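/- arXiv:0706.3221 — 2 statements merged into one kernel-verified Lean document; each statement's English description precedes it below -/
import Mathlib

section
/- Let f : Ω → ℝ³ be a smooth conjugate net without parabolic points, defined on an open set Ω ⊆ ℝ² containing the closed square [0,1]². Then there exist constants C₀ > 0 and ε₀ > 0 such that for every 0 < ε < ε₀, setting N = ⌊1/ε⌋, there exists a map g : {0, …, N} × {0, …, N} → ℝ³ with the following three properties: (i) every value g(i, j) lies in the image f(Ω); (ii) for all 0 ≤ i, j < N the four points g(i, j), g(i+1, j), g(i+1, j+1), g(i, j+1) lie in a common affine plane (each elementary quadrilateral of g is planar, so g is a discrete conjugate net); (iii) ‖g(i, j) − f(iε, jε)‖ ≤ C₀ ε² for all 0 ≤ i, j ≤ N. -/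
open Metric

noncomputable section

/-- Euclidean three-space. -/
abbrev E3 : Type := EuclideanSpace ℝ (Fin 3)

/-- The dot product in `ℝ³`. -/
def dot3 (x y : E3) : ℝ := x 0 * y 0 + x 1 * y 1 + x 2 * y 2

/-- The cross product in `ℝ³`. -/
def cross3 (x y : E3) : E3 :=
  (WithLp.equiv 2 (Fin 3 → ℝ)).symm
    ![x 1 * y 2 - x 2 * y 1, x 2 * y 0 - x 0 * y 2, x 0 * y 1 - x 1 * y 0]

/-- Partial derivative in the first coordinate direction. -/
def pd1 (f : ℝ × ℝ → E3) (p : ℝ × ℝ) : E3 := fderiv ℝ f p (1, 0)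

/-- Partial derivative in the second coordinate direction. -/
def pd2 (f : ℝ × ℝ → E3) (p : ℝ × ℝ) : E3 := fderiv ℝ f p (0, 1)

/-- The scalar triple product in `ℝ³`. -/
def trip (x y z : E3) : ℝ := dot3 (cross3 x y) z

lemma trip_eq (x y z : E3) : trip x y z =
    (x 1 * y 2 - x 2 * y 1) * z 0 + (x 2 * y 0 - x 0 * y 2) * z 1
      + (x 0 * y 1 - x 1 * y 0) * z 2 := by
  simp [trip, dot3, cross3]

lemma trip_add₁ (x x' y z : E3) : trip (x + x') y z = trip x y z + trip x' y z := by
  simp only [trip_eq, PiLp.add_apply]; ring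

lemma trip_add₂ (x y y' z : E3) : trip x (y + y') z = trip x y z + trip x y' z := by
  simp only [trip_eq, PiLp.add_apply]; ring

lemma trip_add₃ (x y z z' : E3) : trip x y (z + z') = trip x y z + trip x y z' := by
  simp only [trip_eq, PiLp.add_apply]; ring

lemma trip_sub₁ (x x' y z : E3) : trip (x - x') y z = trip x y z - trip x' y z := by
  simp only [trip_eq, PiLp.sub_apply]; ring

lemma trip_sub₂ (x y y' z : E3) : trip x (y - y') z = trip x y z - trip x y' z := by
  simp only [trip_eq, PiLp.sub_apply]; ring

lemma trip_sub₃ (x y z z' : E3) : trip x y (z - z') = trip x y z - trip x y z' := by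
  simp only [trip_eq, PiLp.sub_apply]; ring

lemma trip_smul₁ (r : ℝ) (x y z : E3) : trip (r • x) y z = r * trip x y z := by
  simp only [trip_eq, PiLp.smul_apply, smul_eq_mul]; ring

lemma trip_smul₂ (r : ℝ) (x y z : E3) : trip x (r • y) z = r * trip x y z := by
  simp only [trip_eq, PiLp.smul_apply, smul_eq_mul]; ring

lemma trip_smul₃ (r : ℝ) (x y z : E3) : trip x y (r • z) = r * trip x y z := by
  simp only [trip_eq, PiLp.smul_apply, smul_eq_mul]; ring

lemma trip_self₁₂ (x z : E3) : trip x x z = 0 := by simp only [trip_eq]; ring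

lemma trip_self₁₃ (x y : E3) : trip x y x = 0 := by simp only [trip_eq]; ring

lemma trip_self₂₃ (x y : E3) : trip x y y = 0 := by simp only [trip_eq]; ring

lemma trip_swap (x y z : E3) : trip y x z = -trip x y z := by simp only [trip_eq]; ring

lemma abs_trip_le (x y z : E3) : |trip x y z| ≤ 6 * (‖x‖ * ‖y‖ * ‖z‖) := by
  have key : ∀ i j k : Fin 3, |x i * y j * z k| ≤ ‖x‖ * ‖y‖ * ‖z‖ := by
    intro i j k
    rw [abs_mul, abs_mul]
    have h1 : |x i| ≤ ‖x‖ := PiLp.norm_apply_le x i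
    have h2 : |y j| ≤ ‖y‖ := PiLp.norm_apply_le y j
    have h3 : |z k| ≤ ‖z‖ := PiLp.norm_apply_le z k
    gcongr
  rw [trip_eq, abs_le]
  have h := fun i j k => abs_le.1 (key i j k)
  constructor <;>
    linarith [h 1 2 0, h 2 1 0, h 2 0 1, h 0 2 1, h 0 1 2, h 1 0 2]

lemma abs_trip_le_of_le {x y z : E3} {X Y Z : ℝ} (hx : ‖x‖ ≤ X) (hy : ‖y‖ ≤ Y)
    (hz : ‖z‖ ≤ Z) : |trip x y z| ≤ 6 * (X * Y * Z) := by
  have hX := (norm_nonneg x).trans hx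
  have hY := (norm_nonneg y).trans hy
  refine (abs_trip_le x y z).trans ?_
  gcongr

lemma continuous_trip {X : Type*} [TopologicalSpace X] {x y z : X → E3} (hx : Continuous x)
    (hy : Continuous y) (hz : Continuous z) : Continuous fun t => trip (x t) (y t) (z t) := by
  simp only [trip_eq]
  fun_prop

lemma contDiff_trip {x y z : ℝ × ℝ → E3} (hx : ContDiff ℝ (⊤ : ℕ∞) x)
    (hy : ContDiff ℝ (⊤ : ℕ∞) y) (hz : ContDiff ℝ (⊤ : ℕ∞) z) :
    ContDiff ℝ (⊤ : ℕ∞) fun t => trip (x t) (y t) (z t) := by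
  simp only [trip_eq]
  have h : ∀ {w : ℝ × ℝ → E3}, ContDiff ℝ (⊤ : ℕ∞) w → ∀ i, ContDiff ℝ (⊤ : ℕ∞) fun t => w t i :=
    fun hw i => (contDiff_piLp 2).1 hw i
  have hx' := h hx
  have hy' := h hy
  have hz' := h hz
  fun_prop

/-- Vectors close to a common plane have a small triple product. -/
lemma abs_trip_le_of_near_plane {x y z x₀ y₀ z₀ : E3} (h₀ : trip x₀ y₀ z₀ = 0)
    {X Y Z X' Y' Z' : ℝ}
    (hx₀ : ‖x₀‖ ≤ X) (hy : ‖y‖ ≤ Y) (hy₀ : ‖y₀‖ ≤ Y) (hz : ‖z‖ ≤ Z)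
    (hx' : ‖x - x₀‖ ≤ X') (hy' : ‖y - y₀‖ ≤ Y') (hz' : ‖z - z₀‖ ≤ Z') :
    |trip x y z| ≤ 6 * (X' * Y * Z) + 6 * (X * Y' * Z) + 6 * (X * Y * Z') := by
  have e : trip x y z = trip (x - x₀) y z + trip x₀ (y - y₀) z + trip x₀ y₀ (z - z₀) := by
    simp only [trip_sub₁, trip_sub₂, trip_sub₃, h₀]; ring
  rw [e]
  refine (abs_add_three _ _ _).trans ?_
  exact add_le_add (add_le_add (abs_trip_le_of_le hx' hy hz) (abs_trip_le_of_le hx₀ hy' hz))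
    (abs_trip_le_of_le hx₀ hy₀ hz')

lemma trip_eq_zero_of_mem_span {e₁ e₂ : E3} (a b c d p q : ℝ) :
    trip (a • e₁ + b • e₂) (c • e₁ + d • e₂) (p • e₁ + q • e₂) = 0 := by
  simp only [trip_eq, PiLp.add_apply, PiLp.smul_apply, smul_eq_mul]; ring

lemma coplanar_of_trip_eq_zero {p q r s : E3}
    (h : trip (r - p) (q - s) (r + p - q - s) = 0) :
    Coplanar ℝ ({p, q, r, s} : Set E3) := by
  obtain ⟨ν, hν, h0⟩ : ∃ ν : Fin 3 → ℝ, ν ≠ 0 ∧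
      Matrix.mulVec !![(q - p) 0, (q - p) 1, (q - p) 2; (r - p) 0, (r - p) 1, (r - p) 2;
        (s - p) 0, (s - p) 1, (s - p) 2] ν = 0 := by
    rw [Matrix.exists_mulVec_eq_zero_iff, Matrix.det_fin_three]
    simp only [trip_eq, PiLp.add_apply, PiLp.sub_apply] at h
    simp
    linarith
  have h1 := congrFun h0 0
  have h2 := congrFun h0 1
  have h3 := congrFun h0 2
  simp [Matrix.mulVec, dotProduct, Fin.sum_univ_three] at h1 h2 h3
  let φ : E3 →ₗ[ℝ] ℝ :=
    { toFun := fun x => ν 0 * x 0 + ν 1 * x 1 + ν 2 * x 2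
      map_add' := fun x y => by simp only [PiLp.add_apply]; ring
      map_smul' := fun c x => by
        simp only [PiLp.smul_apply, smul_eq_mul, RingHom.id_apply]; ring }
  have hle : vectorSpan ℝ ({p, q, r, s} : Set E3) ≤ LinearMap.ker φ := by
    rw [vectorSpan_eq_span_vsub_set_right ℝ (Set.mem_insert p _), Submodule.span_le]
    rintro _ ⟨x, hx, rfl⟩
    simp only [Set.mem_insert_iff, Set.mem_singleton_iff] at hx
    simp only [SetLike.mem_coe, LinearMap.mem_ker, φ, LinearMap.coe_mk, AddHom.coe_mk,
      vsub_eq_sub, PiLp.sub_apply]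
    rcases hx with rfl | rfl | rfl | rfl <;> linarith
  have hlt : Module.finrank ℝ (vectorSpan ℝ ({p, q, r, s} : Set E3)) < 3 := by
    have : Module.finrank ℝ E3 = 3 := finrank_euclideanSpace_fin
    refine lt_of_lt_of_eq (Submodule.finrank_lt ?_) this
    intro htop
    rw [htop] at hle
    have hm : (WithLp.toLp 2 ν : E3) ∈ LinearMap.ker φ := hle Submodule.mem_top
    simp only [LinearMap.mem_ker, φ, LinearMap.coe_mk, AddHom.coe_mk] at hm
    apply hν
    have e0 : ν 0 = 0 := by nlinarith [sq_nonneg (ν 0), sq_nonneg (ν 1), sq_nonneg (ν 2)]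
    have e1 : ν 1 = 0 := by nlinarith [sq_nonneg (ν 0), sq_nonneg (ν 1), sq_nonneg (ν 2)]
    have e2 : ν 2 = 0 := by nlinarith [sq_nonneg (ν 0), sq_nonneg (ν 1), sq_nonneg (ν 2)]
    ext i; fin_cases i <;> simp [e0, e1, e2]
  rw [coplanar_iff_finrank_le_two]
  omega

section SmoothExtension

/-- A function smooth near a compact set agrees near it with a compactly supported smooth one. -/
lemma exists_contDiff_hasCompactSupport_eq {K Ω : Set (ℝ × ℝ)} (hK : IsCompact K)
    (hΩ : IsOpen Ω) (hKΩ : K ⊆ Ω) {f : ℝ × ℝ → E3} (hf : ContDiffOn ℝ (⊤ : ℕ∞) f Ω) :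
    ∃ F : ℝ × ℝ → E3, ContDiff ℝ (⊤ : ℕ∞) F ∧ HasCompactSupport F ∧
      ∃ U : Set (ℝ × ℝ), IsOpen U ∧ K ⊆ U ∧ U ⊆ Ω ∧ ∀ x ∈ U, F x = f x := by
  obtain ⟨t, ht, hKt, htΩ⟩ := exists_compact_between hK hΩ hKΩ
  obtain ⟨χ, hχ1, hχ0, -⟩ := exists_contMDiffMap_one_nhds_of_subset_interior
    (n := (⊤ : ℕ∞)) (modelWithCornersSelf ℝ (ℝ × ℝ)) hK.isClosed hKt
  have hχ : ContDiff ℝ (⊤ : ℕ∞) χ := χ.contMDiff.contDiff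
  refine ⟨fun x => χ x • f x, ?_, ?_, ?_⟩
  · rw [contDiff_iff_contDiffAt]
    intro x
    by_cases hx : x ∈ t
    · exact hχ.contDiffAt.smul (hf.contDiffAt (hΩ.mem_nhds (htΩ hx)))
    · have : (fun x => χ x • f x) =ᶠ[nhds x] fun _ => 0 := by
        filter_upwards [ht.isClosed.isOpen_compl.mem_nhds hx] with y hy
        simp [hχ0 y hy]
      exact contDiffAt_const.congr_of_eventuallyEq this
  · exact HasCompactSupport.intro ht fun x hx => by simp [hχ0 x hx]
  · obtain ⟨U, hU, hKU, hU1⟩ := eventually_nhdsSet_iff_exists.1 hχ1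
    refine ⟨U ∩ Ω, hU.inter hΩ, Set.subset_inter hKU hKΩ, Set.inter_subset_right, ?_⟩
    intro x hx
    simp [hU1 x hx.1]

end SmoothExtension

section Taylor

variable {G : Type*} [NormedAddCommGroup G] [NormedSpace ℝ G]

/-- The directional derivative of `F` in the direction `h`. -/
def dirDeriv (h : ℝ × ℝ) (F : ℝ × ℝ → G) : ℝ × ℝ → G := fun p => fderiv ℝ F p h

lemma contDiff_dirDeriv {F : ℝ × ℝ → G} (hF : ContDiff ℝ (⊤ : ℕ∞) F) (h : ℝ × ℝ) :
    ContDiff ℝ (⊤ : ℕ∞) (dirDeriv h F) :=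
  (hF.fderiv_right (m := (⊤ : ℕ∞)) (by simp)).clm_apply contDiff_const

lemma hasCompactSupport_dirDeriv {F : ℝ × ℝ → G} (hF : HasCompactSupport F) (h : ℝ × ℝ) :
    HasCompactSupport (dirDeriv h F) :=
  hF.fderiv_apply ℝ h

lemma contDiff_iterate_dirDeriv {F : ℝ × ℝ → G} (hF : ContDiff ℝ (⊤ : ℕ∞) F) (h : ℝ × ℝ)
    (n : ℕ) : ContDiff ℝ (⊤ : ℕ∞) ((dirDeriv h)^[n] F) := by
  induction n with
  | zero => exact hF
  | succ n ih => rw [Function.iterate_succ_apply']; exact contDiff_dirDeriv ih h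

lemma hasCompactSupport_iterate_dirDeriv {F : ℝ × ℝ → G} (hF : HasCompactSupport F) (h : ℝ × ℝ)
    (n : ℕ) : HasCompactSupport ((dirDeriv h)^[n] F) := by
  induction n with
  | zero => exact hF
  | succ n ih => rw [Function.iterate_succ_apply']; exact hasCompactSupport_dirDeriv ih h

/-- Taylor's theorem along a line, with a remainder uniform in the base point. -/
lemma exists_taylor_bound (h : ℝ × ℝ) (n : ℕ) {F : ℝ × ℝ → G} (hF : ContDiff ℝ (⊤ : ℕ∞) F)
    (hc : HasCompactSupport F) :
    ∃ C : ℝ, ∀ p : ℝ × ℝ, ∀ τ : ℝ,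
      ‖F (p + τ • h) - ∑ k ∈ Finset.range n, (τ ^ k / k.factorial) • (dirDeriv h)^[k] F p‖
        ≤ C * |τ| ^ n := by
  induction n generalizing F with
  | zero =>
    obtain ⟨C, hC⟩ := hc.exists_bound_of_continuous hF.continuous
    exact ⟨C, fun p τ => by simpa using hC _⟩
  | succ n ih =>
    obtain ⟨C, hC⟩ := ih (contDiff_dirDeriv hF h) (hasCompactSupport_dirDeriv hc h)
    refine ⟨C, fun p τ => ?_⟩
    set r : ℝ → G := fun t => F (p + t • h) -
      ∑ k ∈ Finset.range (n + 1), (t ^ k / k.factorial) • (dirDeriv h)^[k] F p with hr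
    set r' : ℝ → G := fun t => dirDeriv h F (p + t • h) -
      ∑ k ∈ Finset.range n, (t ^ k / k.factorial) • (dirDeriv h)^[k] (dirDeriv h F) p with hr'
    have hd : ∀ t, HasDerivAt r (r' t) t := by
      intro t
      have h1 : HasDerivAt (fun t : ℝ => F (p + t • h)) (dirDeriv h F (p + t • h)) t := by
        have := ((hF.differentiable (by simp)) (p + t • h)).hasFDerivAt
        have hl : HasDerivAt (fun t : ℝ => p + t • h) h t := by
          simpa using ((hasDerivAt_id t).smul_const h).const_add p
        exact this.comp_hasDerivAt t hl
      have h2 : HasDerivAt (fun t : ℝ => ∑ k ∈ Finset.range (n + 1),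
          (t ^ k / k.factorial) • (dirDeriv h)^[k] F p)
          (∑ k ∈ Finset.range n, (t ^ k / k.factorial) • (dirDeriv h)^[k] (dirDeriv h F) p) t := by
        simp only [Finset.sum_range_succ' _ n]
        rw [← add_zero (∑ k ∈ Finset.range n, _)]
        refine HasDerivAt.add (HasDerivAt.fun_sum fun k _ => ?_) ?_
        · have := (((hasDerivAt_pow (k + 1) t).div_const ((k + 1).factorial : ℝ)).smul_const
            ((dirDeriv h)^[k + 1] F p))
          convert this using 2
          rw [Nat.factorial_succ]
          have : (k.factorial : ℝ) ≠ 0 := by positivity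
          push_cast
          field_simp
          simp
        · simpa using hasDerivAt_const t ((dirDeriv h)^[0] F p)
      exact h1.sub h2
    have hr0 : r 0 = 0 := by
      simp [hr, Finset.sum_range_succ']
    have hb : ∀ t ∈ Set.uIcc 0 τ, ‖r' t‖ ≤ C * |τ| ^ n := by
      intro t ht
      have ht' : |t| ≤ |τ| := by
        simpa using Set.abs_sub_left_of_mem_uIcc ht
      have hC0 : 0 ≤ C := by
        have := (norm_nonneg _).trans (hC p 1)
        simpa using this
      exact (hC p t).trans (by gcongr)
    have := (convex_uIcc (0 : ℝ) τ).norm_image_sub_le_of_norm_hasDerivWithin_le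
      (fun t _ => (hd t).hasDerivWithinAt) hb Set.left_mem_uIcc Set.right_mem_uIcc
    rw [hr0, sub_zero, sub_zero] at this
    calc ‖r τ‖ ≤ C * |τ| ^ n * ‖τ‖ := this
      _ = C * |τ| ^ (n + 1) := by rw [Real.norm_eq_abs]; ring

/-- Lipschitz and derivative bounds, and first-order Taylor expansion with quadratic remainder. -/
lemma exists_lipschitz_taylor_bound {F : ℝ × ℝ → G} (hF : ContDiff ℝ (⊤ : ℕ∞) F)
    (hc : HasCompactSupport F) :
    ∃ C : ℝ, 0 ≤ C ∧ (∀ x y, ‖F x - F y‖ ≤ C * ‖x - y‖) ∧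
      (∀ c v, ‖fderiv ℝ F c v‖ ≤ C * ‖v‖) ∧
        ∀ c x, ‖F x - F c - fderiv ℝ F c (x - c)‖ ≤ C * ‖x - c‖ ^ 2 := by
  obtain ⟨C₁, h₁⟩ := ContDiff.lipschitzWith_of_hasCompactSupport hc hF (by simp)
  obtain ⟨C₂, h₂⟩ := ContDiff.lipschitzWith_of_hasCompactSupport (hc.fderiv ℝ)
    (hF.fderiv_right (m := (⊤ : ℕ∞)) (by simp)) (by simp)
  refine ⟨C₁ + C₂, by positivity, fun x y => ?_, fun c v => ?_, fun c x => ?_⟩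
  · refine (h₁.norm_sub_le x y).trans ?_
    gcongr
    simp
  · refine ((fderiv ℝ F c).le_of_opNorm_le (norm_fderiv_le_of_lipschitz ℝ h₁) v).trans ?_
    gcongr
    simp
  · have := (convex_closedBall c ‖x - c‖).norm_image_sub_le_of_norm_fderiv_le'
      (f := F) (φ := fderiv ℝ F c) (C := C₂ * ‖x - c‖) (𝕜 := ℝ)
      (fun y _ => hF.differentiable (by simp) y) (fun y hy => ?_)
      (x := c) (y := x) (by simp) (by simp [dist_eq_norm])
    · refine this.trans ?_
      rw [mul_assoc, ← sq]
      gcongr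
      simp
    · refine (h₂.norm_sub_le y c).trans ?_
      gcongr
      simpa [dist_eq_norm] using hy

/-- Mean value inequality for the deviation of `F` from a linear map. -/
lemma norm_increment_sub_le {F : ℝ × ℝ → G} (hF : ContDiff ℝ (⊤ : ℕ∞) F) (x δ : ℝ × ℝ)
    (φ : (ℝ × ℝ) →L[ℝ] G) (B : ℝ) (hB : ∀ θ : ℝ × ℝ, ‖θ‖ ≤ ‖δ‖ → ‖fderiv ℝ F (x + θ) - φ‖ ≤ B) :
    ‖F (x + δ) - F x - φ δ‖ ≤ B * ‖δ‖ := by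
  have := (convex_closedBall x ‖δ‖).norm_image_sub_le_of_norm_fderiv_le'
    (f := F) (φ := φ) (C := B) (𝕜 := ℝ)
    (fun y _ => hF.differentiable (by simp) y) (fun y hy => ?_)
    (x := x) (y := x + δ) (by simp) (by simp [dist_eq_norm])
  · simpa using this
  · have := hB (y - x) (by simpa [dist_eq_norm] using hy)
    simpa using this

/-- Second-order expansion of the increment of `F` between two points near `c`. -/
lemma exists_increment_bound {F : ℝ × ℝ → G} (hF : ContDiff ℝ (⊤ : ℕ∞) F)
    (hc : HasCompactSupport F) :
    ∃ C : ℝ, 0 ≤ C ∧ ∀ c h δ : ℝ × ℝ,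
      ‖F (c + h + δ) - F (c + h)‖ ≤ C * ‖δ‖ ∧
      ‖F (c + h + δ) - F (c + h) - fderiv ℝ F c δ‖ ≤ C * (‖h‖ + ‖δ‖) * ‖δ‖ ∧
      ‖F (c + h + δ) - F (c + h) - fderiv ℝ F c δ - fderiv ℝ (fderiv ℝ F) c h δ‖
        ≤ C * ((‖h‖ + ‖δ‖) ^ 2 + ‖δ‖) * ‖δ‖ := by
  obtain ⟨C₀, hC₀, h₀, -, -⟩ := exists_lipschitz_taylor_bound hF hc
  have hF' : ContDiff ℝ (⊤ : ℕ∞) (fderiv ℝ F) := hF.fderiv_right (m := (⊤ : ℕ∞)) (by simp)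
  obtain ⟨C₁, hC₁, h₁, h₂, h₁'⟩ := exists_lipschitz_taylor_bound hF' (hc.fderiv ℝ)
  refine ⟨C₀ + 2 * C₁, by positivity, fun c h δ => ⟨?_, ?_, ?_⟩⟩
  · have := h₀ (c + h + δ) (c + h)
    rw [add_sub_cancel_left] at this
    refine this.trans ?_
    gcongr
    linarith
  · refine norm_increment_sub_le hF (c + h) δ _ _ fun θ hθ => ?_
    refine (h₁ _ _).trans ?_
    have : ‖c + h + θ - c‖ ≤ ‖h‖ + ‖δ‖ := by
      rw [add_assoc, add_sub_cancel_left]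
      exact (norm_add_le _ _).trans (by gcongr)
    gcongr
    linarith
  · rw [sub_sub, ← _root_.add_apply]
    refine norm_increment_sub_le hF (c + h) δ _ _ fun θ hθ => ?_
    have e : fderiv ℝ F (c + h + θ) - (fderiv ℝ F c + fderiv ℝ (fderiv ℝ F) c h) =
        (fderiv ℝ F (c + h + θ) - fderiv ℝ F c - fderiv ℝ (fderiv ℝ F) c (c + h + θ - c))
          + fderiv ℝ (fderiv ℝ F) c θ := by
      rw [add_assoc c h θ, add_sub_cancel_left, map_add]; abel
    rw [e]
    refine (norm_add_le _ _).trans ?_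
    have : ‖c + h + θ - c‖ ≤ ‖h‖ + ‖δ‖ := by
      rw [add_assoc, add_sub_cancel_left]
      exact (norm_add_le _ _).trans (by gcongr)
    have t1 : C₁ * ‖c + h + θ - c‖ ^ 2 ≤ C₁ * (‖h‖ + ‖δ‖) ^ 2 := by gcongr
    have t2 : ‖fderiv ℝ (fderiv ℝ F) c θ‖ ≤ C₁ * ‖δ‖ :=
      (h₂ c θ).trans (by gcongr)
    have t3 := h₁' c (c + h + θ)
    have q1 : 0 ≤ (‖h‖ + ‖δ‖) ^ 2 := by positivity
    have q2 := norm_nonneg δ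
    nlinarith [mul_nonneg hC₀ q1, mul_nonneg hC₁ q1, mul_nonneg hC₀ q2, mul_nonneg hC₁ q2]

end Taylor

section TripleProductEstimates

/-- Sixth-order expansion of the triple product of the two diagonals and the second mixed
difference of an undisplaced quadrilateral. -/
lemma abs_trip_sub_le_of_expansion {F₁ F₂ m G₁ G₂ H D₁ D₂ M : E3} {ε C : ℝ} (hε : 0 < ε)
    (hε1 : ε ≤ 1) (h0 : trip F₁ F₂ m = 0) (hF₁ : ‖F₁‖ ≤ C) (hF₂ : ‖F₂‖ ≤ C) (hm : ‖m‖ ≤ C)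
    (hG₁ : ‖G₁‖ ≤ C) (hG₂ : ‖G₂‖ ≤ C) (hH : ‖H‖ ≤ C)
    (hD₁ : ‖D₁ - ε • F₁ - ε ^ 3 • G₁‖ ≤ C * ε ^ 5) (hD₂ : ‖D₂ - ε • F₂ - ε ^ 3 • G₂‖ ≤ C * ε ^ 5)
    (hM : ‖M - ε ^ 2 • m - ε ^ 4 • H‖ ≤ C * ε ^ 5) :
    |trip D₁ D₂ M - ε ^ 6 * (trip G₁ F₂ m + trip F₁ G₂ m + trip F₁ F₂ H)|
      ≤ 138 * (C ^ 3 * ε ^ 7) := by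
  have hC : 0 ≤ C := (norm_nonneg _).trans hF₁
  obtain ⟨E₁, rfl⟩ : ∃ E, D₁ = ε • F₁ + ε ^ 3 • G₁ + E :=
    ⟨D₁ - ε • F₁ - ε ^ 3 • G₁, by abel⟩
  obtain ⟨E₂, rfl⟩ : ∃ E, D₂ = ε • F₂ + ε ^ 3 • G₂ + E :=
    ⟨D₂ - ε • F₂ - ε ^ 3 • G₂, by abel⟩
  obtain ⟨E₃, rfl⟩ : ∃ E, M = ε ^ 2 • m + ε ^ 4 • H + E :=
    ⟨M - ε ^ 2 • m - ε ^ 4 • H, by abel⟩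
  have hE₁ : ‖E₁‖ ≤ C * ε ^ 5 := by
    rwa [show ε • F₁ + ε ^ 3 • G₁ + E₁ - ε • F₁ - ε ^ 3 • G₁ = E₁ by abel] at hD₁
  have hE₂ : ‖E₂‖ ≤ C * ε ^ 5 := by
    rwa [show ε • F₂ + ε ^ 3 • G₂ + E₂ - ε • F₂ - ε ^ 3 • G₂ = E₂ by abel] at hD₂
  have hE₃ : ‖E₃‖ ≤ C * ε ^ 5 := by
    rwa [show ε ^ 2 • m + ε ^ 4 • H + E₃ - ε ^ 2 • m - ε ^ 4 • H = E₃ by abel] at hM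
  have pw : ∀ {a b : ℕ}, b ≤ a → C * ε ^ a ≤ C * ε ^ b := fun h =>
    mul_le_mul_of_nonneg_left (pow_le_pow_of_le_one hε.le hε1 h) hC
  have nsm : ∀ (k : ℕ) (v : E3), ‖v‖ ≤ C → ‖ε ^ k • v‖ ≤ C * ε ^ k := by
    intro k v hv
    rw [norm_smul, Real.norm_of_nonneg (by positivity), mul_comm]
    gcongr
  have lead : ∀ {a b : ℕ} {u v : E3}, a ≤ b → ‖u‖ ≤ C → ‖v‖ ≤ C →
      ‖ε ^ a • u + ε ^ b • v‖ ≤ 2 * C * ε ^ a := by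
    intro a b u v hab hu hv
    have := norm_add_le (ε ^ a • u) (ε ^ b • v)
    linarith [nsm a u hu, nsm b v hv, pw hab]
  have a₁ : ‖ε • F₁ + ε ^ 3 • G₁‖ ≤ 2 * C * ε := by
    simpa using lead (a := 1) (b := 3) (by norm_num) hF₁ hG₁
  have a₂ : ‖ε • F₂ + ε ^ 3 • G₂‖ ≤ 2 * C * ε := by
    simpa using lead (a := 1) (b := 3) (by norm_num) hF₂ hG₂
  have a₃ : ‖ε ^ 2 • m + ε ^ 4 • H‖ ≤ 2 * C * ε ^ 2 := lead (by norm_num) hm hH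
  have b₂ : ‖ε • F₂ + ε ^ 3 • G₂ + E₂‖ ≤ 3 * C * ε := by
    have := norm_add_le (ε • F₂ + ε ^ 3 • G₂) E₂
    have := pw (a := 5) (b := 1) (by norm_num)
    rw [pow_one] at this
    linarith
  have b₃ : ‖ε ^ 2 • m + ε ^ 4 • H + E₃‖ ≤ 3 * C * ε ^ 2 := by
    have := norm_add_le (ε ^ 2 • m + ε ^ 4 • H) E₃
    have := pw (a := 5) (b := 2) (by norm_num)
    linarith
  have e : trip (ε • F₁ + ε ^ 3 • G₁ + E₁) (ε • F₂ + ε ^ 3 • G₂ + E₂)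
        (ε ^ 2 • m + ε ^ 4 • H + E₃)
      - ε ^ 6 * (trip G₁ F₂ m + trip F₁ G₂ m + trip F₁ F₂ H) =
      trip E₁ (ε • F₂ + ε ^ 3 • G₂ + E₂) (ε ^ 2 • m + ε ^ 4 • H + E₃)
      + trip (ε • F₁ + ε ^ 3 • G₁) E₂ (ε ^ 2 • m + ε ^ 4 • H + E₃)
      + trip (ε • F₁ + ε ^ 3 • G₁) (ε • F₂ + ε ^ 3 • G₂) E₃
      + ε ^ 8 * (trip G₁ G₂ m + trip G₁ F₂ H + trip F₁ G₂ H) + ε ^ 10 * trip G₁ G₂ H := by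
    simp only [trip_add₁, trip_add₂, trip_add₃, trip_smul₁, trip_smul₂, trip_smul₃]
    linear_combination ε ^ 4 * h0
  have t₁ := abs_trip_le_of_le hE₁ b₂ b₃
  have t₂ := abs_trip_le_of_le a₁ hE₂ b₃
  have t₃ := abs_trip_le_of_le a₁ a₂ hE₃
  have q₁ := abs_trip_le_of_le hG₁ hG₂ hm
  have q₂ := abs_trip_le_of_le hG₁ hF₂ hH
  have q₃ := abs_trip_le_of_le hF₁ hG₂ hH
  have q₄ := abs_trip_le_of_le hG₁ hG₂ hH
  rw [e]
  have C3 : 0 ≤ C ^ 3 := by positivity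
  have p87 : C ^ 3 * ε ^ 8 ≤ C ^ 3 * ε ^ 7 :=
    mul_le_mul_of_nonneg_left (pow_le_pow_of_le_one hε.le hε1 (by norm_num)) C3
  have p107 : C ^ 3 * ε ^ 10 ≤ C ^ 3 * ε ^ 7 :=
    mul_le_mul_of_nonneg_left (pow_le_pow_of_le_one hε.le hε1 (by norm_num)) C3
  have s₄ : |ε ^ 8 * (trip G₁ G₂ m + trip G₁ F₂ H + trip F₁ G₂ H)| ≤ ε ^ 8 * (18 * C ^ 3) := by
    rw [abs_mul, abs_of_nonneg (by positivity : 0 ≤ ε ^ 8)]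
    gcongr
    refine (abs_add_three _ _ _).trans ?_
    nlinarith
  have s₅ : |ε ^ 10 * trip G₁ G₂ H| ≤ ε ^ 10 * (6 * C ^ 3) := by
    rw [abs_mul, abs_of_nonneg (by positivity : 0 ≤ ε ^ 10)]
    gcongr
    linarith [q₄]
  refine (abs_add_le _ _).trans ?_
  refine (add_le_add ((abs_add_le _ _).trans (add_le_add (abs_add_three _ _ _) le_rfl))
    le_rfl).trans ?_
  have f₁ : 6 * (C * ε ^ 5 * (3 * C * ε) * (3 * C * ε ^ 2)) = 54 * (C ^ 3 * ε ^ 8) := by ring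
  have f₂ : 6 * (2 * C * ε * (C * ε ^ 5) * (3 * C * ε ^ 2)) = 36 * (C ^ 3 * ε ^ 8) := by ring
  have f₃ : 6 * (2 * C * ε * (2 * C * ε) * (C * ε ^ 5)) = 24 * (C ^ 3 * ε ^ 7) := by ring
  linarith

open Submodule in
/-- First-order effect of displacing the vertices of a quadrilateral: only the displacement `Y` of
the second mixed difference matters to leading order. -/
lemma abs_trip_displaced_sub_le {u v m D₁ D₂ M X₁ X₂ Y x₁ x₂ y : E3} {ε μ C : ℝ} (hε : 0 < ε)
    (hε1 : ε ≤ 1) (hμ : μ ≤ ε ^ 2) (hu : ‖u‖ ≤ C) (hv : ‖v‖ ≤ C)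
    (hm : ‖m‖ ≤ C) (hmS : m ∈ span ℝ {u, v})
    (hD₁ : ‖D₁ - ε • (u + v)‖ ≤ C * ε ^ 3) (hD₂ : ‖D₂ - ε • (u - v)‖ ≤ C * ε ^ 3)
    (hM : ‖M - ε ^ 2 • m‖ ≤ C * ε ^ 4)
    (hX₁ : ‖X₁‖ ≤ C * μ) (hX₂ : ‖X₂‖ ≤ C * μ) (hY : ‖Y‖ ≤ C * μ)
    (hx₁ : x₁ ∈ span ℝ {u, v}) (hx₂ : x₂ ∈ span ℝ {u, v}) (hy : y ∈ span ℝ {u, v})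
    (hXx₁ : ‖X₁ - x₁‖ ≤ C * ε * μ) (hXx₂ : ‖X₂ - x₂‖ ≤ C * ε * μ) (hYy : ‖Y - y‖ ≤ C * ε * μ) :
    |trip (D₁ + X₁) (D₂ + X₂) (M + Y) - trip D₁ D₂ M - ε ^ 2 * trip (u + v) (u - v) Y|
      ≤ 390 * (C ^ 3 * μ * ε ^ 4) := by
  have hC : 0 ≤ C := (norm_nonneg _).trans hu
  rcases hC.eq_or_lt with rfl | hC'
  · simp only [zero_mul, norm_le_zero_iff] at *
    subst hX₁ hX₂ hY
    simp [trip_eq]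
  have hμ0 : 0 ≤ μ := nonneg_of_mul_nonneg_right ((norm_nonneg _).trans hY) hC'
  have plane : ∀ {a b c : E3}, a ∈ span ℝ {u, v} → b ∈ span ℝ {u, v} → c ∈ span ℝ {u, v} →
      trip a b c = 0 := by
    intro a b c ha hb hc
    obtain ⟨_, _, rfl⟩ := mem_span_pair.1 ha
    obtain ⟨_, _, rfl⟩ := mem_span_pair.1 hb
    obtain ⟨_, _, rfl⟩ := mem_span_pair.1 hc
    exact trip_eq_zero_of_mem_span _ _ _ _ _ _
  have huS : u ∈ span ℝ {u, v} := subset_span (by simp)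
  have hvS : v ∈ span ℝ {u, v} := subset_span (by simp)
  have ε2 : ε ^ 2 ≤ ε := by nlinarith
  have ε3 : ε ^ 3 ≤ ε ^ 2 := pow_le_pow_of_le_one hε.le hε1 (by norm_num)
  have ε4 : ε ^ 4 ≤ ε ^ 3 := pow_le_pow_of_le_one hε.le hε1 (by norm_num)
  have Cε2 : C * ε ^ 2 ≤ C * ε := mul_le_mul_of_nonneg_left ε2 hC
  have Cε3 : C * ε ^ 3 ≤ C * ε ^ 2 := mul_le_mul_of_nonneg_left ε3 hC
  have Cε4 : C * ε ^ 4 ≤ C * ε ^ 3 := mul_le_mul_of_nonneg_left ε4 hC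
  have Cμ : C * μ ≤ C * ε ^ 2 := mul_le_mul_of_nonneg_left hμ hC
  have Cεμ : C * ε * μ ≤ C * ε ^ 3 := by
    calc C * ε * μ ≤ C * ε * ε ^ 2 := by gcongr
      _ = C * ε ^ 3 := by ring
  have Cεμ' : C * ε * μ ≤ C * μ := by
    calc C * ε * μ ≤ C * 1 * μ := by gcongr
      _ = C * μ := by ring
  have nF₁ : ‖u + v‖ ≤ 2 * C := (norm_add_le _ _).trans (by linarith)
  have nF₂ : ‖u - v‖ ≤ 2 * C := (norm_sub_le _ _).trans (by linarith)
  have nεF₁ : ‖ε • (u + v)‖ ≤ 2 * C * ε := by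
    rw [norm_smul, Real.norm_of_nonneg hε.le]; nlinarith
  have nεF₂ : ‖ε • (u - v)‖ ≤ 2 * C * ε := by
    rw [norm_smul, Real.norm_of_nonneg hε.le]; nlinarith
  have nεm : ‖ε ^ 2 • m‖ ≤ C * ε ^ 2 := by
    rw [norm_smul, Real.norm_of_nonneg (by positivity), mul_comm]; gcongr
  have nD₁ : ‖D₁‖ ≤ 3 * C * ε := by
    linarith [norm_le_norm_add_norm_sub' D₁ (ε • (u + v))]
  have nD₂ : ‖D₂‖ ≤ 3 * C * ε := by
    linarith [norm_le_norm_add_norm_sub' D₂ (ε • (u - v))]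
  have nM : ‖M‖ ≤ 2 * C * ε ^ 2 := by
    linarith [norm_le_norm_add_norm_sub' M (ε ^ 2 • m)]
  have nMY : ‖M + Y‖ ≤ 3 * C * ε ^ 2 := (norm_add_le _ _).trans (by linarith)
  have nDX : ‖D₂ + X₂‖ ≤ 4 * C * ε := (norm_add_le _ _).trans (by linarith)
  have nx₁ : ‖x₁‖ ≤ 2 * C * μ := by
    have := norm_le_norm_add_norm_sub X₁ x₁
    linarith
  have nx₂ : ‖x₂‖ ≤ 2 * C * μ := by
    have := norm_le_norm_add_norm_sub X₂ x₂
    linarith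
  have nFx : ‖ε • (u - v) + x₂‖ ≤ 4 * C * ε := (norm_add_le _ _).trans (by linarith)
  have dDX : ‖D₂ + X₂ - (ε • (u - v) + x₂)‖ ≤ 2 * C * ε ^ 3 := by
    rw [add_sub_add_comm]
    exact (norm_add_le _ _).trans (by linarith)
  have dMY : ‖M + Y - (ε ^ 2 • m + y)‖ ≤ 2 * C * ε ^ 3 := by
    rw [add_sub_add_comm]
    exact (norm_add_le _ _).trans (by linarith)
  have t₁ := abs_trip_le_of_near_plane
    (plane hx₁ (add_mem (smul_mem _ ε (sub_mem huS hvS)) hx₂) (add_mem (smul_mem _ (ε ^ 2) hmS) hy))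
    nx₁ nDX nFx nMY hXx₁ dDX dMY
  have t₂ := abs_trip_le_of_near_plane
    (plane (smul_mem _ ε (add_mem huS hvS)) hx₂ (add_mem (smul_mem _ (ε ^ 2) hmS) hy))
    nεF₁ (hX₂.trans (by nlinarith : C * μ ≤ 2 * C * μ)) nx₂ nMY hD₁ hXx₂ dMY
  have t₃ := abs_trip_le_of_le hD₁ nD₂ hY
  have t₄ := abs_trip_le_of_le nεF₁ hD₂ hY
  have e : trip (D₁ + X₁) (D₂ + X₂) (M + Y) - trip D₁ D₂ M - ε ^ 2 * trip (u + v) (u - v) Y =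
      trip X₁ (D₂ + X₂) (M + Y) + trip D₁ X₂ (M + Y) + trip (D₁ - ε • (u + v)) D₂ Y
        + trip (ε • (u + v)) (D₂ - ε • (u - v)) Y := by
    simp only [trip_add₁, trip_add₂, trip_add₃, trip_sub₁, trip_sub₂, trip_smul₁, trip_smul₂]
    ring
  rw [e]
  refine (abs_add_le _ _).trans ((add_le_add (abs_add_three _ _ _) le_rfl).trans ?_)
  have C3 : 0 ≤ C ^ 3 * μ := by positivity
  have p54 : C ^ 3 * μ * ε ^ 5 ≤ C ^ 3 * μ * ε ^ 4 :=
    mul_le_mul_of_nonneg_left (pow_le_pow_of_le_one hε.le hε1 (by norm_num)) C3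
  have e₁ : 6 * (C * ε * μ * (4 * C * ε) * (3 * C * ε ^ 2)) + 6 * (2 * C * μ * (2 * C * ε ^ 3)
      * (3 * C * ε ^ 2)) + 6 * (2 * C * μ * (4 * C * ε) * (2 * C * ε ^ 3)) =
      168 * (C ^ 3 * μ * ε ^ 4) + 72 * (C ^ 3 * μ * ε ^ 5) := by ring
  have e₂ : 6 * (C * ε ^ 3 * (2 * C * μ) * (3 * C * ε ^ 2)) + 6 * (2 * C * ε * (C * ε * μ)
      * (3 * C * ε ^ 2)) + 6 * (2 * C * ε * (2 * C * μ) * (2 * C * ε ^ 3)) =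
      84 * (C ^ 3 * μ * ε ^ 4) + 36 * (C ^ 3 * μ * ε ^ 5) := by ring
  have e₃ : 6 * (C * ε ^ 3 * (3 * C * ε) * (C * μ)) = 18 * (C ^ 3 * μ * ε ^ 4) := by ring
  have e₄ : 6 * (2 * C * ε * (C * ε ^ 3) * (C * μ)) = 12 * (C ^ 3 * μ * ε ^ 4) := by ring
  linarith

end TripleProductEstimates

section QuadEstimate

lemma exists_symm_expansion {G : Type*} [NormedAddCommGroup G] [NormedSpace ℝ G] (h : ℝ × ℝ)
    {F : ℝ × ℝ → G} (hF : ContDiff ℝ (⊤ : ℕ∞) F) (hc : HasCompactSupport F) :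
    ∃ C : ℝ, 0 ≤ C ∧ ∀ (p : ℝ × ℝ) (τ : ℝ), 0 ≤ τ →
      ‖F (p + τ • h) - F (p - τ • h) - (2 * τ) • dirDeriv h F p
        - (τ ^ 3 / 3) • (dirDeriv h)^[3] F p‖ ≤ C * τ ^ 5 ∧
      ‖F (p + τ • h) + F (p - τ • h) - (2 : ℝ) • F p - τ ^ 2 • (dirDeriv h)^[2] F p
        - (τ ^ 4 / 12) • (dirDeriv h)^[4] F p‖ ≤ C * τ ^ 5 := by
  obtain ⟨C, hC⟩ := exists_taylor_bound h 5 hF hc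
  have hC0 : 0 ≤ C := by simpa using (norm_nonneg _).trans (hC 0 1)
  refine ⟨2 * C, by positivity, fun p τ hτ => ?_⟩
  have h₁ := hC p τ
  have h₂ := hC p (-τ)
  rw [neg_smul, ← sub_eq_add_neg] at h₂
  simp only [abs_neg, abs_of_nonneg hτ] at h₁ h₂
  constructor
  · refine le_trans (le_of_eq ?_) ((norm_sub_le_of_le h₁ h₂).trans (by linarith))
    congr 1
    simp only [Finset.sum_range_succ, Finset.sum_range_zero, Nat.factorial]
    simp only [Function.iterate_succ, Function.iterate_zero, Function.comp, id]
    push_cast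
    module
  · refine le_trans (le_of_eq ?_) ((norm_add_le_of_le h₁ h₂).trans (by linarith))
    congr 1
    simp only [Finset.sum_range_succ, Finset.sum_range_zero, Nat.factorial]
    simp only [Function.iterate_succ, Function.iterate_zero, Function.comp, id]
    push_cast
    module

lemma fderiv_apply_eq (F : ℝ × ℝ → E3) (c δ : ℝ × ℝ) :
    fderiv ℝ F c δ = δ.1 • pd1 F c + δ.2 • pd2 F c := by
  rw [pd1, pd2, ← map_smul, ← map_smul, ← map_add]
  simp

lemma dirDeriv_dirDeriv {F : ℝ × ℝ → E3} (hF : ContDiff ℝ (⊤ : ℕ∞) F) (h k c : ℝ × ℝ) :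
    dirDeriv h (dirDeriv k F) c = fderiv ℝ (fderiv ℝ F) c h k := by
  have hd : DifferentiableAt ℝ (fderiv ℝ F) c :=
    (hF.fderiv_right (m := (⊤ : ℕ∞)) (by simp)).differentiable (by simp) c
  unfold dirDeriv
  rw [fderiv_clm_apply hd (differentiableAt_const k)]
  simp

lemma fderiv_fderiv_apply_eq {F : ℝ × ℝ → E3} (hF : ContDiff ℝ (⊤ : ℕ∞) F) (c h δ : ℝ × ℝ) :
    fderiv ℝ (fderiv ℝ F) c h δ = (h.1 * δ.1) • pd1 (pd1 F) c
      + (h.1 * δ.2 + h.2 * δ.1) • pd2 (pd1 F) c + (h.2 * δ.2) • pd2 (pd2 F) c := by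
  have symm := (hF.contDiffAt (x := c)).isSymmSndFDerivAt (by
    rw [minSmoothness_of_isRCLikeNormedField]
    exact WithTop.coe_le_coe.2 (le_top : (2 : ℕ∞) ≤ ⊤))
  have e₁ : pd1 (pd1 F) c = fderiv ℝ (fderiv ℝ F) c (1, 0) (1, 0) := dirDeriv_dirDeriv hF _ _ c
  have e₂ : pd2 (pd1 F) c = fderiv ℝ (fderiv ℝ F) c (0, 1) (1, 0) := dirDeriv_dirDeriv hF _ _ c
  have e₃ : pd2 (pd2 F) c = fderiv ℝ (fderiv ℝ F) c (0, 1) (0, 1) := dirDeriv_dirDeriv hF _ _ c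
  have e₄ : fderiv ℝ (fderiv ℝ F) c (1, 0) (0, 1) = fderiv ℝ (fderiv ℝ F) c (0, 1) (1, 0) :=
    symm _ _
  have hh : h = h.1 • ((1 : ℝ), (0 : ℝ)) + h.2 • ((0 : ℝ), (1 : ℝ)) := by simp
  have hδ : δ = δ.1 • ((1 : ℝ), (0 : ℝ)) + δ.2 • ((0 : ℝ), (1 : ℝ)) := by simp
  rw [e₁, e₂, e₃]
  conv_lhs => rw [hh, hδ]
  generalize fderiv ℝ (fderiv ℝ F) c = S at *
  simp only [map_add, map_smul, _root_.add_apply, _root_.smul_apply, e₄]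
  module

/-- The diagonal directions. -/
abbrev diagPlus : ℝ × ℝ := (1 / 2, 1 / 2)

abbrev diagMinus : ℝ × ℝ := (1 / 2, -1 / 2)

/-- A multiple of the signed volume, measuring the failure of a quadrilateral with vertices on the
surface `F` to be planar. -/
def defect (F : ℝ × ℝ → E3) (p₀₀ p₁₀ p₀₁ p₁₁ : ℝ × ℝ) : ℝ :=
  trip (F p₁₁ - F p₀₀) (F p₁₀ - F p₀₁) (F p₁₁ + F p₀₀ - F p₁₀ - F p₀₁)

/-- Expansion of the defect of an undisplaced square of side `ε` centred at `c`. -/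
lemma exists_square_estimate {F : ℝ × ℝ → E3} (hF : ContDiff ℝ (⊤ : ℕ∞) F)
    (hc : HasCompactSupport F) :
    ∃ R : ℝ × ℝ → ℝ, Continuous R ∧ ∃ K : ℝ, 0 ≤ K ∧ ∀ (c : ℝ × ℝ) (ε : ℝ), 0 < ε → ε ≤ 1 →
      ‖pd1 F c‖ ≤ K ∧ ‖pd2 F c‖ ≤ K ∧ ‖pd2 (pd1 F) c‖ ≤ K ∧
      ‖F (c + ε • diagPlus) - F (c - ε • diagPlus) - ε • (pd1 F c + pd2 F c)‖ ≤ K * ε ^ 3 ∧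
      ‖F (c + ε • diagMinus) - F (c - ε • diagMinus) - ε • (pd1 F c - pd2 F c)‖ ≤ K * ε ^ 3 ∧
      ‖F (c + ε • diagPlus) + F (c - ε • diagPlus) - F (c + ε • diagMinus)
        - F (c - ε • diagMinus) - ε ^ 2 • pd2 (pd1 F) c‖ ≤ K * ε ^ 4 ∧
      (pd2 (pd1 F) c ∈ Submodule.span ℝ {pd1 F c, pd2 F c} →
        |defect F (c - ε • diagPlus) (c + ε • diagMinus) (c - ε • diagMinus) (c + ε • diagPlus)
          - ε ^ 6 * R c| ≤ 138 * (K ^ 3 * ε ^ 7)) := by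
  have bdd : ∀ h n, ∃ C : ℝ, 0 ≤ C ∧ ∀ c, ‖(dirDeriv h)^[n] F c‖ ≤ C := fun h n => by
    obtain ⟨C, hC⟩ := (hasCompactSupport_iterate_dirDeriv hc h n).exists_bound_of_continuous
      (contDiff_iterate_dirDeriv hF h n).continuous
    exact ⟨C, (norm_nonneg _).trans (hC 0), hC⟩
  obtain ⟨A₁, hA₁, h₁⟩ := bdd (1, 0) 1
  obtain ⟨A₂, hA₂, h₂⟩ := bdd (0, 1) 1
  obtain ⟨A₃, hA₃, h₃⟩ := bdd diagPlus 3
  obtain ⟨A₄, hA₄, h₄⟩ := bdd diagMinus 3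
  obtain ⟨A₅, hA₅, h₅⟩ := bdd diagPlus 4
  obtain ⟨A₆, hA₆, h₆⟩ := bdd diagMinus 4
  obtain ⟨A₇, hA₇, h₇⟩ := bdd diagPlus 2
  obtain ⟨A₈, hA₈, h₈⟩ := bdd diagMinus 2
  obtain ⟨B₁, hB₁, t₁⟩ := exists_symm_expansion diagPlus hF hc
  obtain ⟨B₂, hB₂, t₂⟩ := exists_symm_expansion diagMinus hF hc
  have d₁ : ∀ c, (2 : ℝ) • dirDeriv diagPlus F c = pd1 F c + pd2 F c := fun c => by
    rw [dirDeriv, fderiv_apply_eq]; module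
  have d₂ : ∀ c, (2 : ℝ) • dirDeriv diagMinus F c = pd1 F c - pd2 F c := fun c => by
    rw [dirDeriv, fderiv_apply_eq]; module
  have d₃ : ∀ c, pd2 (pd1 F) c = (dirDeriv diagPlus)^[2] F c - (dirDeriv diagMinus)^[2] F c := by
    intro c
    change _ = dirDeriv _ (dirDeriv _ F) c - dirDeriv _ (dirDeriv _ F) c
    rw [dirDeriv_dirDeriv hF, dirDeriv_dirDeriv hF, fderiv_fderiv_apply_eq hF,
      fderiv_fderiv_apply_eq hF]
    module
  set G₁ : ℝ × ℝ → E3 := fun c => (1 / 3 : ℝ) • (dirDeriv diagPlus)^[3] F c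
  set G₂ : ℝ × ℝ → E3 := fun c => (1 / 3 : ℝ) • (dirDeriv diagMinus)^[3] F c
  set H : ℝ × ℝ → E3 := fun c =>
    (1 / 12 : ℝ) • ((dirDeriv diagPlus)^[4] F c - (dirDeriv diagMinus)^[4] F c)
  set u : ℝ × ℝ → E3 := pd1 F
  set v : ℝ × ℝ → E3 := pd2 F
  set m : ℝ × ℝ → E3 := pd2 u
  have ct := fun h n => (contDiff_iterate_dirDeriv hF h n).continuous
  have cu : Continuous u := ct (1, 0) 1
  have cv : Continuous v := ct (0, 1) 1
  have cm : Continuous m := by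
    rw [show m = fun c => (dirDeriv diagPlus)^[2] F c - (dirDeriv diagMinus)^[2] F c from
      funext d₃]
    exact (ct _ 2).sub (ct _ 2)
  have cG₁ : Continuous G₁ := (ct diagPlus 3).const_smul (1 / 3 : ℝ)
  have cG₂ : Continuous G₂ := (ct diagMinus 3).const_smul (1 / 3 : ℝ)
  have cH : Continuous H := ((ct diagPlus 4).sub (ct diagMinus 4)).const_smul (1 / 12 : ℝ)
  refine ⟨fun c => trip (G₁ c) (u c - v c) (m c) + trip (u c + v c) (G₂ c) (m c)
      + trip (u c + v c) (u c - v c) (H c),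
    ((continuous_trip cG₁ (cu.sub cv) cm).add (continuous_trip (cu.add cv) cG₂ cm)).add
      (continuous_trip (cu.add cv) (cu.sub cv) cH),
    A₁ + A₂ + A₃ + A₄ + A₅ + A₆ + A₇ + A₈ + B₁ + B₂, by positivity, fun c ε hε hε1 => ?_⟩
  have nu : ‖u c‖ ≤ A₁ := h₁ c
  have nv : ‖v c‖ ≤ A₂ := h₂ c
  have nuv := norm_add_le (u c) (v c)
  have nuv' := norm_sub_le (u c) (v c)
  have nm : ‖m c‖ ≤ A₇ + A₈ := by
    rw [d₃ c]; exact norm_sub_le_of_le (h₇ c) (h₈ c)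
  have shrink : ∀ {r A : ℝ} {w : E3}, 0 ≤ r → r ≤ 1 → ‖w‖ ≤ A → ‖r • w‖ ≤ A := by
    intro r A w h0 h1 hw
    rw [norm_smul, Real.norm_of_nonneg h0]
    exact (mul_le_of_le_one_left (norm_nonneg w) h1).trans hw
  have nG₁ : ‖G₁ c‖ ≤ A₃ := shrink (by norm_num) (by norm_num) (h₃ c)
  have nG₂ : ‖G₂ c‖ ≤ A₄ := shrink (by norm_num) (by norm_num) (h₄ c)
  have nH : ‖H c‖ ≤ A₅ + A₆ :=
    shrink (by norm_num) (by norm_num) (norm_sub_le_of_le (h₅ c) (h₆ c))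
  have E₁ : ‖F (c + ε • diagPlus) - F (c - ε • diagPlus) - ε • (u c + v c) - ε ^ 3 • G₁ c‖
      ≤ B₁ * ε ^ 5 := by
    refine le_of_eq_of_le ?_ (t₁ c ε hε.le).1
    rw [← d₁ c]; congr 1; module
  have E₂ : ‖F (c + ε • diagMinus) - F (c - ε • diagMinus) - ε • (u c - v c) - ε ^ 3 • G₂ c‖
      ≤ B₂ * ε ^ 5 := by
    refine le_of_eq_of_le ?_ (t₂ c ε hε.le).1
    rw [← d₂ c]; congr 1; module
  have E₃ : ‖F (c + ε • diagPlus) + F (c - ε • diagPlus) - F (c + ε • diagMinus)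
        - F (c - ε • diagMinus) - ε ^ 2 • m c - ε ^ 4 • H c‖ ≤ (B₁ + B₂) * ε ^ 5 := by
    refine le_of_eq_of_le ?_ ((norm_sub_le_of_le (t₁ c ε hε.le).2 (t₂ c ε hε.le).2).trans_eq
      (add_mul _ _ _).symm)
    rw [d₃ c]; congr 1; module
  set K := A₁ + A₂ + A₃ + A₄ + A₅ + A₆ + A₇ + A₈ + B₁ + B₂
  have strip : ∀ {X g : E3} {A B : ℝ} {k n : ℕ}, k ≤ n → ‖X - ε ^ k • g‖ ≤ B * ε ^ n → ‖g‖ ≤ A →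
      0 ≤ B → A + B ≤ K → ‖X‖ ≤ K * ε ^ k := by
    intro X g A B k n hkn hX hg hB hAB
    have s₁ := norm_le_norm_add_norm_sub' X (ε ^ k • g)
    have s₂ : ‖ε ^ k • g‖ ≤ A * ε ^ k := by
      rw [norm_smul, Real.norm_of_nonneg (by positivity), mul_comm]; gcongr
    have s₃ : B * ε ^ n ≤ B * ε ^ k :=
      mul_le_mul_of_nonneg_left (pow_le_pow_of_le_one hε.le hε1 hkn) hB
    have s₄ : (A + B) * ε ^ k ≤ K * ε ^ k := by gcongr
    linarith
  refine ⟨by linarith, by linarith, by linarith, strip (by norm_num) E₁ nG₁ hB₁ (by linarith),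
    strip (by norm_num) E₂ nG₂ hB₂ (by linarith),
    strip (by norm_num) E₃ nH (by positivity) (by linarith), fun hspan => ?_⟩
  have h0 : trip (u c + v c) (u c - v c) (m c) = 0 := by
    obtain ⟨a, b, hab⟩ := Submodule.mem_span_pair.1 hspan
    rw [← hab]
    simpa [sub_eq_add_neg] using trip_eq_zero_of_mem_span (e₁ := u c) (e₂ := v c) 1 1 1 (-1) a b
  have up : ∀ {B : ℝ}, B ≤ K → B * ε ^ 5 ≤ K * ε ^ 5 := fun h => by gcongr
  have := abs_trip_sub_le_of_expansion (C := K) hε hε1 h0 (by linarith) (by linarith)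
    (by linarith) (by linarith) (by linarith) (by linarith) (E₁.trans (up (by linarith)))
    (E₂.trans (up (by linarith))) (E₃.trans (up (by linarith)))
  exact this

end QuadEstimate

section DisplacedQuad

/-- The second fundamental form coefficient in the first coordinate direction, unnormalised. -/
def coefL (F : ℝ × ℝ → E3) (c : ℝ × ℝ) : ℝ := trip (pd1 F c) (pd2 F c) (pd1 (pd1 F) c)

/-- The second fundamental form coefficient in the second coordinate direction, unnormalised. -/
def coefM (F : ℝ × ℝ → E3) (c : ℝ × ℝ) : ℝ := trip (pd1 F c) (pd2 F c) (pd2 (pd2 F) c)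

/-- The normal component of the displacement of a single vertex. -/
lemma exists_corner_estimate {F : ℝ × ℝ → E3} (hF : ContDiff ℝ (⊤ : ℕ∞) F)
    (hc : HasCompactSupport F) {A : ℝ} (hu : ∀ c, ‖pd1 F c‖ ≤ A) (hv : ∀ c, ‖pd2 F c‖ ≤ A) :
    ∃ K : ℝ, 0 ≤ K ∧ ∀ (c h δ : ℝ × ℝ) (ε μ : ℝ),
      0 < ε → ε ≤ 1 → μ ≤ ε ^ 2 → ‖h‖ ≤ ε → ‖δ‖ ≤ μ →
      ‖F (c + h + δ) - F (c + h)‖ ≤ K * μ ∧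
      ‖F (c + h + δ) - F (c + h) - fderiv ℝ F c δ‖ ≤ K * ε * μ ∧
      (pd2 (pd1 F) c ∈ Submodule.span ℝ {pd1 F c, pd2 F c} →
        |trip (pd1 F c) (pd2 F c) (F (c + h + δ) - F (c + h))
          - (h.1 * δ.1 * coefL F c + h.2 * δ.2 * coefM F c)| ≤ K * ε ^ 2 * μ) := by
  obtain ⟨C, hC, hb⟩ := exists_increment_bound hF hc
  refine ⟨2 * C + 30 * (A ^ 2 * C), by positivity, fun c h δ ε μ hε hε1 hμ hh hδ => ?_⟩
  obtain ⟨b₁, b₂, b₃⟩ := hb c h δ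
  have hμ0 : 0 ≤ μ := (norm_nonneg δ).trans hδ
  have hμε : μ ≤ ε := hμ.trans (by nlinarith)
  have hAC : 0 ≤ A ^ 2 * C := by positivity
  refine ⟨?_, ?_, fun hspan => ?_⟩
  · calc _ ≤ C * ‖δ‖ := b₁
      _ ≤ (2 * C + 30 * (A ^ 2 * C)) * μ := by gcongr; linarith
  · calc _ ≤ C * (‖h‖ + ‖δ‖) * ‖δ‖ := b₂
      _ ≤ C * (ε + ε) * μ := by gcongr; linarith
      _ = 2 * C * ε * μ := by ring
      _ ≤ (2 * C + 30 * (A ^ 2 * C)) * ε * μ := by gcongr; linarith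
  · have e : trip (pd1 F c) (pd2 F c) (F (c + h + δ) - F (c + h))
          - (h.1 * δ.1 * coefL F c + h.2 * δ.2 * coefM F c) =
        trip (pd1 F c) (pd2 F c) (F (c + h + δ) - F (c + h) - fderiv ℝ F c δ
          - fderiv ℝ (fderiv ℝ F) c h δ) := by
      obtain ⟨a, b, hab⟩ := Submodule.mem_span_pair.1 hspan
      rw [fderiv_fderiv_apply_eq hF, fderiv_apply_eq, ← hab]
      simp only [trip_sub₃, trip_add₃, trip_smul₃, coefL, coefM, trip_self₁₃, trip_self₂₃]
      ring
    rw [e]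
    have b₃' : ‖F (c + h + δ) - F (c + h) - fderiv ℝ F c δ - fderiv ℝ (fderiv ℝ F) c h δ‖
        ≤ 5 * C * ε ^ 2 * μ := by
      calc _ ≤ C * ((‖h‖ + ‖δ‖) ^ 2 + ‖δ‖) * ‖δ‖ := b₃
        _ ≤ C * ((ε + ε) ^ 2 + ε ^ 2) * μ := by gcongr <;> linarith
        _ = 5 * C * ε ^ 2 * μ := by ring
    refine (abs_trip_le_of_le (hu c) (hv c) b₃').trans ?_
    have : 0 ≤ 2 * C * ε ^ 2 * μ := by positivity
    linarith

/-- Expansion of the defect of a quadrilateral obtained from a square of side `ε` by displacing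
its vertices in the parameter domain. -/
lemma exists_defect_estimate {F : ℝ × ℝ → E3} (hF : ContDiff ℝ (⊤ : ℕ∞) F)
    (hc : HasCompactSupport F) :
    ∃ R : ℝ × ℝ → ℝ, Continuous R ∧ ∃ K : ℝ, 0 ≤ K ∧
      ∀ (c δ₀₀ δ₁₀ δ₀₁ δ₁₁ : ℝ × ℝ) (ε μ : ℝ),
      pd2 (pd1 F) c ∈ Submodule.span ℝ {pd1 F c, pd2 F c} →
      0 < ε → ε ≤ 1 → μ ≤ ε ^ 2 → ‖δ₀₀‖ ≤ μ → ‖δ₁₀‖ ≤ μ → ‖δ₀₁‖ ≤ μ → ‖δ₁₁‖ ≤ μ →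
      |defect F (c - ε • diagPlus + δ₀₀) (c + ε • diagMinus + δ₁₀) (c - ε • diagMinus + δ₀₁)
          (c + ε • diagPlus + δ₁₁) - ε ^ 6 * R c
        + ε ^ 3 * (coefL F c * (δ₁₁.1 + δ₀₁.1 - δ₁₀.1 - δ₀₀.1)
          + coefM F c * (δ₁₁.2 + δ₁₀.2 - δ₀₁.2 - δ₀₀.2))| ≤ K * (ε ^ 7 + ε ^ 4 * μ) := by
  obtain ⟨R, hR, A, hA, hsq⟩ := exists_square_estimate hF hc
  obtain ⟨B, hB, hcor⟩ := exists_corner_estimate hF hc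
    (fun c => (hsq c 1 one_pos le_rfl).1) (fun c => (hsq c 1 one_pos le_rfl).2.1)
  refine ⟨R, hR, 138 * A ^ 3 + 390 * (A + 4 * B) ^ 3 + 8 * B, by positivity, ?_⟩
  intro c δ₀₀ δ₁₀ δ₀₁ δ₁₁ ε μ hspan hε hε1 hμ n₀₀ n₁₀ n₀₁ n₁₁
  obtain ⟨nu, nv, nm, hD₁, hD₂, hM, hS⟩ := hsq c ε hε hε1
  have hμ0 : 0 ≤ μ := (norm_nonneg δ₀₀).trans n₀₀
  have nP : ‖ε • diagPlus‖ ≤ ε := by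
    rw [norm_smul, Real.norm_of_nonneg hε.le]
    refine mul_le_of_le_one_right hε.le ?_
    norm_num [Prod.norm_def]
  have nM : ‖ε • diagMinus‖ ≤ ε := by
    rw [norm_smul, Real.norm_of_nonneg hε.le]
    refine mul_le_of_le_one_right hε.le ?_
    norm_num [Prod.norm_def]
  obtain ⟨a₁₁, b₁₁, c₁₁⟩ := hcor c (ε • diagPlus) δ₁₁ ε μ hε hε1 hμ nP n₁₁
  obtain ⟨a₀₀, b₀₀, c₀₀⟩ := hcor c (-(ε • diagPlus)) δ₀₀ ε μ hε hε1 hμ (by rwa [norm_neg]) n₀₀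
  obtain ⟨a₁₀, b₁₀, c₁₀⟩ := hcor c (ε • diagMinus) δ₁₀ ε μ hε hε1 hμ nM n₁₀
  obtain ⟨a₀₁, b₀₁, c₀₁⟩ := hcor c (-(ε • diagMinus)) δ₀₁ ε μ hε hε1 hμ (by rwa [norm_neg]) n₀₁
  replace c₁₁ := c₁₁ hspan
  replace c₀₀ := c₀₀ hspan
  replace c₁₀ := c₁₀ hspan
  replace c₀₁ := c₀₁ hspan
  rw [← sub_eq_add_neg] at a₀₀ b₀₀ c₀₀ a₀₁ b₀₁ c₀₁
  set Δ₁₁ := F (c + ε • diagPlus + δ₁₁) - F (c + ε • diagPlus) with hΔ₁₁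
  set Δ₀₀ := F (c - ε • diagPlus + δ₀₀) - F (c - ε • diagPlus) with hΔ₀₀
  set Δ₁₀ := F (c + ε • diagMinus + δ₁₀) - F (c + ε • diagMinus) with hΔ₁₀
  set Δ₀₁ := F (c - ε • diagMinus + δ₀₁) - F (c - ε • diagMinus) with hΔ₀₁
  have hlin : ∀ δ, fderiv ℝ F c δ ∈ Submodule.span ℝ {pd1 F c, pd2 F c} := fun δ => by
    rw [fderiv_apply_eq]; exact Submodule.mem_span_pair.2 ⟨_, _, rfl⟩
  have C1 : A ≤ A + 4 * B := by linarith
  have tri : ∀ {a b c d : E3} {r : ℝ}, ‖a‖ ≤ r → ‖b‖ ≤ r → ‖c‖ ≤ r → ‖d‖ ≤ r →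
      ‖a + b - c - d‖ ≤ 4 * r := fun ha hb hc hd =>
    (norm_sub_le_of_le (norm_sub_le_of_le (norm_add_le_of_le ha hb) hc) hd).trans (by linarith)
  have up₁ : ∀ {r : ℝ}, 0 ≤ r → 4 * (B * r) ≤ (A + 4 * B) * r := fun hr => by
    nlinarith [mul_nonneg hA hr]
  have up₂ : ∀ {r : ℝ}, 0 ≤ r → B * r + B * r ≤ (A + 4 * B) * r := fun hr => by
    nlinarith [mul_nonneg hA hr, mul_nonneg hB hr]
  have hεμ : 0 ≤ ε * μ := by positivity
  have key := abs_trip_displaced_sub_le (C := A + 4 * B) (X₁ := Δ₁₁ - Δ₀₀) (X₂ := Δ₁₀ - Δ₀₁)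
    (Y := Δ₁₁ + Δ₀₀ - Δ₁₀ - Δ₀₁) (x₁ := fderiv ℝ F c δ₁₁ - fderiv ℝ F c δ₀₀)
    (x₂ := fderiv ℝ F c δ₁₀ - fderiv ℝ F c δ₀₁)
    (y := fderiv ℝ F c δ₁₁ + fderiv ℝ F c δ₀₀ - fderiv ℝ F c δ₁₀ - fderiv ℝ F c δ₀₁)
    hε hε1 hμ (nu.trans C1) (nv.trans C1) (nm.trans C1) hspan
    (hD₁.trans (by gcongr)) (hD₂.trans (by gcongr)) (hM.trans (by gcongr))
    ((norm_sub_le_of_le a₁₁ a₀₀).trans (up₂ hμ0)) ((norm_sub_le_of_le a₁₀ a₀₁).trans (up₂ hμ0))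
    ((tri a₁₁ a₀₀ a₁₀ a₀₁).trans (up₁ hμ0))
    (sub_mem (hlin _) (hlin _)) (sub_mem (hlin _) (hlin _))
    (sub_mem (sub_mem (add_mem (hlin _) (hlin _)) (hlin _)) (hlin _))
    (by
      rw [sub_sub_sub_comm]
      exact (norm_sub_le_of_le b₁₁ b₀₀).trans (by simpa only [mul_assoc] using up₂ hεμ))
    (by
      rw [sub_sub_sub_comm]
      exact (norm_sub_le_of_le b₁₀ b₀₁).trans (by simpa only [mul_assoc] using up₂ hεμ))
    (by
      rw [sub_sub_sub_comm, sub_sub_sub_comm (Δ₁₁ + Δ₀₀), add_sub_add_comm]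
      exact (tri b₁₁ b₀₀ b₁₀ b₀₁).trans (by simpa only [mul_assoc] using up₁ hεμ))
  have hdef : defect F (c - ε • diagPlus + δ₀₀) (c + ε • diagMinus + δ₁₀)
      (c - ε • diagMinus + δ₀₁) (c + ε • diagPlus + δ₁₁) =
      trip (F (c + ε • diagPlus) - F (c - ε • diagPlus) + (Δ₁₁ - Δ₀₀))
        (F (c + ε • diagMinus) - F (c - ε • diagMinus) + (Δ₁₀ - Δ₀₁))
        (F (c + ε • diagPlus) + F (c - ε • diagPlus) - F (c + ε • diagMinus)
          - F (c - ε • diagMinus) + (Δ₁₁ + Δ₀₀ - Δ₁₀ - Δ₀₁)) := by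
    rw [defect, hΔ₁₁, hΔ₀₀, hΔ₁₀, hΔ₀₁]
    congr 1 <;> abel
  rw [← hdef] at key
  have hY : trip (pd1 F c + pd2 F c) (pd1 F c - pd2 F c) (Δ₁₁ + Δ₀₀ - Δ₁₀ - Δ₀₁) =
      -2 * (trip (pd1 F c) (pd2 F c) Δ₁₁ + trip (pd1 F c) (pd2 F c) Δ₀₀
        - trip (pd1 F c) (pd2 F c) Δ₁₀ - trip (pd1 F c) (pd2 F c) Δ₀₁) := by
    simp only [trip_add₁, trip_sub₂, trip_add₃, trip_sub₃, trip_self₁₂,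
      trip_swap (pd1 F c) (pd2 F c)]
    ring
  rw [hY] at key
  have hS' := hS hspan
  simp only [Prod.smul_fst, Prod.smul_snd, Prod.fst_neg, Prod.snd_neg, smul_eq_mul] at c₁₁ c₀₀ c₁₀ c₀₁
  change |_ - trip _ _ _ - _| ≤ _ at key
  change |trip _ _ _ - _| ≤ _ at hS'
  generalize trip (pd1 F c) (pd2 F c) Δ₁₁ = t₁₁ at *
  generalize trip (pd1 F c) (pd2 F c) Δ₀₀ = t₀₀ at *
  generalize trip (pd1 F c) (pd2 F c) Δ₁₀ = t₁₀ at *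
  generalize trip (pd1 F c) (pd2 F c) Δ₀₁ = t₀₁ at *
  generalize defect F _ _ _ _ = D at *
  generalize coefL F c = L at *
  generalize coefM F c = M at *
  have hsum : |2 * ε ^ 2 * (t₁₁ + t₀₀ - t₁₀ - t₀₁) - ε ^ 3 * (L * (δ₁₁.1 + δ₀₁.1 - δ₁₀.1 - δ₀₀.1)
      + M * (δ₁₁.2 + δ₁₀.2 - δ₀₁.2 - δ₀₀.2))| ≤ 2 * ε ^ 2 * (4 * (B * ε ^ 2 * μ)) := by
    have hε2 : 0 ≤ 2 * ε ^ 2 := by positivity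
    rw [show ∀ x y : ℝ, 2 * ε ^ 2 * x - ε ^ 3 * y = 2 * ε ^ 2 * (x - ε / 2 * y) by intros; ring,
      abs_mul, abs_of_nonneg hε2]
    gcongr
    rw [abs_le] at *
    constructor <;> linarith
  have hA3 : 0 ≤ A ^ 3 * (ε ^ 4 * μ) := by positivity
  have hB1 : 0 ≤ B * ε ^ 7 := by positivity
  have hAB3 : 0 ≤ (A + 4 * B) ^ 3 * ε ^ 7 := by positivity
  rw [abs_le] at *
  constructor <;> linarith

end DisplacedQuad

section GridRecursion

/-- A perturbation of a nonconstant affine function has a zero. -/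
lemma exists_eq_zero_of_abs_add_le {D : ℝ → ℝ} (hD : Continuous D) {a s₀ r : ℝ} (hr : 0 ≤ r)
    (h : ∀ s ∈ Set.Icc (s₀ - r) (s₀ + r), |D s + a * (s - s₀)| ≤ |a| * r) :
    ∃ s ∈ Set.Icc (s₀ - r) (s₀ + r), D s = 0 := by
  have hle : s₀ - r ≤ s₀ + r := by linarith
  have h₁ := abs_le.1 (h _ (Set.left_mem_Icc.2 hle))
  have h₂ := abs_le.1 (h _ (Set.right_mem_Icc.2 hle))
  rcases le_total 0 a with ha | ha
  · rw [abs_of_nonneg ha] at h₁ h₂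
    exact intermediate_value_Icc' hle hD.continuousOn ⟨by linarith, by linarith⟩
  · rw [abs_of_nonpos ha] at h₁ h₂
    exact intermediate_value_Icc hle hD.continuousOn ⟨by linarith, by linarith⟩

/-- Filling a grid cell by cell from its boundary values. -/
lemma exists_grid {α : Type*} (x₀ : α) (N : ℕ) (good : ℕ → ℕ → α → Prop)
    (cell : ℕ → ℕ → α → α → α → α → Prop) (h₁ : ∀ j, good 0 j x₀) (h₂ : ∀ i, good i 0 x₀)
    (step : ∀ i < N, ∀ j < N, ∀ a b c, good i j a → good (i + 1) j b → good i (j + 1) c →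
      ∃ d, good (i + 1) (j + 1) d ∧ cell i j a b c d) :
    ∃ s : ℕ → ℕ → α, (∀ i ≤ N, ∀ j ≤ N, good i j (s i j)) ∧ ∀ i < N, ∀ j < N,
      cell i j (s i j) (s (i + 1) j) (s i (j + 1)) (s (i + 1) (j + 1)) := by
  have : Nonempty α := ⟨x₀⟩
  choose! next hgood hcell using step
  let s : ℕ → ℕ → α := fun i => Nat.rec (fun _ => x₀)
    (fun i row j => Nat.rec x₀ (fun j prev => next i j (row j) prev (row (j + 1))) j) i
  have hs : ∀ i j, s (i + 1) (j + 1) = next i j (s i j) (s (i + 1) j) (s i (j + 1)) :=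
    fun _ _ => rfl
  have hg : ∀ i ≤ N, ∀ j ≤ N, good i j (s i j) := by
    intro i
    induction i with
    | zero => exact fun _ j _ => h₁ j
    | succ i ih =>
      intro hi j
      induction j with
      | zero => exact fun _ => h₂ (i + 1)
      | succ j ih' =>
        intro hj
        rw [hs]
        exact hgood i hi j hj _ _ _ (ih (by omega) j (by omega)) (ih' (by omega))
          (ih (by omega) (j + 1) hj)
  refine ⟨s, hg, fun i hi j hj => ?_⟩
  rw [hs]
  exact hcell i hi j hj _ _ _ (hg i hi.le j hj.le) (hg (i + 1) hi j hj.le) (hg i hi.le (j + 1) hj)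

/-- Extracting the dependence of the defect on the transverse displacements. -/
lemma abs_defect_add_le {D L M R w ε ω' ω Λ K S : ℝ} {L₀₀ L₁₀ L₀₁ L₁₁ M₀₀ M₁₀ M₀₁ M₁₁
    s₀₀ s₁₀ s₀₁ s₁₁ : ℝ} (hε : 0 < ε) (hΛ : 0 ≤ Λ) (hL : |L| ≤ Λ) (hM : |M| ≤ Λ)
    (l₀₀ : |L₀₀ - L| ≤ Λ * ε) (l₁₀ : |L₁₀ - L| ≤ Λ * ε) (l₀₁ : |L₀₁ - L| ≤ Λ * ε)
    (l₁₁ : |L₁₁ - L| ≤ Λ * ε) (m₀₀ : |M₀₀ - M| ≤ Λ * ε) (m₁₀ : |M₁₀ - M| ≤ Λ * ε)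
    (m₀₁ : |M₀₁ - M| ≤ Λ * ε) (m₁₁ : |M₁₁ - M| ≤ Λ * ε) (h₀₀ : |s₀₀| ≤ S) (h₁₀ : |s₁₀| ≤ S)
    (h₀₁ : |s₀₁| ≤ S) (h₁₁ : |s₁₁| ≤ S) (hw : |L * w - ε * R| ≤ 2 * Λ * ω' * ε)
    (hD : |D - ε ^ 6 * R + ε ^ 3 * (L * (ε ^ 2 * (w + s₁₁ * M₁₁ + s₀₁ * M₀₁ - s₁₀ * M₁₀
        - s₀₀ * M₀₀)) + M * (ε ^ 2 * (s₁₁ * L₁₁ + s₁₀ * L₁₀ - s₀₁ * L₀₁ - s₀₀ * L₀₀)))|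
      ≤ K * (ε ^ 7 + ε ^ 4 * (ε ^ 2 * (ω + Λ * S)))) :
    |D + ε ^ 5 * (2 * L * M) * (s₁₁ - s₀₀)|
      ≤ ε ^ 6 * (2 * Λ * ω' + K * (ε + ω) + (K * Λ + 8 * Λ ^ 2) * S) := by
  have hS : 0 ≤ S := (abs_nonneg _).trans h₀₀
  have prod : ∀ {x y z : ℝ}, |x| ≤ Λ → |y| ≤ S → |z| ≤ Λ * ε → |x * (y * z)| ≤ Λ ^ 2 * S * ε := by
    intro x y z hx hy hz
    rw [abs_mul, abs_mul]
    calc |x| * (|y| * |z|) ≤ Λ * (S * (Λ * ε)) := by gcongr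
      _ = Λ ^ 2 * S * ε := by ring
  have scale : ∀ {x b : ℝ}, |x| ≤ b → |ε ^ 5 * x| ≤ ε ^ 5 * b := by
    intro x b hx
    rw [abs_mul, abs_of_pos (by positivity : 0 < ε ^ 5)]
    gcongr
  have p₁ := abs_le.1 (scale (prod hL h₁₁ m₁₁))
  have p₂ := abs_le.1 (scale (prod hL h₀₁ m₀₁))
  have p₃ := abs_le.1 (scale (prod hL h₁₀ m₁₀))
  have p₄ := abs_le.1 (scale (prod hL h₀₀ m₀₀))
  have p₅ := abs_le.1 (scale (prod hM h₁₁ l₁₁))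
  have p₆ := abs_le.1 (scale (prod hM h₀₁ l₀₁))
  have p₇ := abs_le.1 (scale (prod hM h₁₀ l₁₀))
  have p₈ := abs_le.1 (scale (prod hM h₀₀ l₀₀))
  have p₉ := abs_le.1 (scale hw)
  rw [abs_le] at hD ⊢
  constructor <;> linarith

end GridRecursion

section PlanarGrid

/-- The vertex of the discrete net near the grid point `p`: displaced by `ε² W` in the first
coordinate direction, and by `ε² s` in the transverse direction `(M, L)`. -/
def vertex (F : ℝ × ℝ → E3) (ε W : ℝ) (p : ℝ × ℝ) (s : ℝ) : ℝ × ℝ :=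
  (p.1 + ε ^ 2 * (W + s * coefM F p), p.2 + ε ^ 2 * (s * coefL F p))

lemma norm_corner_sub_center_le {x y ε W a b : ℝ} (hε : 0 < ε) (hW : ε * |W| ≤ 1 / 2)
    (ha : |a| = ε / 2) (hb : |b| = ε / 2) :
    ‖((x + ε / 2 + a, y + ε / 2 + b) : ℝ × ℝ) - (x + ε / 2 + ε ^ 2 * W, y + ε / 2)‖ ≤ ε := by
  have hεW : |ε ^ 2 * W| ≤ ε / 2 := by
    rw [abs_mul, abs_of_pos (by positivity : 0 < ε ^ 2)]
    nlinarith
  rw [Prod.norm_def]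
  refine max_le ?_ ?_
  · rw [Prod.fst_sub, Real.norm_eq_abs,
      show x + ε / 2 + a - (x + ε / 2 + ε ^ 2 * W) = a - ε ^ 2 * W by ring]
    exact (abs_sub _ _).trans (by linarith)
  · rw [Prod.snd_sub, Real.norm_eq_abs, show y + ε / 2 + b - (y + ε / 2) = b by ring, hb]
    linarith

lemma abs_defect_vertex_add_le {F : ℝ × ℝ → E3} {R : ℝ × ℝ → ℝ} {K Λ ε ω ω' S : ℝ} {x y : ℝ}
    {W₀₀ W₁₀ W₀₁ W₁₁ s₀₀ s₁₀ s₀₁ s₁₁ : ℝ} {c : ℝ × ℝ}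
    (hest : ∀ (δ₀₀ δ₁₀ δ₀₁ δ₁₁ : ℝ × ℝ) (ε μ : ℝ),
      0 < ε → ε ≤ 1 → μ ≤ ε ^ 2 → ‖δ₀₀‖ ≤ μ → ‖δ₁₀‖ ≤ μ → ‖δ₀₁‖ ≤ μ → ‖δ₁₁‖ ≤ μ →
      |defect F (c - ε • diagPlus + δ₀₀) (c + ε • diagMinus + δ₁₀) (c - ε • diagMinus + δ₀₁)
          (c + ε • diagPlus + δ₁₁) - ε ^ 6 * R c
        + ε ^ 3 * (coefL F c * (δ₁₁.1 + δ₀₁.1 - δ₁₀.1 - δ₀₀.1)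
          + coefM F c * (δ₁₁.2 + δ₁₀.2 - δ₀₁.2 - δ₀₀.2))| ≤ K * (ε ^ 7 + ε ^ 4 * μ))
    (hL : ∀ p, |coefL F p| ≤ Λ) (hM : ∀ p, |coefM F p| ≤ Λ)
    (hL' : ∀ p q, |coefL F p - coefL F q| ≤ Λ * ‖p - q‖)
    (hM' : ∀ p q, |coefM F p - coefM F q| ≤ Λ * ‖p - q‖)
    (hε : 0 < ε) (hε1 : ε ≤ 1) (hc : c = (x + ε / 2 + ε ^ 2 * W₀₀, y + ε / 2))
    (hW : ε * |W₀₀| ≤ 1 / 2) (hω₁₀ : |W₁₀ - W₀₀| ≤ ω) (hω₀₁ : |W₀₁ - W₀₀| ≤ ω)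
    (hω₁₁ : |W₁₁ - W₀₀| ≤ ω) (h₀₀ : |s₀₀| ≤ S) (h₁₀ : |s₁₀| ≤ S)
    (h₀₁ : |s₀₁| ≤ S) (h₁₁ : |s₁₁| ≤ S)
    (hw : |coefL F c * (W₁₁ + W₀₁ - W₁₀ - W₀₀) - ε * R c| ≤ 2 * Λ * ω' * ε)
    (hS : ω + Λ * S ≤ 1) :
    |defect F (vertex F ε W₀₀ (x, y) s₀₀) (vertex F ε W₁₀ (x + ε, y) s₁₀)
        (vertex F ε W₀₁ (x, y + ε) s₀₁) (vertex F ε W₁₁ (x + ε, y + ε) s₁₁)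
      + ε ^ 5 * (2 * coefL F c * coefM F c) * (s₁₁ - s₀₀)|
      ≤ ε ^ 6 * (2 * Λ * ω' + K * (ε + ω) + (K * Λ + 8 * Λ ^ 2) * S) := by
  have hΛ : 0 ≤ Λ := (abs_nonneg _).trans (hL 0)
  have hω : 0 ≤ ω := (abs_nonneg _).trans hω₁₀
  have near : ∀ {a b : ℝ}, |a| = ε / 2 → |b| = ε / 2 → ∀ {z : ℝ × ℝ},
      z = (x + ε / 2 + a, y + ε / 2 + b) → ‖z - c‖ ≤ ε := by
    rintro a b ha hb z rfl
    exact hc ▸ norm_corner_sub_center_le hε hW ha hb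
  have hp : |ε / 2| = ε / 2 := abs_of_pos (by linarith)
  have hm : |-(ε / 2)| = ε / 2 := by rw [abs_neg, hp]
  have n₀₀ : ‖(x, y) - c‖ ≤ ε := near hm hm (by ext <;> simp)
  have n₁₀ : ‖(x + ε, y) - c‖ ≤ ε := near hp hm (by ext <;> simp; ring)
  have n₀₁ : ‖(x, y + ε) - c‖ ≤ ε := near hm hp (by ext <;> simp; ring)
  have n₁₁ : ‖(x + ε, y + ε) - c‖ ≤ ε := near hp hp (by ext <;> simp <;> ring)
  have lip : ∀ {G : ℝ × ℝ → ℝ} {p : ℝ × ℝ}, (∀ p q, |G p - G q| ≤ Λ * ‖p - q‖) → ‖p - c‖ ≤ ε →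
      |G p - G c| ≤ Λ * ε := fun hG hp => (hG _ _).trans (by gcongr)
  set δ : ℝ → ℝ → ℝ × ℝ → ℝ × ℝ := fun W s p =>
    (ε ^ 2 * (W - W₀₀ + s * coefM F p), ε ^ 2 * (s * coefL F p)) with hδ
  have nδ : ∀ {W s : ℝ} (p : ℝ × ℝ), |W - W₀₀| ≤ ω → |s| ≤ S →
      ‖δ W s p‖ ≤ ε ^ 2 * (ω + Λ * S) := by
    intro W s p hW hs
    have hsm : |s * coefM F p| ≤ Λ * S := by
      rw [abs_mul, mul_comm]; exact mul_le_mul (hM p) hs (abs_nonneg _) hΛ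
    have hsl : |s * coefL F p| ≤ Λ * S := by
      rw [abs_mul, mul_comm]; exact mul_le_mul (hL p) hs (abs_nonneg _) hΛ
    rw [hδ, Prod.norm_def]
    refine max_le ?_ ?_ <;>
      rw [Real.norm_eq_abs, abs_mul, abs_of_pos (by positivity : 0 < ε ^ 2)] <;> gcongr
    · exact (abs_add_le _ _).trans (by linarith)
    · linarith
  have key := hest (δ W₀₀ s₀₀ (x, y)) (δ W₁₀ s₁₀ (x + ε, y)) (δ W₀₁ s₀₁ (x, y + ε))
    (δ W₁₁ s₁₁ (x + ε, y + ε)) ε (ε ^ 2 * (ω + Λ * S)) hε hε1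
    (mul_le_of_le_one_right (by positivity) hS)
    (nδ _ (by simpa using hω) h₀₀) (nδ _ hω₁₀ h₁₀) (nδ _ hω₀₁ h₀₁) (nδ _ hω₁₁ h₁₁)
  have v₀₀ : c - ε • diagPlus + δ W₀₀ s₀₀ (x, y) = vertex F ε W₀₀ (x, y) s₀₀ := by
    ext <;> simp [hc, hδ, vertex] <;> ring
  have v₁₀ : c + ε • diagMinus + δ W₁₀ s₁₀ (x + ε, y) = vertex F ε W₁₀ (x + ε, y) s₁₀ := by
    ext <;> simp [hc, hδ, vertex] <;> ring
  have v₀₁ : c - ε • diagMinus + δ W₀₁ s₀₁ (x, y + ε) = vertex F ε W₀₁ (x, y + ε) s₀₁ := by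
    ext <;> simp [hc, hδ, vertex] <;> ring
  have v₁₁ : c + ε • diagPlus + δ W₁₁ s₁₁ (x + ε, y + ε)
      = vertex F ε W₁₁ (x + ε, y + ε) s₁₁ := by
    ext <;> simp [hc, hδ, vertex] <;> ring
  rw [v₀₀, v₁₀, v₀₁, v₁₁] at key
  refine abs_defect_add_le hε hΛ (hL c) (hM c) (lip hL' n₀₀) (lip hL' n₁₀) (lip hL' n₀₁)
    (lip hL' n₁₁) (lip hM' n₀₀) (lip hM' n₁₀) (lip hM' n₀₁) (lip hM' n₁₁) h₀₀ h₁₀ h₀₁ h₁₁ hw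
    (le_of_eq_of_le ?_ key)
  simp only [hδ]
  congr 1
  ring

/-- Solving for the fourth vertex of a planar quadrilateral. -/
lemma exists_vertex_step {F : ℝ × ℝ → E3} (hF : Continuous F) {R : ℝ × ℝ → ℝ}
    {K Λ ε ω ω' B η κ K' x y W₀₀ W₁₀ W₀₁ W₁₁ s₀₀ s₁₀ s₀₁ : ℝ} {c : ℝ × ℝ}
    (hest : ∀ (δ₀₀ δ₁₀ δ₀₁ δ₁₁ : ℝ × ℝ) (ε μ : ℝ),
      0 < ε → ε ≤ 1 → μ ≤ ε ^ 2 → ‖δ₀₀‖ ≤ μ → ‖δ₁₀‖ ≤ μ → ‖δ₀₁‖ ≤ μ → ‖δ₁₁‖ ≤ μ →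
      |defect F (c - ε • diagPlus + δ₀₀) (c + ε • diagMinus + δ₁₀) (c - ε • diagMinus + δ₀₁)
          (c + ε • diagPlus + δ₁₁) - ε ^ 6 * R c
        + ε ^ 3 * (coefL F c * (δ₁₁.1 + δ₀₁.1 - δ₁₀.1 - δ₀₀.1)
          + coefM F c * (δ₁₁.2 + δ₁₀.2 - δ₀₁.2 - δ₀₀.2))| ≤ K * (ε ^ 7 + ε ^ 4 * μ))
    (hL : ∀ p, |coefL F p| ≤ Λ) (hM : ∀ p, |coefM F p| ≤ Λ)
    (hL' : ∀ p q, |coefL F p - coefL F q| ≤ Λ * ‖p - q‖)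
    (hM' : ∀ p q, |coefM F p - coefM F q| ≤ Λ * ‖p - q‖)
    (hε : 0 < ε) (hε1 : ε ≤ 1) (hc : c = (x + ε / 2 + ε ^ 2 * W₀₀, y + ε / 2))
    (hW : ε * |W₀₀| ≤ 1 / 2) (hω₁₀ : |W₁₀ - W₀₀| ≤ ω) (hω₀₁ : |W₀₁ - W₀₀| ≤ ω)
    (hω₁₁ : |W₁₁ - W₀₀| ≤ ω) (h₀₀ : |s₀₀| ≤ B) (h₁₀ : |s₁₀| ≤ B) (h₀₁ : |s₀₁| ≤ B)
    (hw : |coefL F c * (W₁₁ + W₀₁ - W₁₀ - W₀₀) - ε * R c| ≤ 2 * Λ * ω' * ε)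
    (hS : ω + Λ * (2 * B + η) ≤ 1) (hκ : κ ≤ |2 * coefL F c * coefM F c|) (hK' : 0 ≤ K')
    (hKκ : K * Λ + 8 * Λ ^ 2 ≤ κ * K') (hη : 2 * Λ * ω' + K * (ε + ω) ≤ κ * η) (hη0 : 0 ≤ η)
    (hηB : η ≤ B) (hεK : ε * (1 + 2 * K') ≤ 1) :
    ∃ s₁₁, |s₁₁| ≤ B * (1 + ε * (1 + 3 * K')) ∧
      defect F (vertex F ε W₀₀ (x, y) s₀₀) (vertex F ε W₁₀ (x + ε, y) s₁₀)
        (vertex F ε W₀₁ (x, y + ε) s₀₁) (vertex F ε W₁₁ (x + ε, y + ε) s₁₁) = 0 := by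
  have hB : 0 ≤ B := hη0.trans hηB
  set r := ε * (η + K' * (2 * B + η)) with hr
  have hr0 : 0 ≤ r := by positivity
  have hrB : r ≤ B + η := by
    have : ε * (1 + 2 * K') * (B + η) ≤ 1 * (B + η) := by gcongr
    have h₁ : 0 ≤ ε * (B + K' * η) := by positivity
    linarith
  have hcont : Continuous fun s => defect F (vertex F ε W₀₀ (x, y) s₀₀)
      (vertex F ε W₁₀ (x + ε, y) s₁₀) (vertex F ε W₀₁ (x, y + ε) s₀₁)
      (vertex F ε W₁₁ (x + ε, y + ε) s) := by
    have hv : Continuous fun s => F (vertex F ε W₁₁ (x + ε, y + ε) s) :=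
      hF.comp (by unfold vertex; fun_prop)
    exact continuous_trip (hv.sub continuous_const) continuous_const
      (((hv.add continuous_const).sub continuous_const).sub continuous_const)
  obtain ⟨s, hs, h0⟩ := exists_eq_zero_of_abs_add_le
    (a := ε ^ 5 * (2 * coefL F c * coefM F c)) (s₀ := s₀₀) hcont hr0 fun s hs => by
      have hsr : |s - s₀₀| ≤ r := abs_le.2 ⟨by linarith [hs.1], by linarith [hs.2]⟩
      have hsS : |s| ≤ 2 * B + η := by
        have := abs_add_le (s - s₀₀) s₀₀
        rw [sub_add_cancel] at this
        linarith
      have hBS : B ≤ 2 * B + η := by linarith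
      refine (abs_defect_vertex_add_le (ω' := ω') hest hL hM hL' hM' hε hε1 hc hW hω₁₀ hω₀₁ hω₁₁
        (h₀₀.trans hBS) (h₁₀.trans hBS) (h₀₁.trans hBS) hsS hw hS).trans ?_
      rw [abs_mul, abs_of_pos (by positivity : 0 < ε ^ 5)]
      calc _ ≤ ε ^ 6 * (κ * η + κ * K' * (2 * B + η)) := by gcongr
        _ = ε ^ 5 * κ * r := by rw [hr]; ring
        _ ≤ _ := by gcongr
  refine ⟨s, ?_, h0⟩
  have hsr : |s - s₀₀| ≤ r := abs_le.2 ⟨by linarith [hs.1], by linarith [hs.2]⟩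
  have := abs_add_le (s - s₀₀) s₀₀
  rw [sub_add_cancel] at this
  have h₁ : 0 ≤ ε * ((1 + K') * (B - η)) :=
    mul_nonneg hε.le (mul_nonneg (by linarith) (by linarith))
  linarith

end PlanarGrid

section Net

/-- The unit square. -/
abbrev unitSquare : Set (ℝ × ℝ) := Set.Icc (0 : ℝ) 1 ×ˢ Set.Icc (0 : ℝ) 1

lemma exists_trip_bound {u v w : ℝ × ℝ → E3} (hu : ContDiff ℝ (⊤ : ℕ∞) u)
    (hv : ContDiff ℝ (⊤ : ℕ∞) v) (hw : ContDiff ℝ (⊤ : ℕ∞) w) (hc : HasCompactSupport u) :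
    ∃ Λ : ℝ, 0 ≤ Λ ∧ (∀ p, |trip (u p) (v p) (w p)| ≤ Λ) ∧
      ∀ p q, |trip (u p) (v p) (w p) - trip (u q) (v q) (w q)| ≤ Λ * ‖p - q‖ := by
  have hs : ContDiff ℝ (⊤ : ℕ∞) fun p => trip (u p) (v p) (w p) := contDiff_trip hu hv hw
  have hsc : HasCompactSupport fun p => trip (u p) (v p) (w p) := by
    refine hc.mono fun p hp => ?_
    contrapose! hp
    simp only [Function.mem_support, not_not] at hp
    simp [trip_eq, hp]
  obtain ⟨C₁, hC₁, h₁, -, -⟩ := exists_lipschitz_taylor_bound hs hsc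
  obtain ⟨C₂, h₂⟩ := hsc.exists_bound_of_continuous hs.continuous
  have hC₂ : 0 ≤ C₂ := (norm_nonneg _).trans (h₂ 0)
  refine ⟨C₁ + C₂, by positivity, fun p => (h₂ p).trans (by linarith), fun p q => ?_⟩
  refine (h₁ p q).trans ?_
  gcongr
  linarith

/-- The displacement along the first coordinate direction which compensates the sixth-order
defect: a Riemann sum of `φ` in the second coordinate direction. -/
def columnSum (φ : ℝ × ℝ → ℝ) (ε : ℝ) (i j : ℕ) : ℝ :=
  ε * ∑ k ∈ Finset.range j, φ (i * ε, k * ε)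

lemma columnSum_succ (φ : ℝ × ℝ → ℝ) (ε : ℝ) (i j : ℕ) :
    columnSum φ ε i (j + 1) = columnSum φ ε i j + ε * φ (i * ε, j * ε) := by
  rw [columnSum, Finset.sum_range_succ, mul_add, columnSum]

lemma abs_riemann_sum_le {a : ℕ → ℝ} {b ε : ℝ} {j : ℕ} (hε : 0 ≤ ε) (hj : j * ε ≤ 1)
    (hb : 0 ≤ b) (ha : ∀ k < j, |a k| ≤ b) : |ε * ∑ k ∈ Finset.range j, a k| ≤ b := by
  rw [abs_mul, abs_of_nonneg hε]
  have : |∑ k ∈ Finset.range j, a k| ≤ j * b :=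
    (Finset.abs_sum_le_sum_abs _ _).trans
      ((Finset.sum_le_sum fun k hk => ha k (Finset.mem_range.1 hk)).trans (by simp))
  calc ε * |∑ k ∈ Finset.range j, a k| ≤ ε * (j * b) := by gcongr
    _ = (j * ε) * b := by ring
    _ ≤ b := mul_le_of_le_one_left hb hj

lemma one_add_pow_le_exp {ε A : ℝ} {N n : ℕ} (hε : 0 ≤ ε) (hA : 0 ≤ A) (hN : N * ε ≤ 1)
    (hn : n ≤ 2 * N) : (1 + ε * A) ^ n ≤ Real.exp (2 * A) := by
  have h₁ : (1 + ε * A) ^ n ≤ Real.exp (ε * A) ^ n :=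
    pow_le_pow_left₀ (by positivity) (by linarith [Real.add_one_le_exp (ε * A)]) n
  refine h₁.trans ?_
  rw [← Real.exp_nat_mul]
  refine Real.exp_le_exp.2 ?_
  have hn' : (n : ℝ) ≤ 2 * N := mod_cast hn
  have : n * (ε * A) ≤ 2 * N * (ε * A) := by gcongr
  nlinarith

set_option maxHeartbeats 1000000 in
/-- A grid of parameter values, second-order close to the square grid, over which all
quadrilaterals on the surface are planar. -/
lemma exists_planar_grid {F : ℝ × ℝ → E3} (hF : ContDiff ℝ (⊤ : ℕ∞) F)
    (hc : HasCompactSupport F)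
    (hspan : ∀ p ∈ unitSquare, pd2 (pd1 F) p ∈ Submodule.span ℝ {pd1 F p, pd2 F p})
    (hL : ∀ p ∈ unitSquare, coefL F p ≠ 0) (hM : ∀ p ∈ unitSquare, coefM F p ≠ 0) :
    ∃ C : ℝ, 0 ≤ C ∧ ∃ ε₀ > 0, ∀ ε : ℝ, 0 < ε → ε < ε₀ → ∀ N : ℕ, N * ε ≤ 1 →
      ∃ V : ℕ → ℕ → ℝ × ℝ,
        (∀ i < N, ∀ j < N, defect F (V i j) (V (i + 1) j) (V i (j + 1)) (V (i + 1) (j + 1)) = 0) ∧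
        ∀ i ≤ N, ∀ j ≤ N, ‖V i j - (i * ε, j * ε)‖ ≤ C * ε ^ 2 := by
  obtain ⟨R, hR, K, hK, hest⟩ := exists_defect_estimate hF hc
  have s₁ := contDiff_dirDeriv hF (1, 0)
  have s₂ := contDiff_dirDeriv hF (0, 1)
  have c₁ := hasCompactSupport_dirDeriv hc (1, 0)
  obtain ⟨Λ₁, hΛ₁, bL, lL⟩ := exists_trip_bound s₁ s₂ (contDiff_dirDeriv s₁ (1, 0)) c₁
  obtain ⟨Λ₂, hΛ₂, bM, lM⟩ := exists_trip_bound s₁ s₂ (contDiff_dirDeriv s₂ (0, 1)) c₁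
  have cL : Continuous (coefL F) :=
    continuous_trip s₁.continuous s₂.continuous (contDiff_dirDeriv s₁ (1, 0)).continuous
  have cM : Continuous (coefM F) :=
    continuous_trip s₁.continuous s₂.continuous (contDiff_dirDeriv s₂ (0, 1)).continuous
  set Λ := 1 + Λ₁ + Λ₂ with hΛ
  have hΛ1 : 1 ≤ Λ := by linarith
  have bL' : ∀ p, |coefL F p| ≤ Λ := fun p => (bL p).trans (by linarith)
  have bM' : ∀ p, |coefM F p| ≤ Λ := fun p => (bM p).trans (by linarith)
  have lL' : ∀ p q, |coefL F p - coefL F q| ≤ Λ * ‖p - q‖ := fun p q =>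
    (lL p q).trans (by gcongr; linarith)
  have lM' : ∀ p q, |coefM F p - coefM F q| ≤ Λ * ‖p - q‖ := fun p q =>
    (lM p q).trans (by gcongr; linarith)
  have hQ : IsCompact unitSquare := isCompact_Icc.prod isCompact_Icc
  obtain ⟨κ, hκ, hκ'⟩ : ∃ κ : ℝ, 0 < κ ∧ ∀ p ∈ unitSquare, κ ≤ |2 * coefL F p * coefM F p| :=
    hQ.exists_forall_le' (by fun_prop) fun p hp => abs_pos.2
      (mul_ne_zero (mul_ne_zero two_ne_zero (hL p hp)) (hM p hp))
  set φ : ℝ × ℝ → ℝ := fun p => R p / (2 * coefL F p) with hφ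
  have hφR : ∀ p ∈ unitSquare, coefL F p * (2 * φ p) = R p := fun p hp => by
    have := hL p hp
    simp only [hφ]
    field_simp
  have cφ : ContinuousOn φ unitSquare :=
    hR.continuousOn.div (by fun_prop) fun p hp => mul_ne_zero two_ne_zero (hL p hp)
  obtain ⟨Φ, hΦ⟩ := hQ.exists_bound_of_continuousOn cφ
  simp only [Real.norm_eq_abs] at hΦ
  have hΦ0 : 0 ≤ Φ := (abs_nonneg _).trans (hΦ (0, 0) (by simp))
  set K' := (K * Λ + 8 * Λ ^ 2) / κ with hK'
  have hK'0 : 0 ≤ K' := by positivity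
  set A := 1 + 3 * K' with hA
  set E := Real.exp (2 * A) with hE
  have hE0 : 0 < E := Real.exp_pos _
  have hE1 : 1 ≤ E := Real.one_le_exp (by positivity)
  set η := 1 / (6 * Λ * E) with hη
  have hη0 : 0 < η := by positivity
  have hηE : Λ * (η * E) = 1 / 6 := by rw [hη]; field_simp
  set ω' := min (1 / 4) (κ * η / (2 * (2 * Λ + K))) with hω'
  have hω'0 : 0 < ω' := by positivity
  have hω'1 : ω' ≤ 1 / 4 := min_le_left _ _
  have hω'2 : (2 * Λ + K) * ω' ≤ κ * η / 2 := by
    calc _ ≤ (2 * Λ + K) * (κ * η / (2 * (2 * Λ + K))) := by gcongr; exact min_le_right _ _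
      _ = κ * η / 2 := by field_simp
  obtain ⟨d, hd, hdφ⟩ := Metric.uniformContinuousOn_iff.1
    (hQ.uniformContinuousOn_of_continuous cφ) ω' hω'0
  set T := 1 + 4 * Φ + 2 * K' + 2 * K * (1 + Φ) / (κ * η) with hT
  have hT' : 0 ≤ 2 * K * (1 + Φ) / (κ * η) := by positivity
  refine ⟨Φ + 1, by positivity, min d (1 / T), by positivity, fun ε hε hεε N hN => ?_⟩
  have hεd : ε < d := hεε.trans_le (min_le_left _ _)
  have hεT : ε * T ≤ 1 := ((lt_div_iff₀ (by positivity)).1 (hεε.trans_le (min_le_right _ _))).le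
  have hεΦ0 : 0 ≤ ε * Φ := by positivity
  have hεK'0 : 0 ≤ ε * K' := by positivity
  have hεX0 : 0 ≤ ε * (2 * K * (1 + Φ) / (κ * η)) := by positivity
  have hT'' : ε + 4 * (ε * Φ) + 2 * (ε * K') + ε * (2 * K * (1 + Φ) / (κ * η)) ≤ 1 := by
    rw [hT] at hεT; linarith
  have hε1 : ε ≤ 1 := by linarith
  have hεΦ : ε * Φ ≤ 1 / 4 := by linarith
  have hεK' : ε * (1 + 2 * K') ≤ 1 := by linarith
  have hεX : K * (ε * (1 + Φ)) ≤ κ * η / 2 := by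
    have : ε * (2 * K * (1 + Φ) / (κ * η)) ≤ 1 := by linarith
    rw [mul_div_assoc', div_le_one (by positivity)] at this
    linarith
  set ω := ω' + ε * Φ with hω
  have osc : ∀ p ∈ unitSquare, ∀ q ∈ unitSquare, ‖p - q‖ ≤ ε → |φ p - φ q| ≤ ω' :=
    fun p hp q hq hpq => (hdφ p hp q hq (by rw [dist_eq_norm]; linarith)).le
  have le1 : ∀ {i : ℕ}, i ≤ N → (i : ℝ) * ε ≤ 1 := fun hi =>
    le_trans (by gcongr) hN
  have grid : ∀ {i j : ℕ}, i ≤ N → j ≤ N → ((i : ℝ) * ε, (j : ℝ) * ε) ∈ unitSquare :=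
    fun hi hj => ⟨⟨by positivity, le1 hi⟩, ⟨by positivity, le1 hj⟩⟩
  have cast_succ : ∀ i : ℕ, ((i + 1 : ℕ) : ℝ) * ε = i * ε + ε := fun i => by push_cast; ring
  have W_le : ∀ {i j : ℕ}, i ≤ N → j ≤ N → |columnSum φ ε i j| ≤ Φ := fun hi hj =>
    abs_riemann_sum_le hε.le (le1 hj) hΦ0 fun k hk => hΦ _ (grid hi (by omega))
  have W_diff : ∀ {i j : ℕ}, i < N → j ≤ N →
      |columnSum φ ε (i + 1) j - columnSum φ ε i j| ≤ ω' := by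
    intro i j hi hj
    rw [columnSum, columnSum, ← mul_sub, ← Finset.sum_sub_distrib]
    refine abs_riemann_sum_le hε.le (le1 hj) hω'0.le fun k hk =>
      osc _ (grid hi (by omega)) _ (grid hi.le (by omega)) ?_
    rw [cast_succ, Prod.mk_sub_mk, add_sub_cancel_left, sub_self, Prod.norm_def]
    simp [abs_of_pos hε, hε.le]
  obtain ⟨s, hgood, hcell⟩ := exists_grid (0 : ℝ) N
    (fun i j s => |s| ≤ η * (1 + ε * A) ^ (i + j))
    (fun i j s₀₀ s₁₀ s₀₁ s₁₁ =>
      defect F (vertex F ε (columnSum φ ε i j) (i * ε, j * ε) s₀₀)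
        (vertex F ε (columnSum φ ε (i + 1) j) ((i + 1 : ℕ) * ε, j * ε) s₁₀)
        (vertex F ε (columnSum φ ε i (j + 1)) (i * ε, (j + 1 : ℕ) * ε) s₀₁)
        (vertex F ε (columnSum φ ε (i + 1) (j + 1)) ((i + 1 : ℕ) * ε, (j + 1 : ℕ) * ε) s₁₁) = 0)
    (fun j => by rw [abs_zero]; positivity) (fun i => by rw [abs_zero]; positivity)
    (by
      intro i hi j hj s₀₀ s₁₀ s₀₁ h₀₀ h₁₀ h₀₁
      set W := columnSum φ ε i j with hW
      have nW : ε * |W| ≤ 1 / 2 := by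
        have : ε * |W| ≤ ε * Φ := by gcongr; exact W_le hi.le hj.le
        linarith
      set c : ℝ × ℝ := (i * ε + ε / 2 + ε ^ 2 * W, j * ε + ε / 2) with hc
      have near : ∀ {a b : ℝ}, |a| = ε / 2 → |b| = ε / 2 →
          ‖((i * ε + ε / 2 + a, j * ε + ε / 2 + b) : ℝ × ℝ) - c‖ ≤ ε :=
        norm_corner_sub_center_le hε nW
      have hcQ : c ∈ unitSquare := by
        have h₁ := le1 (i := i + 1) hi
        have h₂ := le1 (i := j + 1) hj
        rw [cast_succ] at h₁ h₂
        have h₃ : 0 ≤ (i : ℝ) * ε := by positivity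
        have h₄ : 0 ≤ (j : ℝ) * ε := by positivity
        have h₅ : |ε ^ 2 * W| ≤ ε / 2 := by
          rw [abs_mul, abs_of_pos (by positivity : 0 < ε ^ 2)]
          nlinarith
        rw [abs_le] at h₅
        exact ⟨⟨by simp only [hc]; linarith, by simp only [hc]; linarith⟩,
          ⟨by simp only [hc]; linarith, by simp only [hc]; linarith⟩⟩
      have hp : |ε / 2| = ε / 2 := abs_of_pos (by linarith)
      have hm : |-(ε / 2)| = ε / 2 := by rw [abs_neg, hp]
      have o₀₀ : |φ (i * ε, j * ε) - φ c| ≤ ω' := by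
        refine osc _ (grid hi.le hj.le) _ hcQ ?_
        simpa using near hm hm
      have o₁₀ : |φ ((i + 1 : ℕ) * ε, j * ε) - φ c| ≤ ω' := by
        refine osc _ (grid hi hj.le) _ hcQ ?_
        rw [cast_succ]
        simpa [add_assoc] using near hp hm
      have φ₀₀ : |ε * φ (i * ε, j * ε)| ≤ ε * Φ := by
        rw [abs_mul, abs_of_pos hε]; gcongr; exact hΦ _ (grid hi.le hj.le)
      have φ₁₀ : |ε * φ ((i + 1 : ℕ) * ε, j * ε)| ≤ ε * Φ := by
        rw [abs_mul, abs_of_pos hε]; gcongr; exact hΦ _ (grid hi hj.le)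
      have d₁₀ := W_diff (j := j) hi hj.le
      have hw : |coefL F c * (columnSum φ ε (i + 1) (j + 1) + columnSum φ ε i (j + 1)
          - columnSum φ ε (i + 1) j - W) - ε * R c| ≤ 2 * Λ * ω' * ε := by
        rw [columnSum_succ, columnSum_succ, ← hφR c hcQ]
        rw [show ∀ l w w' x y z : ℝ, l * (w + ε * x + (w' + ε * y) - w - w') - ε * (l * (2 * z)) =
          ε * l * ((x - z) + (y - z)) by intros; ring, abs_mul, abs_mul, abs_of_pos hε]
        have : |φ ((i + 1 : ℕ) * ε, j * ε) - φ c + (φ (i * ε, j * ε) - φ c)| ≤ 2 * ω' :=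
          (abs_add_le _ _).trans (by linarith)
        calc _ ≤ ε * Λ * (2 * ω') := by gcongr; exact bL' c
          _ = _ := by ring
      set P := η * (1 + ε * A) ^ (i + j + 1) with hP
      have hone : 1 ≤ 1 + ε * A := by
        have : 0 ≤ ε * A := by positivity
        linarith
      have hηP : η ≤ P := le_mul_of_one_le_right hη0.le (one_le_pow₀ hone)
      have hPE : P ≤ η * E := by
        rw [hP]; gcongr; exact one_add_pow_le_exp hε.le (by positivity) hN (by omega)
      have hΛP : Λ * (2 * P + η) ≤ 1 / 2 := by
        have : Λ * (2 * P + η) ≤ Λ * (3 * (η * E)) := by gcongr; linarith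
        linarith
      obtain ⟨s₁₁, hs, h0⟩ := exists_vertex_step (ω := ω) (B := P) (η := η) (κ := κ) (K' := K')
        (s₀₀ := s₀₀) (s₁₀ := s₁₀) (s₀₁ := s₀₁) hF.continuous
        (fun δ₀₀ δ₁₀ δ₀₁ δ₁₁ ε μ => hest c δ₀₀ δ₁₀ δ₀₁ δ₁₁ ε μ (hspan c hcQ)) bL' bM' lL' lM'
        hε hε1 hc nW (W₁₀ := columnSum φ ε (i + 1) j) (W₀₁ := columnSum φ ε i (j + 1))
        (W₁₁ := columnSum φ ε (i + 1) (j + 1)) (by linarith)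
        (by rw [columnSum_succ, ← hW, add_sub_cancel_left]; linarith)
        (by
          rw [columnSum_succ, add_sub_right_comm]
          exact (abs_add_le _ _).trans (by linarith))
        (h₀₀.trans (mul_le_mul_of_nonneg_left (pow_le_pow_right₀ hone (by omega)) hη0.le))
        (h₁₀.trans_eq (by rw [hP, add_right_comm])) (h₀₁.trans_eq (by rw [hP, add_assoc])) hw
        (by linarith) (hκ' c hcQ) hK'0 (by rw [hK']; field_simp; rfl) (by rw [hω]; linarith)
        hη0.le hηP hεK'
      refine ⟨s₁₁, hs.trans_eq ?_, ?_⟩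
      · rw [hP, mul_assoc, ← pow_succ]
        congr 2
        omega
      · rw [cast_succ, cast_succ]
        exact h0)
  refine ⟨fun i j => vertex F ε (columnSum φ ε i j) (i * ε, j * ε) (s i j), hcell,
    fun i hi j hj => ?_⟩
  have hs : |s i j| ≤ η * E := (hgood i hi j hj).trans (by
    gcongr; exact one_add_pow_le_exp hε.le (by positivity) hN (by omega))
  have small : ∀ {z : ℝ}, |z| ≤ Λ → |s i j * z| ≤ 1 := fun hz => by
    rw [abs_mul]
    calc _ ≤ η * E * Λ := by gcongr
      _ ≤ 1 := by linarith
  have hε2 : 0 < ε ^ 2 := by positivity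
  beta_reduce
  rw [vertex, Prod.mk_sub_mk, add_sub_cancel_left, add_sub_cancel_left, Prod.norm_def]
  refine max_le ?_ ?_
  all_goals
    rw [Real.norm_eq_abs, abs_mul, abs_of_pos hε2, mul_comm]
    gcongr
  · exact (abs_add_le _ _).trans (add_le_add (W_le hi hj) (small (bM' _)))
  · linarith [small (bL' ((i : ℝ) * ε, (j : ℝ) * ε))]

end Net

lemma pd1_congr {f g : ℝ × ℝ → E3} {U : Set (ℝ × ℝ)} (hU : IsOpen U)
    (h : ∀ x ∈ U, f x = g x) : ∀ x ∈ U, pd1 f x = pd1 g x := fun x hx => by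
  have : f =ᶠ[nhds x] g := Filter.eventuallyEq_of_mem (hU.mem_nhds hx) h
  rw [pd1, pd1, this.fderiv_eq]

lemma pd2_congr {f g : ℝ × ℝ → E3} {U : Set (ℝ × ℝ)} (hU : IsOpen U)
    (h : ∀ x ∈ U, f x = g x) : ∀ x ∈ U, pd2 f x = pd2 g x := fun x hx => by
  have : f =ᶠ[nhds x] g := Filter.eventuallyEq_of_mem (hU.mem_nhds hx) h
  rw [pd2, pd2, this.fderiv_eq]

/-- For a smooth conjugate net `f : Ω → ℝ³` without parabolic points, defined on an open
set containing the unit square, there is a discrete conjugate net (all elementary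
quadrilaterals planar) with all vertices on the surface `f(Ω)` which is `ε²`-close to the
smooth net: `‖g(i,j) − f(iε, jε)‖ ≤ C₀ ε²`. -/
theorem exists_discrete_conjugate_net_on_surface_eps2_close
    (Ω : Set (ℝ × ℝ)) (hΩ : IsOpen Ω) (hsq : Set.Icc (0 : ℝ) 1 ×ˢ Set.Icc (0 : ℝ) 1 ⊆ Ω)
    (f : ℝ × ℝ → E3) (a b : ℝ × ℝ → ℝ)
    (hf : ContDiffOn ℝ (⊤ : ℕ∞) f Ω) (ha : ContDiffOn ℝ (⊤ : ℕ∞) a Ω) (hb : ContDiffOn ℝ (⊤ : ℕ∞) b Ω)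
    (hindep : ∀ p ∈ Ω, LinearIndependent ℝ ![pd1 f p, pd2 f p])
    (hconj : ∀ p ∈ Ω, pd2 (pd1 f) p = a p • pd1 f p + b p • pd2 f p)
    (hnonpar : ∀ p ∈ Ω,
      dot3 (cross3 (pd1 (pd1 f) p) (pd1 f p)) (pd2 f p) ≠ 0 ∧
      dot3 (cross3 (pd2 (pd2 f) p) (pd1 f p)) (pd2 f p) ≠ 0) :
    ∃ C₀ > (0 : ℝ), ∃ ε₀ > (0 : ℝ), ∀ ε : ℝ, 0 < ε → ε < ε₀ →
      ∃ g : ℕ → ℕ → E3,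
        (∀ i j : ℕ, i ≤ ⌊1 / ε⌋₊ → j ≤ ⌊1 / ε⌋₊ → g i j ∈ f '' Ω) ∧
        (∀ i j : ℕ, i < ⌊1 / ε⌋₊ → j < ⌊1 / ε⌋₊ →
          Coplanar ℝ ({g i j, g (i + 1) j, g (i + 1) (j + 1), g i (j + 1)} : Set E3)) ∧
        (∀ i j : ℕ, i ≤ ⌊1 / ε⌋₊ → j ≤ ⌊1 / ε⌋₊ →
          ‖g i j - f (i * ε, j * ε)‖ ≤ C₀ * ε ^ 2) := by

  have hQ : IsCompact unitSquare := isCompact_Icc.prod isCompact_Icc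
  obtain ⟨F, hF, hFc, U, hU, hQU, hUΩ, hFU⟩ :=
    exists_contDiff_hasCompactSupport_eq hQ hΩ hsq hf
  have e₁ := pd1_congr hU hFU
  have e₂ := pd2_congr hU hFU
  have e₁₁ := pd1_congr hU e₁
  have e₁₂ := pd2_congr hU e₁
  have e₂₂ := pd2_congr hU e₂
  have cyclic : ∀ x y z : E3, trip x y z = dot3 (cross3 z x) y := fun x y z => by
    rw [← trip, trip_eq, trip_eq]; ring
  have hspan : ∀ p ∈ unitSquare, pd2 (pd1 F) p ∈ Submodule.span ℝ {pd1 F p, pd2 F p} :=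
    fun p hp => by
      have hp := hQU hp
      rw [e₁₂ p hp, e₁ p hp, e₂ p hp, hconj p (hUΩ hp)]
      exact Submodule.mem_span_pair.2 ⟨a p, b p, rfl⟩
  have hL : ∀ p ∈ unitSquare, coefL F p ≠ 0 := fun p hp => by
    have hp := hQU hp
    rw [coefL, cyclic, e₁₁ p hp, e₁ p hp, e₂ p hp]
    exact (hnonpar p (hUΩ hp)).1
  have hM : ∀ p ∈ unitSquare, coefM F p ≠ 0 := fun p hp => by
    have hp := hQU hp
    rw [coefM, cyclic, e₂₂ p hp, e₁ p hp, e₂ p hp]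
    exact (hnonpar p (hUΩ hp)).2
  obtain ⟨C, hC, ε₁, hε₁, hgrid⟩ := exists_planar_grid hF hFc hspan hL hM
  obtain ⟨D, hD, hlip, -, -⟩ := exists_lipschitz_taylor_bound hF hFc
  obtain ⟨δ, hδ, hδU⟩ := hQ.exists_thickening_subset_open hU hQU
  refine ⟨D * C + 1, by positivity, min ε₁ (min 1 (δ / (C + 1))), by positivity,
    fun ε hε hεε => ?_⟩
  obtain ⟨hεε₁, hε1, hεδ⟩ : ε < ε₁ ∧ ε < 1 ∧ ε < δ / (C + 1) := by simpa using hεε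
  rw [lt_div_iff₀ (by positivity)] at hεδ
  set N := ⌊1 / ε⌋₊
  have hN : (N : ℝ) * ε ≤ 1 := by
    rw [← le_div_iff₀ hε]
    exact Nat.floor_le (by positivity)
  obtain ⟨V, hplanar, hclose⟩ := hgrid ε hε hεε₁ N hN
  have le1 : ∀ {i : ℕ}, i ≤ N → (i : ℝ) * ε ≤ 1 := fun hi => le_trans (by gcongr) hN
  have hsquare : ∀ {i j : ℕ}, i ≤ N → j ≤ N → ((i : ℝ) * ε, (j : ℝ) * ε) ∈ unitSquare :=
    fun hi hj => ⟨⟨by positivity, le1 hi⟩, ⟨by positivity, le1 hj⟩⟩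
  have hVU : ∀ {i j : ℕ}, i ≤ N → j ≤ N → V i j ∈ U := fun {i j} hi hj => by
    refine hδU (Metric.mem_thickening_iff.2 ⟨_, hsquare hi hj, ?_⟩)
    rw [dist_eq_norm]
    refine (hclose i hi j hj).trans_lt ?_
    have : C * ε * ε ≤ C * ε * 1 := by gcongr
    linarith
  refine ⟨fun i j => f (V i j), fun i j hi hj => ⟨_, hUΩ (hVU hi hj), rfl⟩,
    fun i j hi hj => coplanar_of_trip_eq_zero ?_, fun i j hi hj => ?_⟩
  · beta_reduce
    rw [← hFU _ (hVU hi.le hj.le), ← hFU _ (hVU hi hj.le), ← hFU _ (hVU hi.le hj),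
      ← hFU _ (hVU hi hj)]
    exact hplanar i hi j hj
  · beta_reduce
    rw [← hFU _ (hVU hi hj), ← hFU _ (hQU (hsquare hi hj))]
    calc _ ≤ D * (C * ε ^ 2) := (hlip _ _).trans (by gcongr; exact hclose i hi j hj)
      _ ≤ (D * C + 1) * ε ^ 2 := by linarith [sq_nonneg ε]

end
end

section
/- Let f : Ω → ℝ³ be a smooth surface parametrized by curvature lines with no umbilic points (the principal curvatures satisfy k₁ ≠ k₂ at every point of Ω), defined on an open set Ω ⊆ ℝ² containing the closed square [0,1]². Then there exist constants C₀ > 0 and ε₀ > 0 such that for every 0 < ε < ε₀, setting N = ⌊1/ε⌋, there exists a map g : {0, …, N} × {0, …, N} → ℝ³ with the following three properties: (i) every value g(i, j) lies in the image f(Ω); (ii) for all 0 ≤ i, j < N the four points g(i, j), g(i+1, j), g(i+1, j+1), g(i, j+1) are concyclic, i.e. they lie in a common affine plane and on a common sphere (so g is a discrete circular net); (iii) ‖g(i, j) − f(iε, jε)‖ ≤ C₀ ε² for all 0 ≤ i, j ≤ N. -/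
open Metric

noncomputable section

/-- The unit normal of a parametrized surface. -/
def unitNormal (f : ℝ × ℝ → E3) (p : ℝ × ℝ) : E3 :=
  ‖cross3 (pd1 f p) (pd2 f p)‖⁻¹ • cross3 (pd1 f p) (pd2 f p)

/-- The first principal curvature of a curvature-line parametrized surface. -/
def princCurv1 (f : ℝ × ℝ → E3) (p : ℝ × ℝ) : ℝ :=
  dot3 (pd1 (pd1 f) p) (unitNormal f p) / ‖pd1 f p‖ ^ 2

/-- The second principal curvature of a curvature-line parametrized surface. -/
def princCurv2 (f : ℝ × ℝ → E3) (p : ℝ × ℝ) : ℝ :=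
  dot3 (pd2 (pd2 f) p) (unitNormal f p) / ‖pd2 f p‖ ^ 2

open scoped ContDiff in
/-- Smooth dependence on parameters of an integral over the unit interval. -/
theorem contDiff_parametric_integral_zero_one {P : Type} [NormedAddCommGroup P] [NormedSpace ℝ P]
    [FiniteDimensional ℝ P] {E : Type} [NormedAddCommGroup E] [NormedSpace ℝ E] [CompleteSpace E]
    {G : ℝ × P → E} (hG : ContDiff ℝ ∞ G) :
    ContDiff ℝ ∞ (fun p => ∫ t in (0 : ℝ)..1, G (t, p)) := by
  have : ProperSpace P := FiniteDimensional.proper ℝ P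
  rw [contDiff_infty]
  intro n
  induction n generalizing E with
  | zero =>
    rw [Nat.cast_zero, contDiff_zero]
    exact intervalIntegral.continuous_parametric_intervalIntegral_of_continuous'
      (f := fun p t => G (t, p)) (by have := hG.continuous; simp only [Function.uncurry_def]; fun_prop) 0 1
  | succ n ih =>
    set G' : ℝ × P → (P →L[ℝ] E) :=
      fun q => (fderiv ℝ G q).comp (ContinuousLinearMap.inr ℝ ℝ P) with hG'def
    have hG' : ContDiff ℝ ∞ G' :=
      (hG.fderiv_right (m := ∞) (by simp)).clm_comp contDiff_const
    rw [Nat.cast_succ, contDiff_succ_iff_hasFDerivAt]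
    refine ⟨fun p => ∫ t in (0 : ℝ)..1, G' (t, p), ih hG', fun p => ?_⟩
    obtain ⟨C, hC⟩ := ((isCompact_Icc (a := (0 : ℝ)) (b := 1)).prod
      (isCompact_closedBall p 1)).exists_bound_of_continuousOn hG'.continuous.continuousOn
    have hc : ∀ q, Continuous fun t => G (t, q) := fun q => by
      have := hG.continuous; fun_prop
    have hc' : ∀ q, Continuous fun t => G' (t, q) := fun q => by
      have := hG'.continuous; fun_prop
    refine intervalIntegral.hasFDerivAt_integral_of_dominated_of_fderiv_le
      (F := fun q t => G (t, q)) (F' := fun q t => G' (t, q)) (bound := fun _ => C)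
      (ball_mem_nhds p one_pos) ?_ ?_ ?_ ?_ ?_ ?_
    · exact Filter.Eventually.of_forall fun q => (hc q).aestronglyMeasurable
    · exact (hc p).intervalIntegrable _ _
    · exact (hc' p).aestronglyMeasurable
    · refine Filter.Eventually.of_forall fun t ht q hq => hC _ ⟨?_, ball_subset_closedBall hq⟩
      rw [Set.uIoc_of_le zero_le_one] at ht
      exact ⟨ht.1.le, ht.2⟩
    · exact intervalIntegrable_const
    · refine Filter.Eventually.of_forall fun t _ q _ => ?_
      have h1 : HasFDerivAt G (fderiv ℝ G (t, q)) (t, q) :=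
        (hG.differentiable (by simp) _).hasFDerivAt
      exact h1.comp q (hasFDerivAt_prodMk_right t q)

/-- The average of `D` with weight `2 (1 - t)` along a segment, halved: for `D` the second
derivative of a function this is the second order coefficient in Taylor's formula. -/
def taylorAverage {V B : Type} [NormedAddCommGroup V] [NormedSpace ℝ V] [NormedAddCommGroup B]
    [NormedSpace ℝ B] (D : V → B) (q : V × V) : B :=
  ∫ t in (0 : ℝ)..1, (1 - t) • D (q.1 + t • q.2)

section taylorAverage
open scoped ContDiff

variable {V B E : Type} [NormedAddCommGroup V] [NormedSpace ℝ V]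
  [NormedAddCommGroup B] [NormedSpace ℝ B] [CompleteSpace B]
  [NormedAddCommGroup E] [NormedSpace ℝ E] [CompleteSpace E] {F : V → E}

theorem contDiff_taylorAverage [FiniteDimensional ℝ V] {D : V → B} (hD : ContDiff ℝ ∞ D) :
    ContDiff ℝ ∞ (taylorAverage D) := by
  refine contDiff_parametric_integral_zero_one
    (G := fun z : ℝ × V × V => (1 - z.1) • D (z.2.1 + z.1 • z.2.2)) ?_
  fun_prop

theorem taylorAverage_zero (D : V → B) (c : V) :
    taylorAverage D (c, 0) = (1 / 2 : ℝ) • D c := by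
  simp only [taylorAverage, smul_zero, add_zero, intervalIntegral.integral_smul_const]
  congr 1
  rw [intervalIntegral.integral_sub (by simp) (by simp)]
  norm_num

theorem eq_add_taylorAverage (hF : ContDiff ℝ ∞ F) (c x : V) :
    F (c + x) = F c + fderiv ℝ F c x + taylorAverage (fderiv ℝ (fderiv ℝ F)) (c, x) x x := by
  have h1 : ContDiff ℝ ∞ (fderiv ℝ F) := hF.fderiv_right (by simp)
  have h2 : ContDiff ℝ ∞ (fderiv ℝ (fderiv ℝ F)) := h1.fderiv_right (by simp)
  have hl : ∀ t : ℝ, HasDerivAt (fun t : ℝ => c + t • x) x t := fun t => by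
    simpa using ((hasDerivAt_id t).smul_const x).const_add c
  have hd : ∀ t ∈ Set.uIcc (0 : ℝ) 1, HasDerivAt
      (fun t : ℝ => F (c + t • x) + (1 - t) • fderiv ℝ F (c + t • x) x)
      (((1 - t) • fderiv ℝ (fderiv ℝ F) (c + t • x)) x x) t := by
    intro t _
    have e1 := (hF.differentiable (by simp) (c + t • x)).hasFDerivAt.comp_hasDerivAt t (hl t)
    have e2 := (h1.differentiable (by simp) (c + t • x)).hasFDerivAt.comp_hasDerivAt t (hl t)
    have e3 : HasDerivAt (fun t : ℝ => fderiv ℝ F (c + t • x) x)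
        (fderiv ℝ (fderiv ℝ F) (c + t • x) x x) t := by
      simpa using e2.clm_apply (hasDerivAt_const t x)
    have e4 : HasDerivAt (fun t : ℝ => 1 - t) (-1) t := by
      simpa using (hasDerivAt_id t).const_sub 1
    refine (e1.add (e4.smul e3)).congr_deriv ?_
    simp
  have hcont : Continuous fun t : ℝ => (1 - t) • fderiv ℝ (fderiv ℝ F) (c + t • x) := by
    have := h2.continuous
    fun_prop
  have := intervalIntegral.integral_eq_sub_of_hasDerivAt hd
    (Continuous.intervalIntegrable (by fun_prop) _ _)
  have e : taylorAverage (fderiv ℝ (fderiv ℝ F)) (c, x) x x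
      = ∫ t in (0 : ℝ)..1, ((1 - t) • fderiv ℝ (fderiv ℝ F) (c + t • x)) x x := by
    rw [taylorAverage, ContinuousLinearMap.intervalIntegral_apply (hcont.intervalIntegrable _ _),
      ContinuousLinearMap.intervalIntegral_apply]
    exact Continuous.intervalIntegrable (by fun_prop) _ _
  rw [e, this]
  simp

end taylorAverage

section order_two
open scoped ContDiff

variable {W : Type} [NormedAddCommGroup W] [NormedSpace ℝ W]

theorem abs_le_sq_of_deriv_deriv_le {g g' g'' : ℝ → ℝ} {C ε : ℝ} (hε : 0 ≤ ε)
    (hg : ∀ t ∈ Set.Icc 0 ε, HasDerivAt g (g' t) t)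
    (hg' : ∀ t ∈ Set.Icc 0 ε, HasDerivAt g' (g'' t) t)
    (h0 : g 0 = 0) (h0' : g' 0 = 0) (hC : ∀ t ∈ Set.Icc 0 ε, |g'' t| ≤ C) :
    |g ε| ≤ C * ε ^ 2 := by
  have hC0 : 0 ≤ C := (abs_nonneg _).trans (hC 0 ⟨le_rfl, hε⟩)
  have step : ∀ t ∈ Set.Icc 0 ε, |g' t| ≤ C * ε := by
    intro t ht
    have := (convex_Icc 0 ε).norm_image_sub_le_of_norm_hasDerivWithin_le
      (fun x hx => (hg' x hx).hasDerivWithinAt) hC ⟨le_rfl, hε⟩ ht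
    rw [h0', sub_zero, sub_zero, Real.norm_eq_abs, Real.norm_eq_abs, abs_of_nonneg ht.1] at this
    exact this.trans (mul_le_mul_of_nonneg_left ht.2 hC0)
  have := (convex_Icc 0 ε).norm_image_sub_le_of_norm_hasDerivWithin_le
    (fun x hx => (hg x hx).hasDerivWithinAt) step ⟨le_rfl, hε⟩ (Set.right_mem_Icc.2 hε)
  rw [h0, sub_zero, sub_zero, Real.norm_eq_abs, Real.norm_eq_abs, abs_of_nonneg hε] at this
  linarith

theorem deriv_eq_zero_of_even {g : ℝ → ℝ} {d : ℝ} (hg : ∀ t, g (-t) = g t)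
    (hd : HasDerivAt g d 0) : d = 0 := by
  have hd' : HasDerivAt g d (-(0 : ℝ)) := by simpa using hd
  have h : HasDerivAt (fun t => g (-t)) (d * -1) 0 := hd'.comp 0 (hasDerivAt_neg 0)
  simp only [hg] at h
  have := h.unique hd
  linarith

/-- A smooth function of `(ε, w)`, even in `ε` and vanishing at `ε = 0`, is `ε²` times a family
that is bounded and Lipschitz in `w` on compact convex sets. -/
theorem exists_lipschitz_of_even {O K : Set W} (hO : IsOpen O) (hK : IsCompact K)
    (hKc : Convex ℝ K) (hKO : K ⊆ O) {h : ℝ × W → ℝ}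
    (hh : ContDiffOn ℝ ∞ h (Set.univ ×ˢ O)) (h0 : ∀ w ∈ O, h (0, w) = 0)
    (heven : ∀ ε, ∀ w ∈ O, h (-ε, w) = h (ε, w)) :
    ∃ L : ℝ, 0 ≤ L ∧ ∀ ε ∈ Set.Icc (0 : ℝ) 1, ∀ w ∈ K, |h (ε, w)| ≤ L * ε ^ 2 ∧
      ∀ w' ∈ K, |h (ε, w) - h (ε, w')| ≤ L * ‖w - w'‖ * ε ^ 2 := by
  have hU : IsOpen ((Set.univ : Set ℝ) ×ˢ O) := isOpen_univ.prod hO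
  have hD : ∀ k : ℝ × W → ℝ, ContDiffOn ℝ ∞ k (Set.univ ×ˢ O) →
      ContDiffOn ℝ ∞ (fun q => fderiv ℝ k q (1, 0)) (Set.univ ×ˢ O) := fun k hk =>
    (hk.fderiv_of_isOpen hU (by simp)).clm_apply contDiffOn_const
  have hder : ∀ k : ℝ × W → ℝ, ContDiffOn ℝ ∞ k (Set.univ ×ˢ O) → ∀ t, ∀ w ∈ O,
      HasDerivAt (fun t => k (t, w)) (fderiv ℝ k (t, w) (1, 0)) t := by
    intro k hk t w hw
    have h1 : HasFDerivAt k (fderiv ℝ k (t, w)) (t, w) :=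
      ((hk.contDiffAt (hU.mem_nhds ⟨trivial, hw⟩)).differentiableAt (by simp)).hasFDerivAt
    exact h1.comp_hasDerivAt t ((hasDerivAt_id t).prodMk (hasDerivAt_const t w))
  set h1 : ℝ × W → ℝ := fun q => fderiv ℝ h q (1, 0) with h1def
  set h2 : ℝ × W → ℝ := fun q => fderiv ℝ h1 q (1, 0) with h2def
  have hh1 := hD h hh
  have hh2 := hD h1 hh1
  set B : Set (ℝ × W) := Set.Icc 0 1 ×ˢ K with hB
  have hBU : B ⊆ Set.univ ×ˢ O := Set.prod_mono (Set.subset_univ _) hKO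
  have hBc : IsCompact B := isCompact_Icc.prod hK
  have hBconv : Convex ℝ B := (convex_Icc _ _).prod hKc
  obtain ⟨C, hC⟩ := hBc.exists_bound_of_continuousOn (hh2.continuousOn.mono hBU)
  obtain ⟨C', hC'⟩ := hBc.exists_bound_of_continuousOn
    ((hh2.continuousOn_fderiv_of_isOpen hU (by simp)).mono hBU)
  have hz : ∀ w ∈ O, h1 (0, w) = 0 := fun w hw =>
    deriv_eq_zero_of_even (fun t => heven t w hw) (hder h hh 0 w hw)
  refine ⟨max 0 (max C C'), le_max_left _ _, fun ε hε w hw => ⟨?_, fun w' hw' => ?_⟩⟩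
  · have := abs_le_sq_of_deriv_deriv_le (g := fun t => h (t, w)) hε.1
      (fun t _ => hder h hh t w (hKO hw)) (fun t _ => hder h1 hh1 t w (hKO hw))
      (h0 w (hKO hw)) (hz w (hKO hw)) (C := C)
      (fun t ht => hC (t, w) ⟨⟨ht.1, ht.2.trans hε.2⟩, hw⟩)
    refine this.trans (mul_le_mul_of_nonneg_right ?_ (sq_nonneg _))
    exact (le_max_left _ _).trans (le_max_right _ _)
  · have hl : ∀ t ∈ Set.Icc 0 ε, |h2 (t, w) - h2 (t, w')| ≤ C' * ‖w - w'‖ := by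
      intro t ht
      have ht' : t ∈ Set.Icc (0 : ℝ) 1 := ⟨ht.1, ht.2.trans hε.2⟩
      have := hBconv.norm_image_sub_le_of_norm_fderiv_le (f := h2) (C := C')
        (x := (t, w')) (y := (t, w))
        (fun q hq => (hh2.contDiffAt (hU.mem_nhds (hBU hq))).differentiableAt (by simp))
        (fun q hq => hC' q hq) ⟨ht', hw'⟩ ⟨ht', hw⟩
      simpa [Prod.norm_def] using this
    have := abs_le_sq_of_deriv_deriv_le (g := fun t => h (t, w) - h (t, w')) hε.1
      (fun t _ => (hder h hh t w (hKO hw)).sub (hder h hh t w' (hKO hw')))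
      (fun t _ => (hder h1 hh1 t w (hKO hw)).sub (hder h1 hh1 t w' (hKO hw')))
      (by simp [h0 w (hKO hw), h0 w' (hKO hw')]) 
      (by have e := hz w (hKO hw); have e' := hz w' (hKO hw'); simp only [h1def] at e e'; simp [e, e'])
      (C := C' * ‖w - w'‖) hl
    refine this.trans ?_
    have : C' ≤ max 0 (max C C') := (le_max_right _ _).trans (le_max_right _ _)
    gcongr

end order_two

/-- Local coordinates of a parameter quadrilateral: centre and the three scaled
deviations from it. -/
abbrev CellParam : Type := (ℝ × ℝ) × (ℝ × ℝ) × (ℝ × ℝ) × (ℝ × ℝ)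

/-- The coordinates of the undisturbed square cell with centre `c`. -/
def squareCell (c : ℝ × ℝ) : CellParam := (c, (1 / 2, 0), (0, 1 / 2), 0)

/-- The coordinates of the cell with centre `c` whose vertices are displaced by
`e₀₀`, `e₁₀`, `e₀₁` and `e₁₀ + e₀₁ - e₀₀ + 4 ε² ζ`. -/
def displacedCell (ε : ℝ) (c e00 e10 e01 ζ : ℝ × ℝ) : CellParam :=
  (c + (1 / 2 : ℝ) • (e10 + e01) + ε ^ 2 • ζ,
    (1 / 2, 0) + (1 / (2 * ε)) • (e10 - e00) + ε • ζ,
    (0, 1 / 2) + (1 / (2 * ε)) • (e01 - e00) + ε • ζ, ζ)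

/-- The centre of the cell `(i, j)` of the square grid of mesh size `ε`. -/
def cellCentre (ε : ℝ) (i j : ℕ) : ℝ × ℝ := ((i + 1 / 2) * ε, (j + 1 / 2) * ε)

/-- Solution of a discrete Goursat problem with zero boundary values. -/
def goursat {X : Type} [Zero X] (S : ℕ → ℕ → X → X → X → X) : ℕ → ℕ → X
  | 0, _ => 0
  | _ + 1, 0 => 0
  | i + 1, j + 1 => S i j (goursat S i j) (goursat S (i + 1) j) (goursat S i (j + 1))

theorem norm_displacedCell_sub_le {ε : ℝ} (hε : 0 < ε) (hε1 : ε ≤ 1)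
    (c e00 e10 e01 ζ ζ' : ℝ × ℝ) :
    ‖displacedCell ε c e00 e10 e01 ζ - displacedCell ε c e00 e10 e01 ζ'‖ ≤ ‖ζ - ζ'‖ := by
  have h2 : ε ^ 2 ≤ 1 := pow_le_one₀ hε.le hε1
  have h : displacedCell ε c e00 e10 e01 ζ - displacedCell ε c e00 e10 e01 ζ'
      = (ε ^ 2 • (ζ - ζ'), ε • (ζ - ζ'), ε • (ζ - ζ'), ζ - ζ') := by
    simp [displacedCell, smul_sub]
  rw [h]
  simp only [Prod.norm_mk, norm_smul, Real.norm_eq_abs, abs_of_pos hε, abs_of_pos (pow_pos hε 2)]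
  have := norm_nonneg (ζ - ζ')
  refine max_le ?_ (max_le ?_ (max_le ?_ le_rfl)) <;> nlinarith

theorem exists_displacedCell_eq {L ε : ℝ} {H₁ H₂ : CellParam → ℝ} (hL : 0 ≤ L) (hε : 0 < ε)
    (hε1 : ε ≤ 1) (hLε : 16 * L * ε ≤ 1)
    (h₁ : ∀ w w', |H₁ w - H₁ w'| ≤ L * ‖w - w'‖) (h₂ : ∀ w w', |H₂ w - H₂ w'| ≤ L * ‖w - w'‖)
    (c e00 e10 e01 : ℝ × ℝ) :
    ∃ ζ : ℝ × ℝ,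
      ζ.1 = -(e01.1 - e00.1) / (2 * ε ^ 2) + ε * H₁ (displacedCell ε c e00 e10 e01 ζ) ∧
      ζ.2 = -(e10.2 - e00.2) / (2 * ε ^ 2) + ε * H₂ (displacedCell ε c e00 e10 e01 ζ) := by
  set Z : ℝ × ℝ → ℝ × ℝ := fun ζ =>
    (-(e01.1 - e00.1) / (2 * ε ^ 2) + ε * H₁ (displacedCell ε c e00 e10 e01 ζ),
      -(e10.2 - e00.2) / (2 * ε ^ 2) + ε * H₂ (displacedCell ε c e00 e10 e01 ζ)) with hZ
  have hlip : LipschitzWith (1 / 2) Z := by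
    refine LipschitzWith.of_dist_le_mul fun ζ ζ' => ?_
    have hw := norm_displacedCell_sub_le hε hε1 c e00 e10 e01 ζ ζ'
    have key : ∀ H : CellParam → ℝ, (∀ w w', |H w - H w'| ≤ L * ‖w - w'‖) →
        |ε * H (displacedCell ε c e00 e10 e01 ζ) - ε * H (displacedCell ε c e00 e10 e01 ζ')|
          ≤ 1 / 2 * ‖ζ - ζ'‖ := by
      intro H hH
      rw [← mul_sub, abs_mul, abs_of_pos hε]
      have h3 := (hH _ _).trans (mul_le_mul_of_nonneg_left hw hL)
      have h4 := mul_le_mul_of_nonneg_left h3 hε.le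
      nlinarith [norm_nonneg (ζ - ζ')]
    rw [dist_eq_norm, dist_eq_norm, hZ]
    simp only [Prod.mk_sub_mk, add_sub_add_left_eq_sub, Prod.norm_mk, Real.norm_eq_abs]
    exact max_le (by simpa using key H₁ h₁) (by simpa using key H₂ h₂)
  have hc : ContractingWith (1 / 2) Z := ⟨by
    rw [← NNReal.coe_lt_coe]; norm_num, hlip⟩
  have := hc.fixedPoint_isFixedPt
  refine ⟨ContractingWith.fixedPoint Z hc, ?_, ?_⟩
  · exact (congrArg Prod.fst this.eq).symm
  · exact (congrArg Prod.snd this.eq).symm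

/-- The a priori estimate for one cell. -/
theorem norm_displacedCell_sub_squareCell_le {L ε Z : ℝ} {H₁ H₂ : CellParam → ℝ} (hL : 1 ≤ L)
    (hε : 0 < ε) (hε1 : ε ≤ 1) (hLε : 16 * L * ε ≤ 1) (hZ : 16 * L ≤ Z)
    (h₁ : ∀ w w', |H₁ w - H₁ w'| ≤ L * ‖w - w'‖) (h₂ : ∀ w w', |H₂ w - H₂ w'| ≤ L * ‖w - w'‖)
    {c e00 e10 e01 ζ : ℝ × ℝ}
    (hc₁ : |H₁ (squareCell c)| ≤ 4 * L) (hc₂ : |H₂ (squareCell c)| ≤ 4 * L)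
    (h00 : ‖e00‖ ≤ 3 * ε ^ 2 * Z) (h10 : ‖e10‖ ≤ 3 * ε ^ 2 * Z) (h01 : ‖e01‖ ≤ 3 * ε ^ 2 * Z)
    (hA : |e01.1 - e00.1| ≤ Z * ε ^ 3) (hD : |e10.2 - e00.2| ≤ Z * ε ^ 3)
    (hζ₁ : ζ.1 = -(e01.1 - e00.1) / (2 * ε ^ 2) + ε * H₁ (displacedCell ε c e00 e10 e01 ζ))
    (hζ₂ : ζ.2 = -(e10.2 - e00.2) / (2 * ε ^ 2) + ε * H₂ (displacedCell ε c e00 e10 e01 ζ)) :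
    ‖displacedCell ε c e00 e10 e01 ζ - squareCell c‖ ≤ 5 * ε * Z := by
  set Y := ‖displacedCell ε c e00 e10 e01 ζ - squareCell c‖ with hY
  have hY0 : 0 ≤ Y := norm_nonneg _
  have hζ : ‖ζ‖ ≤ 3 / 4 * ε * Z + Y / 16 := by
    have key : ∀ (H : CellParam → ℝ) (x a : ℝ), (∀ w w', |H w - H w'| ≤ L * ‖w - w'‖) →
        |H (squareCell c)| ≤ 4 * L → |a| ≤ Z * ε ^ 3 →
        x = -a / (2 * ε ^ 2) + ε * H (displacedCell ε c e00 e10 e01 ζ) →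
        |x| ≤ 3 / 4 * ε * Z + Y / 16 := by
      intro H x a hH hc ha hx
      have e1 : |-a / (2 * ε ^ 2)| ≤ ε * Z / 2 := by
        rw [abs_div, abs_neg, abs_of_pos (by positivity : (0 : ℝ) < 2 * ε ^ 2),
          div_le_iff₀ (by positivity)]
        linarith
      have e2 := hH (displacedCell ε c e00 e10 e01 ζ) (squareCell c)
      have e3 : |H (displacedCell ε c e00 e10 e01 ζ)| ≤ 4 * L + L * Y := by
        have := abs_sub_abs_le_abs_sub (H (displacedCell ε c e00 e10 e01 ζ)) (H (squareCell c))
        linarith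
      have e4 : |ε * H (displacedCell ε c e00 e10 e01 ζ)| ≤ ε * (4 * L + L * Y) := by
        rw [abs_mul, abs_of_pos hε]
        exact mul_le_mul_of_nonneg_left e3 hε.le
      rw [hx]
      refine (abs_add_le _ _).trans ?_
      have e5 : ε * (16 * L) ≤ ε * Z := mul_le_mul_of_nonneg_left hZ hε.le
      have e6 : 16 * L * ε * Y ≤ 1 * Y := mul_le_mul_of_nonneg_right hLε hY0
      linarith
    rw [Prod.norm_def]
    exact max_le (key H₁ _ _ h₁ hc₁ hA hζ₁) (key H₂ _ _ h₂ hc₂ hD hζ₂)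
  have hZ0 : 0 ≤ Z := by linarith
  have hε2 : ε ^ 2 ≤ ε := by nlinarith
  have hsub : displacedCell ε c e00 e10 e01 ζ - squareCell c
      = ((1 / 2 : ℝ) • (e10 + e01) + ε ^ 2 • ζ, (1 / (2 * ε)) • (e10 - e00) + ε • ζ,
        (1 / (2 * ε)) • (e01 - e00) + ε • ζ, ζ) := by
    simp [displacedCell, squareCell, add_assoc]
  have hn := norm_nonneg ζ
  have hquot : ∀ e e' : ℝ × ℝ, ‖e‖ ≤ 3 * ε ^ 2 * Z → ‖e'‖ ≤ 3 * ε ^ 2 * Z →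
      ‖(1 / (2 * ε)) • (e - e') + ε • ζ‖ ≤ 3 * ε * Z + ‖ζ‖ := by
    intro e e' he he'
    refine (norm_add_le _ _).trans (add_le_add ?_ ?_)
    · rw [norm_smul, Real.norm_eq_abs, abs_of_pos (by positivity), one_div_mul_eq_div,
        div_le_iff₀ (by positivity)]
      refine (norm_sub_le _ _).trans ?_
      linarith
    · rw [norm_smul, Real.norm_eq_abs, abs_of_pos hε]
      nlinarith
  have hbound : Y ≤ 3 * ε * Z + ‖ζ‖ := by
    rw [hY, hsub]
    simp only [Prod.norm_mk]
    refine max_le ?_ (max_le (hquot _ _ h10 h00) (max_le (hquot _ _ h01 h00) ?_))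
    · refine (norm_add_le _ _).trans (add_le_add ?_ ?_)
      · rw [norm_smul, Real.norm_eq_abs, abs_of_pos (by norm_num)]
        have := norm_add_le e10 e01
        nlinarith
      · rw [norm_smul, Real.norm_eq_abs, abs_of_pos (by positivity)]
        nlinarith
    · have : 0 ≤ 3 * ε * Z := by positivity
      linarith
  have : 0 ≤ ε * Z := by positivity
  linarith

/-- Existence and `ε²`-smallness of displacements solving the cell equations on the grid. -/
theorem exists_small_displacement {L ε : ℝ} {H₁ H₂ : CellParam → ℝ} (hL : 1 ≤ L)
    (hε : 0 < ε) (hε1 : ε ≤ 1) (hLε : 16 * L * ε ≤ 1)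
    (h₁ : ∀ w w', |H₁ w - H₁ w'| ≤ L * ‖w - w'‖) (h₂ : ∀ w w', |H₂ w - H₂ w'| ≤ L * ‖w - w'‖)
    (h0₁ : |H₁ (squareCell 0)| ≤ L) (h0₂ : |H₂ (squareCell 0)| ≤ L) :
    ∃ e ζ : ℕ → ℕ → ℝ × ℝ,
      (∀ i j, e (i + 1) (j + 1) = e (i + 1) j + e i (j + 1) - e i j + (4 * ε ^ 2) • ζ i j) ∧
      (∀ i j, ζ i j = (
        -((e i (j + 1)).1 - (e i j).1) / (2 * ε ^ 2) +
          ε * H₁ (displacedCell ε (cellCentre ε i j) (e i j) (e (i + 1) j) (e i (j + 1)) (ζ i j)),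
        -((e (i + 1) j).2 - (e i j).2) / (2 * ε ^ 2) +
          ε * H₂ (displacedCell ε (cellCentre ε i j) (e i j) (e (i + 1) j) (e i (j + 1))
            (ζ i j)))) ∧
      (∀ i j : ℕ, ((i + j : ℕ) + 1 : ℝ) * ε ≤ 3 →
        ‖e i j‖ ≤ 80 * L * Real.exp (63 * L) * ε ^ 2 ∧
        ‖displacedCell ε (cellCentre ε i j) (e i j) (e (i + 1) j) (e i (j + 1)) (ζ i j)
          - squareCell (cellCentre ε i j)‖ ≤ 80 * L * Real.exp (63 * L) * ε) := by
  have hL0 : 0 ≤ L := by linarith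
  choose sol hsol₁ hsol₂ using fun c e00 e10 e01 : ℝ × ℝ =>
    exists_displacedCell_eq hL0 hε hε1 hLε h₁ h₂ c e00 e10 e01
  set e : ℕ → ℕ → ℝ × ℝ := goursat fun i j e00 e10 e01 =>
    e10 + e01 - e00 + (4 * ε ^ 2) • sol (cellCentre ε i j) e00 e10 e01 with he
  set ζ : ℕ → ℕ → ℝ × ℝ := fun i j =>
    sol (cellCentre ε i j) (e i j) (e (i + 1) j) (e i (j + 1)) with hζ
  have hζ₁ : ∀ i j, (ζ i j).1 = -((e i (j + 1)).1 - (e i j).1) / (2 * ε ^ 2) +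
      ε * H₁ (displacedCell ε (cellCentre ε i j) (e i j) (e (i + 1) j) (e i (j + 1)) (ζ i j)) :=
    fun i j => hsol₁ _ _ _ _
  have hζ₂ : ∀ i j, (ζ i j).2 = -((e (i + 1) j).2 - (e i j).2) / (2 * ε ^ 2) +
      ε * H₂ (displacedCell ε (cellCentre ε i j) (e i j) (e (i + 1) j) (e i (j + 1)) (ζ i j)) :=
    fun i j => hsol₂ _ _ _ _
  have hrec : ∀ i j,
      e (i + 1) (j + 1) = e (i + 1) j + e i (j + 1) - e i j + (4 * ε ^ 2) • ζ i j := by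
    intro i j
    rw [he, goursat]
  have hleft : ∀ j, e 0 j = 0 := fun j => by rw [he, goursat]
  have hbot : ∀ i, e i 0 = 0 := fun i => by cases i <;> rw [he, goursat]
  have hgrid : ∀ i j i' j' : ℕ, squareCell (cellCentre ε i j) - squareCell (cellCentre ε i' j') =
      ((((i : ℝ) - i') * ε, ((j : ℝ) - j') * ε), 0, 0, 0) := by
    intro i j i' j'
    simp only [squareCell, cellCentre, Prod.mk_sub_mk, sub_self, Prod.mk_zero_zero]
    congr 2 <;> ring
  have hφ : ∀ H : CellParam → ℝ, (∀ w w', |H w - H w'| ≤ L * ‖w - w'‖) →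
      |H (squareCell 0)| ≤ L → ∀ i j : ℕ, ((i + j : ℕ) + 1 : ℝ) * ε ≤ 3 →
      |H (squareCell (cellCentre ε i j))| ≤ 4 * L := by
    intro H hH hH0 i j hij
    have e1 : ‖squareCell (cellCentre ε i j) - squareCell 0‖ ≤ 3 := by
      have hi : (0 : ℝ) ≤ i := i.cast_nonneg
      have hj : (0 : ℝ) ≤ j := j.cast_nonneg
      push_cast at hij
      simp only [squareCell, cellCentre, Prod.mk_sub_mk, sub_self, sub_zero,
        Prod.norm_mk, norm_zero, Real.norm_eq_abs]
      rw [abs_of_nonneg (by positivity), abs_of_nonneg (by positivity)]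
      refine max_le (max_le ?_ ?_) (by simp) <;> nlinarith
    have e2 := hH (squareCell (cellCentre ε i j)) (squareCell 0)
    have e3 := abs_sub_abs_le_abs_sub (H (squareCell (cellCentre ε i j))) (H (squareCell 0))
    nlinarith
  set q : ℝ := 1 + 21 * L * ε with hq
  have hq1 : 1 ≤ q := by rw [hq]; have : 0 ≤ L * ε := by positivity
                         linarith
  set Z : ℕ → ℝ := fun n => 16 * L * q ^ n with hZdef
  have hZ16 : ∀ n, 16 * L ≤ Z n := fun n => by
    have := one_le_pow₀ hq1 (n := n)
    simp only [hZdef]; nlinarith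
  have hZsucc : ∀ n, Z (n + 1) = Z n + 21 * L * ε * Z n := fun n => by
    simp only [hZdef, hq]; ring
  -- consequences of the bounds on edges
  have hedge : ∀ n : ℕ, ((n : ℝ) + 1) * ε ≤ 3 →
      (∀ i j, i + j ≤ n →
        |(e i (j + 1)).1 - (e i j).1 - 2 * ε ^ 3 * H₁ (squareCell (cellCentre ε i j))|
          ≤ (Z n - 8 * L) * ε ^ 3 ∧
        |(e (i + 1) j).2 - (e i j).2 - 2 * ε ^ 3 * H₂ (squareCell (cellCentre ε i j))|
          ≤ (Z n - 8 * L) * ε ^ 3) →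
      (∀ i j, i + j ≤ n → |(e i (j + 1)).1 - (e i j).1| ≤ Z n * ε ^ 3 ∧
        |(e (i + 1) j).2 - (e i j).2| ≤ Z n * ε ^ 3) ∧
      (∀ i j, i + j ≤ n + 1 → ‖e i j‖ ≤ 3 * ε ^ 2 * Z n) ∧
      (∀ i j, i + j ≤ n →
        ‖displacedCell ε (cellCentre ε i j) (e i j) (e (i + 1) j) (e i (j + 1)) (ζ i j)
          - squareCell (cellCentre ε i j)‖ ≤ 5 * ε * Z n) := by
    intro n hn hP
    have hlev : ∀ i j : ℕ, i + j ≤ n → ((i + j : ℕ) + 1 : ℝ) * ε ≤ 3 := by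
      intro i j hij
      have : ((i + j : ℕ) : ℝ) ≤ n := by exact_mod_cast hij
      nlinarith
    have hZ0 : 0 ≤ Z n := by have := hZ16 n; linarith
    have hE : ∀ i j, i + j ≤ n → |(e i (j + 1)).1 - (e i j).1| ≤ Z n * ε ^ 3 ∧
        |(e (i + 1) j).2 - (e i j).2| ≤ Z n * ε ^ 3 := by
      intro i j hij
      have hε3 : 0 < ε ^ 3 := by positivity
      have key : ∀ x H : ℝ, |H| ≤ 4 * L → |x - 2 * ε ^ 3 * H| ≤ (Z n - 8 * L) * ε ^ 3 →
          |x| ≤ Z n * ε ^ 3 := by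
        intro x H hH hx
        have e1 : |2 * ε ^ 3 * H| ≤ 2 * ε ^ 3 * (4 * L) := by
          rw [abs_mul, abs_of_pos (by positivity)]
          exact mul_le_mul_of_nonneg_left hH (by positivity)
        have e2 := abs_sub_abs_le_abs_sub x (2 * ε ^ 3 * H)
        linarith
      exact ⟨key _ _ (hφ H₁ h₁ h0₁ i j (hlev i j hij)) (hP i j hij).1,
        key _ _ (hφ H₂ h₂ h0₂ i j (hlev i j hij)) (hP i j hij).2⟩
    have hfst : ∀ j i, i + j ≤ n + 1 → |(e i j).1| ≤ j * (Z n * ε ^ 3) := by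
      intro j
      induction j with
      | zero => intro i _; simp [hbot]
      | succ j ih =>
        intro i hij
        have e1 := ih i (by omega)
        have e2 := (hE i j (by omega)).1
        have e3 := abs_sub_abs_le_abs_sub (e i (j + 1)).1 (e i j).1
        push_cast
        linarith
    have hsnd : ∀ i j, i + j ≤ n + 1 → |(e i j).2| ≤ i * (Z n * ε ^ 3) := by
      intro i
      induction i with
      | zero => intro i _; simp [hleft]
      | succ i ih =>
        intro j hij
        have e1 := ih j (by omega)
        have e2 := (hE i j (by omega)).2
        have e3 := abs_sub_abs_le_abs_sub (e (i + 1) j).2 (e i j).2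
        push_cast
        linarith
    have hnorm : ∀ i j, i + j ≤ n + 1 → ‖e i j‖ ≤ 3 * ε ^ 2 * Z n := by
      intro i j hij
      have key : ∀ m : ℕ, m ≤ n + 1 → m * (Z n * ε ^ 3) ≤ 3 * ε ^ 2 * Z n := by
        intro m hm
        have h1 : (m : ℝ) ≤ n + 1 := by exact_mod_cast hm
        have h2 : (m : ℝ) * ε ≤ 3 := (mul_le_mul_of_nonneg_right h1 hε.le).trans hn
        have h3 : 0 ≤ Z n * ε ^ 2 := by positivity
        calc m * (Z n * ε ^ 3) = (m * ε) * (Z n * ε ^ 2) := by ring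
          _ ≤ 3 * (Z n * ε ^ 2) := mul_le_mul_of_nonneg_right h2 h3
          _ = _ := by ring
      rw [Prod.norm_def]
      exact max_le ((hfst j i hij).trans (key j (by omega)))
        ((hsnd i j hij).trans (key i (by omega)))
    refine ⟨hE, hnorm, fun i j hij => ?_⟩
    exact norm_displacedCell_sub_squareCell_le hL hε hε1 hLε (hZ16 n) h₁ h₂
      (hφ H₁ h₁ h0₁ i j (hlev i j hij)) (hφ H₂ h₂ h0₂ i j (hlev i j hij))
      (hnorm _ _ (by omega)) (hnorm _ _ (by omega)) (hnorm _ _ (by omega))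
      (hE i j hij).1 (hE i j hij).2 (hζ₁ i j) (hζ₂ i j)
  have hmain : ∀ n : ℕ, ((n : ℝ) + 1) * ε ≤ 3 → ∀ i j, i + j ≤ n →
      |(e i (j + 1)).1 - (e i j).1 - 2 * ε ^ 3 * H₁ (squareCell (cellCentre ε i j))|
        ≤ (Z n - 8 * L) * ε ^ 3 ∧
      |(e (i + 1) j).2 - (e i j).2 - 2 * ε ^ 3 * H₂ (squareCell (cellCentre ε i j))|
        ≤ (Z n - 8 * L) * ε ^ 3 := by
    have hbase : ∀ m (i j : ℕ) (H : CellParam → ℝ), (∀ w w', |H w - H w'| ≤ L * ‖w - w'‖) →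
        |H (squareCell 0)| ≤ L → ((i + j : ℕ) + 1 : ℝ) * ε ≤ 3 →
        |0 - 2 * ε ^ 3 * H (squareCell (cellCentre ε i j))| ≤ (Z m - 8 * L) * ε ^ 3 := by
      intro m i j H hH hH0 hij
      have h3 := hφ H hH hH0 i j hij
      have h4 := hZ16 m
      rw [zero_sub, abs_neg, abs_mul, abs_of_pos (by positivity)]
      have : 0 < ε ^ 3 := by positivity
      nlinarith
    -- propagation across one cell
    have hstep : ∀ (n : ℕ) (x y ζ' h h' : ℝ) (H : CellParam → ℝ) (w : CellParam)
        (i j i' j' : ℕ), (∀ w w', |H w - H w'| ≤ L * ‖w - w'‖) →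
        ‖squareCell (cellCentre ε i j) - squareCell (cellCentre ε i' j')‖ ≤ ε →
        ‖w - squareCell (cellCentre ε i j)‖ ≤ 5 * ε * Z n →
        h = H (squareCell (cellCentre ε i j)) → h' = H (squareCell (cellCentre ε i' j')) →
        ζ' = -x / (2 * ε ^ 2) + ε * H w → y = x + 4 * ε ^ 2 * ζ' →
        |x - 2 * ε ^ 3 * h| ≤ (Z n - 8 * L) * ε ^ 3 →
        |y - 2 * ε ^ 3 * h'| ≤ (Z (n + 1) - 8 * L) * ε ^ 3 := by
      intro n x y ζ' h h' H w i j i' j' hH hsq hw hh hh' hζ' hy hx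
      have e1 : |H w - h| ≤ L * (5 * ε * Z n) := by
        rw [hh]; exact (hH _ _).trans (mul_le_mul_of_nonneg_left hw hL0)
      have e2 : |h - h'| ≤ L * ε := by
        rw [hh, hh']; exact (hH _ _).trans (mul_le_mul_of_nonneg_left hsq hL0)
      have e3 : y - 2 * ε ^ 3 * h' =
          -(x - 2 * ε ^ 3 * h) + ε ^ 3 * (4 * (H w - h) + 2 * (h - h')) := by
        rw [hy, hζ']; field_simp; ring
      rw [e3, hZsucc]
      refine (abs_add_le _ _).trans ?_
      rw [abs_neg, abs_mul, abs_of_pos (by positivity : 0 < ε ^ 3)]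
      have e4 : |4 * (H w - h) + 2 * (h - h')| ≤ 21 * L * ε * Z n := by
        refine (abs_add_le _ _).trans ?_
        rw [abs_mul, abs_mul, abs_of_pos (by norm_num : (0 : ℝ) < 4),
          abs_of_pos (by norm_num : (0 : ℝ) < 2)]
        have : L * ε * 16 ≤ L * ε * Z n :=
          mul_le_mul_of_nonneg_left (by linarith [hZ16 n]) (by positivity)
        linarith
      have := mul_le_mul_of_nonneg_left e4 (by positivity : 0 ≤ ε ^ 3)
      linarith
    intro n
    induction n with
    | zero =>
      intro hn i j hij
      obtain ⟨rfl, rfl⟩ : i = 0 ∧ j = 0 := by omega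
      simp only [hleft, hbot, Prod.fst_zero, Prod.snd_zero, sub_zero]
      exact ⟨hbase 0 0 0 H₁ h₁ h0₁ (by simpa using hn), hbase 0 0 0 H₂ h₂ h0₂ (by simpa using hn)⟩
    | succ n ih =>
      intro hn i j hij
      have hn' : ((n : ℝ) + 1) * ε ≤ 3 := by push_cast at hn; nlinarith
      obtain ⟨-, -, hcell⟩ := hedge n hn' (ih hn')
      have hlev : ((i + j : ℕ) + 1 : ℝ) * ε ≤ 3 := by
        have : ((i + j : ℕ) : ℝ) ≤ (n + 1 : ℕ) := by exact_mod_cast hij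
        nlinarith
      constructor
      · cases i with
        | zero =>
          simp only [hleft, Prod.fst_zero, sub_zero]
          exact hbase _ _ _ H₁ h₁ h0₁ hlev
        | succ i =>
          refine hstep n _ _ _ _ _ H₁ _ i j (i + 1) j h₁ ?_ (hcell i j (by omega)) rfl rfl
            (hζ₁ i j) ?_ (ih hn' i j (by omega)).1
          · rw [hgrid]; simp [abs_of_pos hε, hε.le]
          · rw [hrec]; simp; ring
      · cases j with
        | zero =>
          simp only [hbot, Prod.snd_zero, sub_zero]
          exact hbase _ _ _ H₂ h₂ h0₂ hlev
        | succ j =>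
          refine hstep n _ _ _ _ _ H₂ _ i j i (j + 1) h₂ ?_ (hcell i j (by omega)) rfl rfl
            (hζ₂ i j) ?_ (ih hn' i j (by omega)).2
          · rw [hgrid]; simp [abs_of_pos hε, hε.le]
          · rw [hrec]; simp; ring
  refine ⟨e, ζ, hrec, fun i j => Prod.ext (hζ₁ i j) (hζ₂ i j), fun i j hij => ?_⟩
  obtain ⟨-, hnorm, hcell⟩ := hedge (i + j) hij (hmain (i + j) hij)
  have hZle : Z (i + j) ≤ 16 * L * Real.exp (63 * L) := by
    have h1 : q ≤ Real.exp (21 * L * ε) := by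
      have := Real.add_one_le_exp (21 * L * ε)
      linarith
    have h2 : q ^ (i + j) ≤ Real.exp (63 * L) := by
      refine (pow_le_pow_left₀ (by linarith) h1 (i + j)).trans ?_
      rw [← Real.exp_nat_mul, Real.exp_le_exp]
      have h3 : ((i + j : ℕ) : ℝ) * ε ≤ 3 := by nlinarith
      nlinarith
    exact mul_le_mul_of_nonneg_left h2 (by positivity)
  constructor
  · refine (hnorm i j (by omega)).trans ?_
    have h1 : 0 < ε ^ 2 := by positivity
    have h2 : 0 ≤ 16 * L * Real.exp (63 * L) := by positivity
    nlinarith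
  · refine (hcell i j le_rfl).trans ?_
    nlinarith

/-- The determinant of three vectors of `ℝ³`. -/
def det3 (a b c : E3) : ℝ := dot3 (cross3 a b) c

theorem det3_eq (a b c : E3) : det3 a b c = (a 1 * b 2 - a 2 * b 1) * c 0 +
    (a 2 * b 0 - a 0 * b 2) * c 1 + (a 0 * b 1 - a 1 * b 0) * c 2 := by
  simp [det3, dot3, cross3]

/-- The determinant of the Gram matrix of two vectors. -/
def gram (a b : E3) : ℝ := dot3 a a * dot3 b b - dot3 a b ^ 2

/-- The cospherical defect of the quadrilateral `s a + t b + ε s t m`, `s, t = ± 1`, divided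
by a suitable power of `ε`. -/
def circDefect (ε : ℝ) (a b m : E3) : ℝ :=
  dot3 a b * gram a b - ε ^ 2 *
    (dot3 b m * (dot3 a m * dot3 b b - dot3 b m * dot3 a b) +
      dot3 a m * (dot3 b m * dot3 a a - dot3 a m * dot3 a b))

theorem norm_sq_eq_dot3 (x : E3) : ‖x‖ ^ 2 = dot3 x x := by
  rw [EuclideanSpace.norm_sq_eq, Fin.sum_univ_three]
  simp only [dot3, Real.norm_eq_abs, sq_abs]
  ring

theorem dot3_add_left (x y z : E3) : dot3 (x + y) z = dot3 x z + dot3 y z := by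
  simp only [dot3, PiLp.add_apply]; ring

theorem dot3_smul_left (r : ℝ) (x z : E3) : dot3 (r • x) z = r * dot3 x z := by
  simp only [dot3, PiLp.smul_apply, smul_eq_mul]; ring

theorem dot3_comm (x y : E3) : dot3 x y = dot3 y x := by
  simp only [dot3]; ring

theorem dot3_add_right (x y z : E3) : dot3 x (y + z) = dot3 x y + dot3 x z := by
  simp only [dot3, PiLp.add_apply]; ring

theorem dot3_smul_right (r : ℝ) (x z : E3) : dot3 x (r • z) = r * dot3 x z := by
  simp only [dot3, PiLp.smul_apply, smul_eq_mul]; ring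

theorem gram_ne_zero_of_linearIndependent {a b : E3} (h : LinearIndependent ℝ ![a, b]) :
    gram a b ≠ 0 := by
  intro h0
  rw [LinearIndependent.pair_iff] at h
  have key : dot3 (dot3 b b • a + (-dot3 a b) • b) (dot3 b b • a + (-dot3 a b) • b) = 0 := by
    have : dot3 (dot3 b b • a + (-dot3 a b) • b) (dot3 b b • a + (-dot3 a b) • b)
        = dot3 b b * gram a b := by
      simp only [dot3_add_left, dot3_add_right, dot3_smul_left, dot3_smul_right, gram,
        dot3_comm b a]
      ring
    rw [this, h0, mul_zero]
  rw [← norm_sq_eq_dot3, sq_eq_zero_iff, norm_eq_zero] at key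
  obtain ⟨hbb, -⟩ := h _ _ key
  rw [← norm_sq_eq_dot3, sq_eq_zero_iff, norm_eq_zero] at hbb
  have := (h 0 1 (by simp [hbb])).2
  norm_num at this

theorem smul_eq_of_det3_eq_zero {a b m : E3} (h : det3 a b m = 0) :
    gram a b • m = (dot3 a m * dot3 b b - dot3 b m * dot3 a b) • a +
      (dot3 b m * dot3 a a - dot3 a m * dot3 a b) • b := by
  rw [det3_eq] at h
  ext i
  simp only [gram, dot3, PiLp.add_apply, PiLp.smul_apply, smul_eq_mul]
  fin_cases i
  · simp only [Fin.zero_eta]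
    linear_combination (a 1 * b 2 - a 2 * b 1) * h
  · simp only [Fin.mk_one]
    linear_combination (a 2 * b 0 - a 0 * b 2) * h
  · simp only [Fin.reduceFinMk]
    linear_combination (a 0 * b 1 - a 1 * b 0) * h

theorem concyclic_of_defects_eq_zero {ε : ℝ} {M a b m : E3} (hgram : gram a b ≠ 0)
    (hdet : det3 a b m = 0) (hcirc : circDefect ε a b m = 0) :
    EuclideanGeometry.Concyclic
      ({M - ε • a - ε • b + ε ^ 2 • m, M + ε • a - ε • b - ε ^ 2 • m,
        M + ε • a + ε • b + ε ^ 2 • m, M - ε • a + ε • b - ε ^ 2 • m} : Set E3) := by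
  have hm := smul_eq_of_det3_eq_zero hdet
  set Γ := gram a b with hΓ
  set p := dot3 a m * dot3 b b - dot3 b m * dot3 a b with hp
  set r := dot3 b m * dot3 a a - dot3 a m * dot3 a b with hr
  have hm' : m = (p / Γ) • a + (r / Γ) • b := by
    rw [div_eq_inv_mul, div_eq_inv_mul, mul_smul, mul_smul, ← smul_add, ← hm, smul_smul,
      inv_mul_cancel₀ hgram, one_smul]
  constructor
  · set y : E3 := ((dot3 b m * dot3 b b - dot3 a m * dot3 a b) / Γ) • a +
      ((dot3 a m * dot3 a a - dot3 b m * dot3 a b) / Γ) • b with hy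
    have hya : dot3 y a = dot3 b m := by
      rw [hy, dot3_add_left, dot3_smul_left, dot3_smul_left, dot3_comm b a]
      field_simp
      rw [hΓ, gram]; ring
    have hyb : dot3 y b = dot3 a m := by
      rw [hy, dot3_add_left, dot3_smul_left, dot3_smul_left]
      field_simp
      rw [hΓ, gram]; ring
    have hym : ε ^ 2 * dot3 y m = dot3 a b := by
      have e1 : dot3 y m = (p / Γ) * dot3 b m + (r / Γ) * dot3 a m := by
        conv_lhs => rw [hm']
        rw [dot3_add_right, dot3_smul_right, dot3_smul_right, hya, hyb]
      rw [e1]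
      rw [circDefect, ← hp, ← hr, ← hΓ] at hcirc
      field_simp
      linarith
    refine ⟨M + ε ^ 2 • y, √(ε ^ 2 * (dot3 a a + dot3 b b) + ε ^ 4 * (dot3 m m + dot3 y y)), ?_⟩
    have key : ∀ x : E3, dot3 (x - (M + ε ^ 2 • y)) (x - (M + ε ^ 2 • y)) =
        ε ^ 2 * (dot3 a a + dot3 b b) + ε ^ 4 * (dot3 m m + dot3 y y) →
        dist x (M + ε ^ 2 • y) =
          √(ε ^ 2 * (dot3 a a + dot3 b b) + ε ^ 4 * (dot3 m m + dot3 y y)) := by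
      intro x hx
      rw [dist_eq_norm, ← hx, ← norm_sq_eq_dot3, Real.sqrt_sq (norm_nonneg _)]
    simp only [dot3] at hya hyb hym
    intro x hx
    apply key
    simp only [Set.mem_insert_iff, Set.mem_singleton_iff] at hx
    rcases hx with rfl | rfl | rfl | rfl <;>
      simp only [dot3, PiLp.add_apply, PiLp.sub_apply, PiLp.smul_apply, smul_eq_mul]
    · linear_combination (2 * ε ^ 3) * hya + (2 * ε ^ 3) * hyb - (2 * ε ^ 2) * hym
    · linear_combination (-2 * ε ^ 3) * hya + (2 * ε ^ 3) * hyb + (2 * ε ^ 2) * hym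
    · linear_combination (-2 * ε ^ 3) * hya - (2 * ε ^ 3) * hyb - (2 * ε ^ 2) * hym
    · linear_combination (2 * ε ^ 3) * hya - (2 * ε ^ 3) * hyb + (2 * ε ^ 2) * hym
  · have ha : a ∈ Submodule.span ℝ ({a, b} : Set E3) := Submodule.subset_span (by simp)
    have hb : b ∈ Submodule.span ℝ ({a, b} : Set E3) := Submodule.subset_span (by simp)
    have hmm : m ∈ Submodule.span ℝ ({a, b} : Set E3) := by
      rw [hm']
      exact Submodule.add_mem _ (Submodule.smul_mem _ _ ha) (Submodule.smul_mem _ _ hb)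
    have hle : vectorSpan ℝ ({M - ε • a - ε • b + ε ^ 2 • m, M + ε • a - ε • b - ε ^ 2 • m,
        M + ε • a + ε • b + ε ^ 2 • m, M - ε • a + ε • b - ε ^ 2 • m} : Set E3)
        ≤ Submodule.span ℝ ({a, b} : Set E3) := by
      have hin : ∀ x ∈ ({M - ε • a - ε • b + ε ^ 2 • m, M + ε • a - ε • b - ε ^ 2 • m,
          M + ε • a + ε • b + ε ^ 2 • m, M - ε • a + ε • b - ε ^ 2 • m} : Set E3),
          x - M ∈ Submodule.span ℝ ({a, b} : Set E3) := by
        have ha' := Submodule.smul_mem _ ε ha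
        have hb' := Submodule.smul_mem _ ε hb
        have hm'' := Submodule.smul_mem _ (ε ^ 2) hmm
        intro x hx
        simp only [Set.mem_insert_iff, Set.mem_singleton_iff] at hx
        rcases hx with rfl | rfl | rfl | rfl
        · convert Submodule.add_mem _ (Submodule.neg_mem _ (Submodule.add_mem _ ha' hb')) hm'' using 1
          abel
        · convert Submodule.sub_mem _ (Submodule.sub_mem _ ha' hb') hm'' using 1
          abel
        · convert Submodule.add_mem _ (Submodule.add_mem _ ha' hb') hm'' using 1
          abel
        · convert Submodule.sub_mem _ (Submodule.sub_mem _ hb' ha') hm'' using 1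
          abel
      rw [vectorSpan, Submodule.span_le]
      rintro _ ⟨x, hx, y, hy, rfl⟩
      have := Submodule.sub_mem _ (hin x hx) (hin y hy)
      simpa using this
    refine (Submodule.rank_mono hle).trans ((rank_span_le _).trans ?_)
    refine (Cardinal.mk_insert_le).trans ?_
    rw [Cardinal.mk_singleton]
    norm_num

section CellFunctions

open Set
open scoped ContDiff

/-- The deviation, divided by `ε`, of the vertex `(s, t)` of a quadrilateral from its centre,
where `s, t = ± 1` and the argument is `(ε, w)`. -/
def cellOffset (s t : ℝ) (q : ℝ × CellParam) : ℝ × ℝ :=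
  s • q.2.2.1 + t • q.2.2.2.1 + (q.1 * (s * t)) • q.2.2.2.2

/-- The vertex `(s, t)` of the parameter quadrilateral with coordinates `w` at scale `ε`. -/
def cellVertex (s t : ℝ) (q : ℝ × CellParam) : ℝ × ℝ := q.2.1 + q.1 • cellOffset s t q

/-- The second-order Taylor remainder of `F` at the vertex `(s, t)`, divided by `ε ^ 2`. -/
def cellRemainder (F : ℝ × ℝ → E3) (s t : ℝ) (q : ℝ × CellParam) : E3 :=
  taylorAverage (fderiv ℝ (fderiv ℝ F)) (q.2.1, q.1 • cellOffset s t q)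
    (cellOffset s t q) (cellOffset s t q)

/-- The mean of the four vertices of the image of a parameter quadrilateral. -/
def cellMean (F : ℝ × ℝ → E3) (q : ℝ × CellParam) : E3 :=
  F q.2.1 + (q.1 ^ 2 / 4) • (cellRemainder F 1 1 q + cellRemainder F 1 (-1) q +
    cellRemainder F (-1) 1 q + cellRemainder F (-1) (-1) q)

/-- The first midline vector of the image of a parameter quadrilateral, divided by `2 ε`. -/
def cellFst (F : ℝ × ℝ → E3) (q : ℝ × CellParam) : E3 :=
  fderiv ℝ F q.2.1 q.2.2.1 + (q.1 / 4) • (cellRemainder F 1 1 q + cellRemainder F 1 (-1) q -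
    cellRemainder F (-1) 1 q - cellRemainder F (-1) (-1) q)

/-- The second midline vector of the image of a parameter quadrilateral, divided by `2 ε`. -/
def cellSnd (F : ℝ × ℝ → E3) (q : ℝ × CellParam) : E3 :=
  fderiv ℝ F q.2.1 q.2.2.2.1 + (q.1 / 4) • (cellRemainder F 1 1 q - cellRemainder F 1 (-1) q +
    cellRemainder F (-1) 1 q - cellRemainder F (-1) (-1) q)

/-- The mixed second difference of the image of a parameter quadrilateral, divided by
`4 ε ^ 2`. -/
def cellMix (F : ℝ × ℝ → E3) (q : ℝ × CellParam) : E3 :=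
  fderiv ℝ F q.2.1 q.2.2.2.2 + (1 / 4 : ℝ) • (cellRemainder F 1 1 q - cellRemainder F 1 (-1) q -
    cellRemainder F (-1) 1 q + cellRemainder F (-1) (-1) q)

variable {F : ℝ × ℝ → E3}

theorem contDiff_cellRemainder (hF : ContDiff ℝ ∞ F) (s t : ℝ) :
    ContDiff ℝ ∞ (cellRemainder F s t) := by
  have h1 : ContDiff ℝ ∞ (fderiv ℝ (fderiv ℝ F)) :=
    (hF.fderiv_right (m := ∞) (by simp)).fderiv_right (m := ∞) (by simp)
  have h2 : ContDiff ℝ ∞ (cellOffset s t) := by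
    unfold cellOffset; fun_prop
  have h3 : ContDiff ℝ ∞ fun q : ℝ × CellParam => (q.2.1, q.1 • cellOffset s t q) := by
    fun_prop
  exact (((contDiff_taylorAverage h1).comp h3).clm_apply h2).clm_apply h2

theorem contDiff_fderiv_cellParam (hF : ContDiff ℝ ∞ F) {X : ℝ × CellParam → ℝ × ℝ}
    (hX : ContDiff ℝ ∞ X) : ContDiff ℝ ∞ fun q : ℝ × CellParam => fderiv ℝ F q.2.1 (X q) := by
  have h1 : ContDiff ℝ ∞ (fderiv ℝ F) := hF.fderiv_right (m := ∞) (by simp)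
  have h3 : ContDiff ℝ ∞ fun q : ℝ × CellParam => q.2.1 := by fun_prop
  exact (h1.comp h3).clm_apply hX

theorem contDiff_cellFst (hF : ContDiff ℝ ∞ F) : ContDiff ℝ ∞ (cellFst F) := by
  have hR := contDiff_cellRemainder hF
  have := contDiff_fderiv_cellParam hF (X := fun q => q.2.2.1) (by fun_prop)
  unfold cellFst
  fun_prop

theorem contDiff_cellSnd (hF : ContDiff ℝ ∞ F) : ContDiff ℝ ∞ (cellSnd F) := by
  have hR := contDiff_cellRemainder hF
  have := contDiff_fderiv_cellParam hF (X := fun q => q.2.2.2.1) (by fun_prop)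
  unfold cellSnd
  fun_prop

theorem contDiff_cellMix (hF : ContDiff ℝ ∞ F) : ContDiff ℝ ∞ (cellMix F) := by
  have hR := contDiff_cellRemainder hF
  have := contDiff_fderiv_cellParam hF (X := fun q => q.2.2.2.2) (by fun_prop)
  unfold cellMix
  fun_prop

theorem cellOffset_neg (s t ε : ℝ) (w : CellParam) :
    cellOffset s t (-ε, w) = -cellOffset (-s) (-t) (ε, w) := by
  simp only [cellOffset, neg_smul, neg_mul, mul_neg, neg_neg]
  abel

theorem cellRemainder_neg (F : ℝ × ℝ → E3) (s t ε : ℝ) (w : CellParam) :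
    cellRemainder F s t (-ε, w) = cellRemainder F (-s) (-t) (ε, w) := by
  simp [cellRemainder, cellOffset_neg]

theorem cellFst_neg (F : ℝ × ℝ → E3) (ε : ℝ) (w : CellParam) :
    cellFst F (-ε, w) = cellFst F (ε, w) := by
  simp only [cellFst, cellRemainder_neg, neg_neg]
  module

theorem cellSnd_neg (F : ℝ × ℝ → E3) (ε : ℝ) (w : CellParam) :
    cellSnd F (-ε, w) = cellSnd F (ε, w) := by
  simp only [cellSnd, cellRemainder_neg, neg_neg]
  module

theorem cellMix_neg (F : ℝ × ℝ → E3) (ε : ℝ) (w : CellParam) :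
    cellMix F (-ε, w) = cellMix F (ε, w) := by
  simp only [cellMix, cellRemainder_neg, neg_neg]
  module

theorem apply_cellVertex (hF : ContDiff ℝ ∞ F) (s t : ℝ) (q : ℝ × CellParam) :
    F (cellVertex s t q) = F q.2.1 + (q.1 * s) • fderiv ℝ F q.2.1 q.2.2.1 +
      (q.1 * t) • fderiv ℝ F q.2.1 q.2.2.2.1 + (q.1 ^ 2 * (s * t)) • fderiv ℝ F q.2.1 q.2.2.2.2 +
      q.1 ^ 2 • cellRemainder F s t q := by
  rw [cellVertex, eq_add_taylorAverage hF]
  simp only [map_smul, smul_apply, cellRemainder]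
  nth_rewrite 1 [cellOffset]
  simp only [map_add, map_smul]
  module

theorem apply_cellVertex_eq (hF : ContDiff ℝ ∞ F) (ε : ℝ) (w : CellParam) :
    F (cellVertex (-1) (-1) (ε, w)) = cellMean F (ε, w) - ε • cellFst F (ε, w) -
        ε • cellSnd F (ε, w) + ε ^ 2 • cellMix F (ε, w) ∧
      F (cellVertex 1 (-1) (ε, w)) = cellMean F (ε, w) + ε • cellFst F (ε, w) -
        ε • cellSnd F (ε, w) - ε ^ 2 • cellMix F (ε, w) ∧
      F (cellVertex 1 1 (ε, w)) = cellMean F (ε, w) + ε • cellFst F (ε, w) +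
        ε • cellSnd F (ε, w) + ε ^ 2 • cellMix F (ε, w) ∧
      F (cellVertex (-1) 1 (ε, w)) = cellMean F (ε, w) - ε • cellFst F (ε, w) +
        ε • cellSnd F (ε, w) - ε ^ 2 • cellMix F (ε, w) := by
  refine ⟨?_, ?_, ?_, ?_⟩ <;>
  · rw [apply_cellVertex hF]
    simp only [cellMean, cellFst, cellSnd, cellMix]
    module

theorem fderiv_apply_eq_pd (F : ℝ × ℝ → E3) (c X : ℝ × ℝ) :
    fderiv ℝ F c X = X.1 • pd1 F c + X.2 • pd2 F c := by
  have : X = X.1 • ((1, 0) : ℝ × ℝ) + X.2 • ((0, 1) : ℝ × ℝ) := by ext <;> simp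
  conv_lhs => rw [this]
  simp only [map_add, map_smul, pd1, pd2]

theorem fderiv_fderiv_apply_eq_pd (hF : ContDiff ℝ ∞ F) (c X Y : ℝ × ℝ) :
    fderiv ℝ (fderiv ℝ F) c X Y = (X.1 * Y.1) • pd1 (pd1 F) c +
      (X.1 * Y.2 + X.2 * Y.1) • pd2 (pd1 F) c + (X.2 * Y.2) • pd2 (pd2 F) c := by
  have hd : DifferentiableAt ℝ (fderiv ℝ F) c :=
    (hF.fderiv_right (m := ∞) (by simp)).differentiable (by simp) c
  have happ : ∀ a b : ℝ × ℝ, fderiv ℝ (fun p => fderiv ℝ F p a) c b =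
      fderiv ℝ (fderiv ℝ F) c b a := by
    intro a b
    rw [fderiv_clm_apply hd (differentiableAt_const a)]
    simp
  have hsymm : fderiv ℝ (fderiv ℝ F) c (1, 0) (0, 1) = fderiv ℝ (fderiv ℝ F) c (0, 1) (1, 0) :=
    (hF.contDiffAt.isSymmSndFDerivAt (by simp [ENat.LEInfty.out])).eq _ _
  have h1 : pd1 (pd1 F) c = fderiv ℝ (fderiv ℝ F) c (1, 0) (1, 0) := happ _ _
  have h2 : pd2 (pd1 F) c = fderiv ℝ (fderiv ℝ F) c (0, 1) (1, 0) := happ _ _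
  have h3 : pd2 (pd2 F) c = fderiv ℝ (fderiv ℝ F) c (0, 1) (0, 1) := happ _ _
  rw [h1, h2, h3]
  have hX : X = X.1 • ((1, 0) : ℝ × ℝ) + X.2 • ((0, 1) : ℝ × ℝ) := by ext <;> simp
  have hY : Y = Y.1 • ((1, 0) : ℝ × ℝ) + Y.2 • ((0, 1) : ℝ × ℝ) := by ext <;> simp
  conv_lhs => rw [hX, hY]
  simp only [map_add, map_smul, add_apply, smul_apply,
    hsymm]
  module

theorem cellFst_zero (F : ℝ × ℝ → E3) (w : CellParam) :
    cellFst F (0, w) = w.2.1.1 • pd1 F w.1 + w.2.1.2 • pd2 F w.1 := by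
  simp [cellFst, fderiv_apply_eq_pd]

theorem cellSnd_zero (F : ℝ × ℝ → E3) (w : CellParam) :
    cellSnd F (0, w) = w.2.2.1.1 • pd1 F w.1 + w.2.2.1.2 • pd2 F w.1 := by
  simp [cellSnd, fderiv_apply_eq_pd]

theorem cellMix_zero (hF : ContDiff ℝ ∞ F) (w : CellParam) :
    cellMix F (0, w) = w.2.2.2.1 • pd1 F w.1 + w.2.2.2.2 • pd2 F w.1 +
      ((w.2.1.1 * w.2.2.1.1) • pd1 (pd1 F) w.1 +
        (w.2.1.1 * w.2.2.1.2 + w.2.1.2 * w.2.2.1.1) • pd2 (pd1 F) w.1 +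
        (w.2.1.2 * w.2.2.1.2) • pd2 (pd2 F) w.1) := by
  simp only [cellMix, cellRemainder, zero_smul, taylorAverage_zero, cellOffset, zero_mul, add_zero,
    fderiv_apply_eq_pd, smul_apply, fderiv_fderiv_apply_eq_pd hF, Prod.fst_add,
    Prod.snd_add, Prod.smul_fst, Prod.smul_snd, smul_eq_mul]
  module

end CellFunctions

section CellEquations

open Set
open scoped ContDiff

variable {Y : Type} [NormedAddCommGroup Y] [NormedSpace ℝ Y]

theorem contDiff_dot3 {a b : Y → E3} (ha : ContDiff ℝ ∞ a) (hb : ContDiff ℝ ∞ b) :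
    ContDiff ℝ ∞ fun y => dot3 (a y) (b y) := by
  have := contDiff_euclidean.1 ha
  have := contDiff_euclidean.1 hb
  unfold dot3
  fun_prop

theorem contDiff_gram {a b : Y → E3} (ha : ContDiff ℝ ∞ a) (hb : ContDiff ℝ ∞ b) :
    ContDiff ℝ ∞ fun y => gram (a y) (b y) := by
  have := contDiff_dot3 ha ha
  have := contDiff_dot3 hb hb
  have := contDiff_dot3 ha hb
  unfold gram
  fun_prop

theorem contDiff_det3 {a b c : Y → E3} (ha : ContDiff ℝ ∞ a) (hb : ContDiff ℝ ∞ b)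
    (hc : ContDiff ℝ ∞ c) : ContDiff ℝ ∞ fun y => det3 (a y) (b y) (c y) := by
  have := contDiff_euclidean.1 ha
  have := contDiff_euclidean.1 hb
  have := contDiff_euclidean.1 hc
  simp only [det3_eq]
  fun_prop

theorem contDiff_circDefect {ε : Y → ℝ} {a b m : Y → E3} (hε : ContDiff ℝ ∞ ε)
    (ha : ContDiff ℝ ∞ a) (hb : ContDiff ℝ ∞ b) (hm : ContDiff ℝ ∞ m) :
    ContDiff ℝ ∞ fun y => circDefect (ε y) (a y) (b y) (m y) := by
  have := contDiff_dot3 ha ha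
  have := contDiff_dot3 hb hb
  have := contDiff_dot3 ha hb
  have := contDiff_dot3 ha hm
  have := contDiff_dot3 hb hm
  have := contDiff_gram ha hb
  unfold circDefect
  fun_prop

theorem contDiff_pd1 {F : ℝ × ℝ → E3} (hF : ContDiff ℝ ∞ F) : ContDiff ℝ ∞ (pd1 F) :=
  (hF.fderiv_right (m := ∞) (by simp)).clm_apply contDiff_const

theorem contDiff_pd2 {F : ℝ × ℝ → E3} (hF : ContDiff ℝ ∞ F) : ContDiff ℝ ∞ (pd2 F) :=
  (hF.fderiv_right (m := ∞) (by simp)).clm_apply contDiff_const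

/-- The area of the parallelogram spanned by the scaled edge directions. -/
def cellJac (w : CellParam) : ℝ := w.2.1.1 * w.2.2.1.2 - w.2.2.1.1 * w.2.1.2

/-- The coefficient `⟨F_u, F_u⟩` of the first fundamental form. -/
def firstE (F : ℝ × ℝ → E3) (p : ℝ × ℝ) : ℝ := dot3 (pd1 F p) (pd1 F p)

/-- The coefficient `⟨F_v, F_v⟩` of the first fundamental form. -/
def firstG (F : ℝ × ℝ → E3) (p : ℝ × ℝ) : ℝ := dot3 (pd2 F p) (pd2 F p)

/-- The coefficient `L` of the second fundamental form, up to normalization. -/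
def secondL (F : ℝ × ℝ → E3) (p : ℝ × ℝ) : ℝ := det3 (pd1 F p) (pd2 F p) (pd1 (pd1 F) p)

/-- The coefficient `N` of the second fundamental form, up to normalization. -/
def secondN (F : ℝ × ℝ → E3) (p : ℝ × ℝ) : ℝ := det3 (pd1 F p) (pd2 F p) (pd2 (pd2 F) p)

/-- The points at which `F` is an orthogonal conjugate immersion without umbilics. -/
structure IsRegularCurvaturePoint (F : ℝ × ℝ → E3) (p : ℝ × ℝ) : Prop where
  orth : dot3 (pd1 F p) (pd2 F p) = 0
  conj : det3 (pd1 F p) (pd2 F p) (pd2 (pd1 F) p) = 0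
  firstE_ne : firstE F p ≠ 0
  firstG_ne : firstG F p ≠ 0
  umbilic : firstG F p * secondL F p - secondN F p * firstE F p ≠ 0

/-- The coplanarity defect of the image of a parameter quadrilateral. -/
def cellDet (F : ℝ × ℝ → E3) (q : ℝ × CellParam) : ℝ :=
  det3 (cellFst F q) (cellSnd F q) (cellMix F q)

/-- The cospherical defect of the image of a parameter quadrilateral. -/
def cellCirc (F : ℝ × ℝ → E3) (q : ℝ × CellParam) : ℝ :=
  circDefect q.1 (cellFst F q) (cellSnd F q) (cellMix F q)

/-- The combination of the two defects whose leading term is the first coordinate of the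
second edge direction. -/
def cellEqFst (F : ℝ × ℝ → E3) (q : ℝ × CellParam) : ℝ :=
  (firstG F q.2.1 * (firstE F q.2.1 * firstG F q.2.1) * cellJac q.2 * cellDet F q -
      secondN F q.2.1 * cellCirc F q) /
    (cellJac q.2 ^ 2 * (firstE F q.2.1 * firstG F q.2.1) *
      (firstG F q.2.1 * secondL F q.2.1 - secondN F q.2.1 * firstE F q.2.1) * q.2.2.1.1)

/-- The combination of the two defects whose leading term is the second coordinate of the
first edge direction. -/
def cellEqSnd (F : ℝ × ℝ → E3) (q : ℝ × CellParam) : ℝ :=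
  (secondL F q.2.1 * cellCirc F q -
      firstE F q.2.1 * (firstE F q.2.1 * firstG F q.2.1) * cellJac q.2 * cellDet F q) /
    (cellJac q.2 ^ 2 * (firstE F q.2.1 * firstG F q.2.1) *
      (firstG F q.2.1 * secondL F q.2.1 - secondN F q.2.1 * firstE F q.2.1) * q.2.2.2.1.2)

/-- The coordinates of the cells near the square ones with centre in `V`. -/
def regularCells (V : Set (ℝ × ℝ)) : Set CellParam :=
  {w | w.1 ∈ V ∧ cellJac w ≠ 0 ∧ w.2.1.1 ≠ 0 ∧ w.2.2.1.2 ≠ 0}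

variable {F : ℝ × ℝ → E3} {V : Set (ℝ × ℝ)}

theorem isOpen_regularCells (hV : IsOpen V) : IsOpen (regularCells V) := by
  refine (hV.preimage continuous_fst).inter (IsOpen.inter ?_ (IsOpen.inter ?_ ?_))
  · exact isOpen_ne_fun (by unfold cellJac; fun_prop) continuous_const
  · exact isOpen_ne_fun (by fun_prop) continuous_const
  · exact isOpen_ne_fun (by fun_prop) continuous_const

theorem cellDet_zero (hF : ContDiff ℝ ∞ F) {w : CellParam} (h : IsRegularCurvaturePoint F w.1) :
    cellDet F (0, w) = cellJac w * (secondL F w.1 * (w.2.1.1 * w.2.2.1.1) +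
      secondN F w.1 * (w.2.1.2 * w.2.2.1.2)) := by
  have hc := h.conj
  simp only [cellDet, cellFst_zero, cellSnd_zero, cellMix_zero hF, cellJac, secondL, secondN,
    det3_eq, PiLp.add_apply, PiLp.smul_apply, smul_eq_mul] at hc ⊢
  linear_combination (w.2.1.1 * w.2.2.1.2 - w.2.2.1.1 * w.2.1.2) *
    (w.2.1.1 * w.2.2.1.2 + w.2.1.2 * w.2.2.1.1) * hc

theorem gram_cell_zero {w : CellParam} (h : IsRegularCurvaturePoint F w.1) :
    gram (cellFst F (0, w)) (cellSnd F (0, w)) =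
      cellJac w ^ 2 * (firstE F w.1 * firstG F w.1) := by
  have ho := h.orth
  have ho' : dot3 (pd2 F w.1) (pd1 F w.1) = 0 := by rw [dot3_comm, ho]
  simp only [gram, cellFst_zero, cellSnd_zero, dot3_add_left, dot3_add_right, dot3_smul_left,
    dot3_smul_right, ho, ho', cellJac, firstE, firstG]
  ring

theorem cellCirc_zero {w : CellParam} (h : IsRegularCurvaturePoint F w.1) :
    cellCirc F (0, w) = (firstE F w.1 * (w.2.1.1 * w.2.2.1.1) +
      firstG F w.1 * (w.2.1.2 * w.2.2.1.2)) *
      (cellJac w ^ 2 * (firstE F w.1 * firstG F w.1)) := by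
  have ho := h.orth
  have ho' : dot3 (pd2 F w.1) (pd1 F w.1) = 0 := by rw [dot3_comm, ho]
  simp only [cellCirc, circDefect, gram_cell_zero h]
  simp only [cellFst_zero, cellSnd_zero, dot3_add_left, dot3_add_right, dot3_smul_left,
    dot3_smul_right, ho, ho', firstE, firstG]
  ring

theorem cellEqFst_zero (hF : ContDiff ℝ ∞ F) (hreg : ∀ p ∈ V, IsRegularCurvaturePoint F p)
    {w : CellParam} (hw : w ∈ regularCells V) : cellEqFst F (0, w) = w.2.2.1.1 := by
  obtain ⟨h1, h2, h3, h4⟩ := hw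
  have h := hreg _ h1
  have := h.firstE_ne
  have := h.firstG_ne
  have := h.umbilic
  rw [cellEqFst, cellDet_zero hF h, cellCirc_zero h, div_eq_iff (by simp_all)]
  ring

theorem cellEqSnd_zero (hF : ContDiff ℝ ∞ F) (hreg : ∀ p ∈ V, IsRegularCurvaturePoint F p)
    {w : CellParam} (hw : w ∈ regularCells V) : cellEqSnd F (0, w) = w.2.1.2 := by
  obtain ⟨h1, h2, h3, h4⟩ := hw
  have h := hreg _ h1
  have := h.firstE_ne
  have := h.firstG_ne
  have := h.umbilic
  rw [cellEqSnd, cellDet_zero hF h, cellCirc_zero h, div_eq_iff (by simp_all)]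
  ring

theorem cellEqFst_neg (F : ℝ × ℝ → E3) (ε : ℝ) (w : CellParam) :
    cellEqFst F (-ε, w) = cellEqFst F (ε, w) := by
  simp [cellEqFst, cellDet, cellCirc, circDefect, cellFst_neg, cellSnd_neg, cellMix_neg]

theorem cellEqSnd_neg (F : ℝ × ℝ → E3) (ε : ℝ) (w : CellParam) :
    cellEqSnd F (-ε, w) = cellEqSnd F (ε, w) := by
  simp [cellEqSnd, cellDet, cellCirc, circDefect, cellFst_neg, cellSnd_neg, cellMix_neg]

theorem contDiffOn_cellEq (hF : ContDiff ℝ ∞ F) (hreg : ∀ p ∈ V, IsRegularCurvaturePoint F p) :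
    ContDiffOn ℝ ∞ (cellEqFst F) (univ ×ˢ regularCells V) ∧
      ContDiffOn ℝ ∞ (cellEqSnd F) (univ ×ˢ regularCells V) := by
  have hp : ContDiff ℝ ∞ fun q : ℝ × CellParam => q.2.1 := by fun_prop
  have h1 := contDiff_pd1 hF
  have h2 := contDiff_pd2 hF
  have hE : ContDiff ℝ ∞ fun q : ℝ × CellParam => firstE F q.2.1 := (contDiff_dot3 h1 h1).comp hp
  have hG : ContDiff ℝ ∞ fun q : ℝ × CellParam => firstG F q.2.1 := (contDiff_dot3 h2 h2).comp hp
  have hL : ContDiff ℝ ∞ fun q : ℝ × CellParam => secondL F q.2.1 :=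
    (contDiff_det3 h1 h2 (contDiff_pd1 h1)).comp hp
  have hN : ContDiff ℝ ∞ fun q : ℝ × CellParam => secondN F q.2.1 :=
    (contDiff_det3 h1 h2 (contDiff_pd2 h2)).comp hp
  have hJ : ContDiff ℝ ∞ fun q : ℝ × CellParam => cellJac q.2 := by
    unfold cellJac; fun_prop
  have ha := contDiff_cellFst hF
  have hb := contDiff_cellSnd hF
  have hm := contDiff_cellMix hF
  have hd : ContDiff ℝ ∞ (cellDet F) := contDiff_det3 ha hb hm
  have hc : ContDiff ℝ ∞ (cellCirc F) := contDiff_circDefect contDiff_fst ha hb hm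
  constructor
  · refine ContDiffOn.div (ContDiff.contDiffOn (by fun_prop)) (ContDiff.contDiffOn (by fun_prop)) ?_
    rintro ⟨ε, w⟩ ⟨-, hw1, hw2, hw3, hw4⟩
    have h := hreg _ hw1
    have := h.firstE_ne
    have := h.firstG_ne
    have := h.umbilic
    simp_all
  · refine ContDiffOn.div (ContDiff.contDiffOn (by fun_prop)) (ContDiff.contDiffOn (by fun_prop)) ?_
    rintro ⟨ε, w⟩ ⟨-, hw1, hw2, hw3, hw4⟩
    have h := hreg _ hw1
    have := h.firstE_ne
    have := h.firstG_ne
    have := h.umbilic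
    simp_all

theorem defects_eq_zero_of_cellEq_eq_zero (hreg : ∀ p ∈ V, IsRegularCurvaturePoint F p)
    {ε : ℝ} {w : CellParam} (hw : w ∈ regularCells V) (h1 : cellEqFst F (ε, w) = 0)
    (h2 : cellEqSnd F (ε, w) = 0) : cellDet F (ε, w) = 0 ∧ cellCirc F (ε, w) = 0 := by
  obtain ⟨hw1, hw2, hw3, hw4⟩ := hw
  have h := hreg _ hw1
  have hE := h.firstE_ne
  have hG := h.firstG_ne
  have hU := h.umbilic
  rw [cellEqFst, div_eq_zero_iff, or_iff_left (by simp_all)] at h1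
  rw [cellEqSnd, div_eq_zero_iff, or_iff_left (by simp_all)] at h2
  dsimp only at h1 h2
  constructor
  · have : (firstG F w.1 * secondL F w.1 - secondN F w.1 * firstE F w.1) *
        (firstE F w.1 * firstG F w.1 * cellJac w) * cellDet F (ε, w) = 0 := by
      linear_combination secondL F w.1 * h1 + secondN F w.1 * h2
    simpa [hE, hG, hU, hw2] using this
  · have : (firstG F w.1 * secondL F w.1 - secondN F w.1 * firstE F w.1) *
        cellCirc F (ε, w) = 0 := by
      linear_combination firstE F w.1 * h1 + firstG F w.1 * h2
    simpa [hU] using this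

/-- An extension to the whole space of the solved form `ε² H` of one cell equation. -/
theorem exists_lipschitz_extension {T P : ℝ × CellParam → ℝ} {K : Set CellParam} {L ε : ℝ}
    (hL : 0 ≤ L) (hε : 0 < ε) (h : ∀ w ∈ K, ∀ w' ∈ K,
      |(T (ε, w) - P (ε, w)) - (T (ε, w') - P (ε, w'))| ≤ L * ‖w - w'‖ * ε ^ 2) :
    ∃ H : CellParam → ℝ, (∀ w w', |H w - H w'| ≤ L * ‖w - w'‖) ∧
      ∀ w ∈ K, T (ε, w) - P (ε, w) = -(ε ^ 2 * H w) := by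
  have hε2 : 0 < ε ^ 2 := by positivity
  have hlip : LipschitzOnWith L.toNNReal
      (fun w => -(T (ε, w) - P (ε, w)) / ε ^ 2) K := by
    refine LipschitzOnWith.of_dist_le_mul fun w hw w' hw' => ?_
    rw [Real.dist_eq, dist_eq_norm, Real.coe_toNNReal _ hL, ← sub_div, abs_div, abs_of_pos hε2,
      div_le_iff₀ hε2, neg_sub_neg, abs_sub_comm]
    exact h w hw w' hw'
  obtain ⟨H, hH, hHK⟩ := hlip.extend_real
  refine ⟨H, fun w w' => ?_, fun w hw => ?_⟩
  · have := hH.dist_le_mul w w'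
    rwa [Real.dist_eq, dist_eq_norm, Real.coe_toNNReal _ hL] at this
  · rw [← hHK hw]
    field_simp

/-- On a compact convex set of cells, the condition that the image of a cell at scale `ε` is
concyclic can be solved for the two small edge coordinates. -/
theorem exists_cell_equations (hF : ContDiff ℝ ∞ F) (hV : IsOpen V)
    (hreg : ∀ p ∈ V, IsRegularCurvaturePoint F p) {K : Set CellParam} (hK : IsCompact K)
    (hKc : Convex ℝ K) (hKV : K ⊆ regularCells V) :
    ∃ L ≥ 1, ∃ ε₁ > 0, ε₁ ≤ 1 ∧ ∀ ε, 0 < ε → ε < ε₁ → ∃ H₁ H₂ : CellParam → ℝ,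
      (∀ w w', |H₁ w - H₁ w'| ≤ L * ‖w - w'‖) ∧ (∀ w w', |H₂ w - H₂ w'| ≤ L * ‖w - w'‖) ∧
      ∀ w ∈ K, |H₁ w| ≤ L ∧ |H₂ w| ≤ L ∧
        (w.2.2.1.1 = ε ^ 2 * H₁ w → w.2.1.2 = ε ^ 2 * H₂ w →
          EuclideanGeometry.Concyclic ({F (cellVertex (-1) (-1) (ε, w)),
            F (cellVertex 1 (-1) (ε, w)), F (cellVertex 1 1 (ε, w)),
            F (cellVertex (-1) 1 (ε, w))} : Set E3)) := by
  have hO := isOpen_regularCells hV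
  obtain ⟨hs1, hs2⟩ := contDiffOn_cellEq hF hreg
  have hx : ContDiff ℝ ∞ fun q : ℝ × CellParam => q.2.2.2.1.1 := by fun_prop
  have hy : ContDiff ℝ ∞ fun q : ℝ × CellParam => q.2.2.1.2 := by fun_prop
  obtain ⟨L₁, hL₁, hB₁⟩ := exists_lipschitz_of_even hO hK hKc hKV (hs1.sub hx.contDiffOn)
    (fun w hw => by simp [cellEqFst_zero hF hreg hw])
    (fun ε w hw => by simp [cellEqFst_neg])
  obtain ⟨L₂, hL₂, hB₂⟩ := exists_lipschitz_of_even hO hK hKc hKV (hs2.sub hy.contDiffOn)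
    (fun w hw => by simp [cellEqSnd_zero hF hreg hw])
    (fun ε w hw => by simp [cellEqSnd_neg])
  have hgram : ∃ δ > 0, ∀ ε, 0 < ε → ε < δ → ∀ w ∈ K,
      gram (cellFst F (ε, w)) (cellSnd F (ε, w)) ≠ 0 := by
    have hc : Continuous fun q : ℝ × CellParam => gram (cellFst F q) (cellSnd F q) :=
      (contDiff_gram (contDiff_cellFst hF) (contDiff_cellSnd hF)).continuous
    obtain ⟨u, v, hu, -, h0u, hKv, huv⟩ := generalized_tube_lemma (isCompact_singleton (x := (0 : ℝ)))
      hK (isOpen_ne_fun hc continuous_const) (n := {q | gram (cellFst F q) (cellSnd F q) ≠ 0}) (by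
        rintro ⟨ε, w⟩ ⟨rfl, hw⟩
        obtain ⟨hw1, hw2, -, -⟩ := hKV hw
        have h := hreg _ hw1
        simpa [gram_cell_zero h, h.firstE_ne, h.firstG_ne] using hw2)
    obtain ⟨δ, hδ, hball⟩ := Metric.isOpen_iff.1 hu 0 (h0u rfl)
    refine ⟨δ, hδ, fun ε h0 h1 w hw => ?_⟩
    have hm : ((ε, w) : ℝ × CellParam) ∈ u ×ˢ v :=
      ⟨hball (by simpa [abs_of_pos h0] using h1), hKv hw⟩
    exact huv hm
  obtain ⟨δ, hδ, hgram⟩ := hgram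
  set L := max 1 (max L₁ L₂) with hLdef
  have hL1 : 1 ≤ L := le_max_left _ _
  have hL1' : L₁ ≤ L := (le_max_left _ _).trans (le_max_right _ _)
  have hL2' : L₂ ≤ L := (le_max_right _ _).trans (le_max_right _ _)
  refine ⟨L, hL1, min δ 1, by positivity, min_le_right _ _, fun ε h0 h1 => ?_⟩
  have hεI : ε ∈ Icc (0 : ℝ) 1 := ⟨h0.le, (h1.trans_le (min_le_right _ _)).le⟩
  have hε2 : 0 < ε ^ 2 := by positivity
  obtain ⟨H₁, hH₁, hE₁⟩ := exists_lipschitz_extension (T := cellEqFst F)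
    (P := fun q => q.2.2.2.1.1) hL₁ h0 fun w hw w' hw' => (hB₁ ε hεI w hw).2 w' hw'
  obtain ⟨H₂, hH₂, hE₂⟩ := exists_lipschitz_extension (T := cellEqSnd F)
    (P := fun q => q.2.2.1.2) hL₂ h0 fun w hw w' hw' => (hB₂ ε hεI w hw).2 w' hw'
  have hbd : ∀ {T H M : ℝ}, T = -(ε ^ 2 * H) → |T| ≤ M * ε ^ 2 → M ≤ L → |H| ≤ L := by
    intro T H M hT hTM hM
    rw [hT, abs_neg, abs_mul, abs_of_pos hε2, mul_comm] at hTM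
    exact (le_of_mul_le_mul_right hTM hε2).trans hM
  refine ⟨H₁, H₂, fun w w' => (hH₁ w w').trans (by gcongr),
    fun w w' => (hH₂ w w').trans (by gcongr), fun w hw =>
    ⟨hbd (hE₁ w hw) (hB₁ ε hεI w hw).1 hL1', hbd (hE₂ w hw) (hB₂ ε hεI w hw).1 hL2',
      fun hw1 hw2 => ?_⟩⟩
  have e1 := hE₁ w hw
  have e2 := hE₂ w hw
  dsimp only at e1 e2
  obtain ⟨hd, hc⟩ := defects_eq_zero_of_cellEq_eq_zero (ε := ε) hreg (hKV hw)
    (by linarith) (by linarith)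
  obtain ⟨v1, v2, v3, v4⟩ := apply_cellVertex_eq hF ε w
  rw [v1, v2, v3, v4]
  exact concyclic_of_defects_eq_zero (hgram ε h0 (h1.trans_le (min_le_left _ _)) w hw) hd hc

end CellEquations

section Assembly

open Set
open scoped ContDiff Topology

/-- A function smooth on an open set agrees near a closed subset with a smooth function. -/
theorem exists_contDiff_eqOn_open {V B : Type} [NormedAddCommGroup V] [NormedSpace ℝ V]
    [FiniteDimensional ℝ V] [NormedAddCommGroup B] [NormedSpace ℝ B] {Ω S : Set V}
    (hΩ : IsOpen Ω) (hS : IsClosed S) (hSΩ : S ⊆ Ω) {f : V → B} (hf : ContDiffOn ℝ ∞ f Ω) :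
    ∃ F : V → B, ContDiff ℝ ∞ F ∧ ∃ U, IsOpen U ∧ S ⊆ U ∧ U ⊆ Ω ∧ EqOn F f U := by
  obtain ⟨χ, h0, h1, -⟩ := exists_contMDiffMap_zero_one_nhds_of_isClosed (n := (⊤ : ℕ∞))
    (modelWithCornersSelf ℝ V) hΩ.isClosed_compl hS (disjoint_compl_left_iff_subset.2 hSΩ)
  have hχ : ContDiff ℝ ∞ χ := χ.contMDiff.contDiff
  refine ⟨fun x => χ x • f x, contDiff_iff_contDiffAt.2 fun x => ?_,
    Ω ∩ interior {x | χ x = 1}, hΩ.inter isOpen_interior, subset_inter hSΩ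
      (subset_interior_iff_mem_nhdsSet.2 h1), inter_subset_left, fun x hx => ?_⟩
  · by_cases hx : x ∈ Ω
    · exact hχ.contDiffAt.smul (hf.contDiffAt (hΩ.mem_nhds hx))
    · have hz : (fun x => χ x • f x) =ᶠ[𝓝 x] fun _ => 0 :=
        (h0.filter_mono (nhds_le_nhdsSet hx)).mono fun y hy => by simp [hy]
      exact contDiffAt_const.congr_of_eventuallyEq hz
  · have : x ∈ {x | χ x = 1} := interior_subset hx.2
    simp [this.out]

theorem pd1_congr_s9 {f g : ℝ × ℝ → E3} {p : ℝ × ℝ} (h : f =ᶠ[𝓝 p] g) :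
    pd1 f =ᶠ[𝓝 p] pd1 g :=
  (h.fderiv (𝕜 := ℝ)).mono fun x hx => by simp [pd1, hx]

theorem pd2_congr_s9 {f g : ℝ × ℝ → E3} {p : ℝ × ℝ} (h : f =ᶠ[𝓝 p] g) :
    pd2 f =ᶠ[𝓝 p] pd2 g :=
  (h.fderiv (𝕜 := ℝ)).mono fun x hx => by simp [pd2, hx]

theorem IsRegularCurvaturePoint.congr {f g : ℝ × ℝ → E3} {p : ℝ × ℝ}
    (hf : IsRegularCurvaturePoint f p) (h : g =ᶠ[𝓝 p] f) : IsRegularCurvaturePoint g p := by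
  have h1 := (pd1_congr_s9 h).eq_of_nhds
  have h2 := (pd2_congr_s9 h).eq_of_nhds
  have h11 := (pd1_congr_s9 (pd1_congr_s9 h)).eq_of_nhds
  have h12 := (pd2_congr_s9 (pd1_congr_s9 h)).eq_of_nhds
  have h22 := (pd2_congr_s9 (pd2_congr_s9 h)).eq_of_nhds
  obtain ⟨a1, a2, a3, a4, a5⟩ := hf
  constructor <;> simpa only [firstE, firstG, secondL, secondN, h1, h2, h11, h12, h22]

theorem isRegularCurvaturePoint_of_hypotheses {f : ℝ × ℝ → E3} {p : ℝ × ℝ}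
    (hindep : LinearIndependent ℝ ![pd1 f p, pd2 f p]) (horth : dot3 (pd1 f p) (pd2 f p) = 0)
    (hconj : pd2 (pd1 f) p ∈ Submodule.span ℝ ({pd1 f p, pd2 f p} : Set E3))
    (humb : princCurv1 f p ≠ princCurv2 f p) : IsRegularCurvaturePoint f p := by
  have hgram := gram_ne_zero_of_linearIndependent hindep
  rw [gram, horth] at hgram
  have hE : firstE f p ≠ 0 := fun h => hgram (by rw [firstE] at h; rw [h]; ring)
  have hG : firstG f p ≠ 0 := fun h => hgram (by rw [firstG] at h; rw [h]; ring)
  refine ⟨horth, ?_, hE, hG, fun h => humb ?_⟩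
  · obtain ⟨a, b, hab⟩ := Submodule.mem_span_pair.1 hconj
    rw [← hab]
    simp only [det3_eq, PiLp.add_apply, PiLp.smul_apply, smul_eq_mul]
    ring
  · have e1 : princCurv1 f p =
        ‖cross3 (pd1 f p) (pd2 f p)‖⁻¹ * secondL f p / firstE f p := by
      rw [princCurv1, unitNormal, dot3_smul_right, norm_sq_eq_dot3, dot3_comm _ (cross3 _ _)]
      rfl
    have e2 : princCurv2 f p =
        ‖cross3 (pd1 f p) (pd2 f p)‖⁻¹ * secondN f p / firstG f p := by
      rw [princCurv2, unitNormal, dot3_smul_right, norm_sq_eq_dot3, dot3_comm _ (cross3 _ _)]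
      rfl
    rw [e1, e2, div_eq_div_iff hE hG]
    linear_combination ‖cross3 (pd1 f p) (pd2 f p)‖⁻¹ * h

/-- The cells that are `ρ`-close to a square cell with centre in the unit square. -/
def nearSquareCells (ρ : ℝ) : Set CellParam :=
  closedBall (1 / 2, 1 / 2) (1 / 2 + ρ) ×ˢ closedBall (1 / 2, 0) ρ ×ˢ
    closedBall (0, 1 / 2) ρ ×ˢ closedBall 0 ρ

theorem isCompact_nearSquareCells (ρ : ℝ) : IsCompact (nearSquareCells ρ) :=
  (isCompact_closedBall _ _).prod ((isCompact_closedBall _ _).prod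
    ((isCompact_closedBall _ _).prod (isCompact_closedBall _ _)))

theorem convex_nearSquareCells (ρ : ℝ) : Convex ℝ (nearSquareCells ρ) :=
  (convex_closedBall _ _).prod ((convex_closedBall _ _).prod
    ((convex_closedBall _ _).prod (convex_closedBall _ _)))

theorem nearSquareCells_subset_regularCells {ρ : ℝ} (hρ : ρ ≤ 1 / 8) {V : Set (ℝ × ℝ)}
    (hV : closedBall (1 / 2, 1 / 2) (1 / 2 + ρ) ⊆ V) : nearSquareCells ρ ⊆ regularCells V := by
  rintro ⟨c, ⟨x₁, y₁⟩, ⟨x₂, y₂⟩, z⟩ ⟨hc, h1, h2, -⟩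
  simp only [mem_closedBall, dist_eq_norm, Prod.mk_sub_mk, Prod.norm_mk, sup_le_iff,
    Real.norm_eq_abs, sub_zero, abs_le] at h1 h2
  obtain ⟨⟨a1, a2⟩, a3, a4⟩ := h1
  obtain ⟨⟨b1, b2⟩, b3, b4⟩ := h2
  refine ⟨hV hc, ?_, ?_, ?_⟩
  · have : 0 < x₁ * y₂ - x₂ * y₁ := by nlinarith
    exact this.ne'
  · change x₁ ≠ 0
    linarith
  · change y₂ ≠ 0
    linarith

theorem mem_nearSquareCells {ρ : ℝ} {c : ℝ × ℝ} {w : CellParam}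
    (hc : c ∈ closedBall ((1 / 2, 1 / 2) : ℝ × ℝ) (1 / 2)) (hw : ‖w - squareCell c‖ ≤ ρ) :
    w ∈ nearSquareCells ρ := by
  simp only [squareCell, Prod.norm_def, Prod.fst_sub, Prod.snd_sub, sup_le_iff] at hw
  obtain ⟨h1, h2, h3, h4⟩ := hw
  refine ⟨?_, ?_, ?_, ?_⟩
  · rw [mem_closedBall] at hc ⊢
    have : dist w.1 c ≤ ρ := by
      rw [dist_eq_norm, Prod.norm_def]; exact sup_le h1.1 h1.2
    linarith [dist_triangle w.1 c (1 / 2, 1 / 2)]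
  · rw [mem_closedBall, dist_eq_norm, Prod.norm_def]; exact sup_le h2.1 h2.2
  · rw [mem_closedBall, dist_eq_norm, Prod.norm_def]; exact sup_le h3.1 h3.2
  · rw [mem_closedBall, dist_eq_norm, Prod.norm_def]; exact sup_le h4.1 h4.2

theorem unitSquare_eq_closedBall :
    Icc (0 : ℝ) 1 ×ˢ Icc (0 : ℝ) 1 = closedBall ((1 / 2, 1 / 2) : ℝ × ℝ) (1 / 2) := by
  rw [← closedBall_prod_same, Real.closedBall_eq_Icc]
  norm_num

theorem cellVertex_displacedCell {ε : ℝ} (hε : ε ≠ 0) (i j : ℕ) (e00 e10 e01 ζ : ℝ × ℝ) :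
    cellVertex (-1) (-1) (ε, displacedCell ε (cellCentre ε i j) e00 e10 e01 ζ) =
        (i * ε, j * ε) + e00 ∧
      cellVertex 1 (-1) (ε, displacedCell ε (cellCentre ε i j) e00 e10 e01 ζ) =
        ((i + 1 : ℕ) * ε, j * ε) + e10 ∧
      cellVertex 1 1 (ε, displacedCell ε (cellCentre ε i j) e00 e10 e01 ζ) =
        ((i + 1 : ℕ) * ε, (j + 1 : ℕ) * ε) + (e10 + e01 - e00 + (4 * ε ^ 2) • ζ) ∧
      cellVertex (-1) 1 (ε, displacedCell ε (cellCentre ε i j) e00 e10 e01 ζ) =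
        (i * ε, (j + 1 : ℕ) * ε) + e01 := by
  refine ⟨?_, ?_, ?_, ?_⟩ <;> ext <;>
  · simp [cellVertex, cellOffset, displacedCell, cellCentre]
    field_simp
    ring

theorem mem_unitSquare_of_le_floor {ε : ℝ} (hε : 0 < ε) {i j : ℕ} (hi : i ≤ ⌊1 / ε⌋₊)
    (hj : j ≤ ⌊1 / ε⌋₊) : ((i * ε, j * ε) : ℝ × ℝ) ∈ Icc (0 : ℝ) 1 ×ˢ Icc (0 : ℝ) 1 := by
  have key : ∀ k : ℕ, k ≤ ⌊1 / ε⌋₊ → (k : ℝ) * ε ≤ 1 := fun k hk =>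
    (le_div_iff₀ hε).1 ((Nat.le_floor_iff (by positivity)).1 hk)
  exact ⟨⟨by positivity, key i hi⟩, by positivity, key j hj⟩

theorem cellCentre_mem_unitSquare {ε : ℝ} (hε : 0 < ε) {i j : ℕ} (hi : i < ⌊1 / ε⌋₊)
    (hj : j < ⌊1 / ε⌋₊) : cellCentre ε i j ∈ Icc (0 : ℝ) 1 ×ˢ Icc (0 : ℝ) 1 := by
  obtain ⟨⟨-, h1⟩, -, h2⟩ := mem_unitSquare_of_le_floor hε (Nat.succ_le_of_lt hi)
    (Nat.succ_le_of_lt hj)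
  push_cast at h1 h2
  simp only [cellCentre]
  exact ⟨⟨by positivity, by dsimp only; linarith⟩, by positivity, by dsimp only; linarith⟩

theorem exists_lipschitz_const_closedBall {F : ℝ × ℝ → E3} (hF : ContDiff ℝ ∞ F) (c : ℝ × ℝ)
    (r : ℝ) : ∃ C > 0, ∀ x ∈ closedBall c r, ∀ y ∈ closedBall c r,
      ‖F y - F x‖ ≤ C * ‖y - x‖ := by
  obtain ⟨C, hC⟩ := (isCompact_closedBall c r).exists_bound_of_continuousOn
    (hF.continuous_fderiv (by simp)).continuousOn
  refine ⟨max C 1, by positivity, fun x hx y hy => ?_⟩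
  exact (convex_closedBall c r).norm_image_sub_le_of_norm_fderiv_le
    (fun z _ => hF.differentiable (by simp) z) (fun z hz => (hC z hz).trans (le_max_left _ _)) hx hy

theorem exists_closedBall_subset_of_isOpen {V : Set (ℝ × ℝ)} (hV : IsOpen V)
    (hsq : Icc (0 : ℝ) 1 ×ˢ Icc (0 : ℝ) 1 ⊆ V) :
    ∃ ρ, 0 < ρ ∧ ρ ≤ 1 / 8 ∧ closedBall ((1 / 2, 1 / 2) : ℝ × ℝ) (1 / 2 + ρ) ⊆ V := by
  rw [unitSquare_eq_closedBall] at hsq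
  obtain ⟨δ, hδ, h⟩ := (isCompact_closedBall _ _).exists_cthickening_subset_open hV hsq
  rw [cthickening_closedBall hδ.le (by norm_num)] at h
  refine ⟨min δ (1 / 8), by positivity, min_le_right _ _, (closedBall_subset_closedBall ?_).trans h⟩
  linarith [min_le_left δ (1 / 8)]

end Assembly

/-- For a smooth surface parametrized by curvature lines without umbilic points, defined
on an open set containing the unit square, there is a discrete circular net (all elementary
quadrilaterals concyclic: coplanar and cospherical) with all vertices on the surface
`f(Ω)` which is `ε²`-close to the smooth net: `‖g(i,j) − f(iε, jε)‖ ≤ C₀ ε²`. -/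
theorem exists_discrete_circular_net_on_surface_eps2_close
    (Ω : Set (ℝ × ℝ)) (hΩ : IsOpen Ω) (hsq : Set.Icc (0 : ℝ) 1 ×ˢ Set.Icc (0 : ℝ) 1 ⊆ Ω)
    (f : ℝ × ℝ → E3)
    (hf : ContDiffOn ℝ (⊤ : ℕ∞) f Ω)
    (hindep : ∀ p ∈ Ω, LinearIndependent ℝ ![pd1 f p, pd2 f p])
    (horth : ∀ p ∈ Ω, dot3 (pd1 f p) (pd2 f p) = 0)
    (hconj : ∀ p ∈ Ω, pd2 (pd1 f) p ∈ Submodule.span ℝ ({pd1 f p, pd2 f p} : Set E3))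
    (humb : ∀ p ∈ Ω, princCurv1 f p ≠ princCurv2 f p) :
    ∃ C₀ > (0 : ℝ), ∃ ε₀ > (0 : ℝ), ∀ ε : ℝ, 0 < ε → ε < ε₀ →
      ∃ g : ℕ → ℕ → E3,
        (∀ i j : ℕ, i ≤ ⌊1 / ε⌋₊ → j ≤ ⌊1 / ε⌋₊ → g i j ∈ f '' Ω) ∧
        (∀ i j : ℕ, i < ⌊1 / ε⌋₊ → j < ⌊1 / ε⌋₊ →
          EuclideanGeometry.Concyclic
            ({g i j, g (i + 1) j, g (i + 1) (j + 1), g i (j + 1)} : Set E3)) ∧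
        (∀ i j : ℕ, i ≤ ⌊1 / ε⌋₊ → j ≤ ⌊1 / ε⌋₊ →
          ‖g i j - f (i * ε, j * ε)‖ ≤ C₀ * ε ^ 2) := by
  obtain ⟨F, hF, V, hV, hsqV, hVΩ, hFf⟩ := exists_contDiff_eqOn_open hΩ
    (isClosed_Icc.prod isClosed_Icc) hsq hf
  have hreg : ∀ p ∈ V, IsRegularCurvaturePoint F p := fun p hp =>
    (isRegularCurvaturePoint_of_hypotheses (hindep p (hVΩ hp)) (horth p (hVΩ hp))
      (hconj p (hVΩ hp)) (humb p (hVΩ hp))).congr (hFf.eventuallyEq_of_mem (hV.mem_nhds hp))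
  obtain ⟨ρ, hρ, hρ8, hball⟩ := exists_closedBall_subset_of_isOpen hV hsqV
  obtain ⟨L, hL, ε₁, hε₁, hε₁1, hcell⟩ := exists_cell_equations hF hV hreg
    (isCompact_nearSquareCells ρ) (convex_nearSquareCells ρ)
    (nearSquareCells_subset_regularCells hρ8 hball)
  obtain ⟨C, hC, hlip⟩ := exists_lipschitz_const_closedBall hF (1 / 2, 1 / 2) (1 / 2 + ρ)
  set A := 80 * L * Real.exp (63 * L) with hA
  have hL0 : 0 < L := by linarith
  have hA0 : 0 < A := by positivity
  refine ⟨C * A, by positivity, min ε₁ (min (ρ / A) (1 / (16 * L))), by positivity,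
    fun ε h0 hlt => ?_⟩
  simp only [lt_min_iff, lt_div_iff₀ hA0, lt_div_iff₀ (show 0 < 16 * L by positivity)] at hlt
  obtain ⟨hlt1, hlt2, hlt3⟩ := hlt
  have hε1 : ε ≤ 1 := hlt1.le.trans hε₁1
  obtain ⟨H₁, H₂, hH₁, hH₂, hK⟩ := hcell ε h0 hlt1
  have hbase : squareCell 0 ∈ nearSquareCells ρ := by
    refine mem_nearSquareCells (c := 0) ?_ (by simpa using hρ.le)
    rw [← unitSquare_eq_closedBall]
    exact ⟨by simp, by simp⟩
  obtain ⟨e, ζ, he, hζ, hest⟩ := exists_small_displacement hL h0 hε1 (by linarith) hH₁ hH₂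
    (hK _ hbase).1 (hK _ hbase).2.1
  rw [← hA] at hest
  have hsum : ∀ {i j : ℕ}, i ≤ ⌊1 / ε⌋₊ → j ≤ ⌊1 / ε⌋₊ → ((i + j : ℕ) + 1 : ℝ) * ε ≤ 3 := by
    intro i j hi hj
    obtain ⟨⟨-, h1⟩, -, h2⟩ := mem_unitSquare_of_le_floor h0 hi hj
    dsimp only at h1 h2
    push_cast
    linarith
  have hsq' : ∀ {i j : ℕ}, i ≤ ⌊1 / ε⌋₊ → j ≤ ⌊1 / ε⌋₊ →
      ((i * ε, j * ε) : ℝ × ℝ) ∈ closedBall ((1 / 2, 1 / 2) : ℝ × ℝ) (1 / 2 + ρ) ∧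
      ((i * ε, j * ε) : ℝ × ℝ) + e i j ∈ closedBall ((1 / 2, 1 / 2) : ℝ × ℝ) (1 / 2 + ρ) := by
    intro i j hi hj
    have h1 := mem_unitSquare_of_le_floor h0 hi hj
    rw [unitSquare_eq_closedBall, mem_closedBall] at h1
    have h2 := (hest i j (hsum hi hj)).1
    have h3 : dist (((i * ε, j * ε) : ℝ × ℝ) + e i j) (i * ε, j * ε) ≤ ρ := by
      rw [dist_eq_norm, add_sub_cancel_left]
      nlinarith
    refine ⟨?_, ?_⟩ <;> rw [mem_closedBall]
    · linarith
    · linarith [dist_triangle (((i * ε, j * ε) : ℝ × ℝ) + e i j) (i * ε, j * ε) (1 / 2, 1 / 2)]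
  have hgF : ∀ {i j : ℕ}, i ≤ ⌊1 / ε⌋₊ → j ≤ ⌊1 / ε⌋₊ →
      f (((i * ε, j * ε) : ℝ × ℝ) + e i j) = F (((i * ε, j * ε) : ℝ × ℝ) + e i j) :=
    fun hi hj => (hFf (hball (hsq' hi hj).2)).symm
  refine ⟨fun i j => f (((i * ε, j * ε) : ℝ × ℝ) + e i j), fun i j hi hj =>
    ⟨_, hVΩ (hball (hsq' hi hj).2), rfl⟩, fun i j hi hj => ?_, fun i j hi hj => ?_⟩
  · have hw := (hest i j (hsum hi.le hj.le)).2
    have hζij := hζ i j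
    obtain ⟨v1, v2, v3, v4⟩ := cellVertex_displacedCell h0.ne' i j (e i j) (e (i + 1) j)
      (e i (j + 1)) (ζ i j)
    rw [← he] at v3
    have hX₂ : (displacedCell ε (cellCentre ε i j) (e i j) (e (i + 1) j) (e i (j + 1))
        (ζ i j)).2.2.1.1 = (1 / (2 * ε)) * ((e i (j + 1)).1 - (e i j).1) + ε * (ζ i j).1 := by
      simp [displacedCell]
    have hX₁ : (displacedCell ε (cellCentre ε i j) (e i j) (e (i + 1) j) (e i (j + 1))
        (ζ i j)).2.1.2 = (1 / (2 * ε)) * ((e (i + 1) j).2 - (e i j).2) + ε * (ζ i j).2 := by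
      simp [displacedCell]
    set w := displacedCell ε (cellCentre ε i j) (e i j) (e (i + 1) j) (e i (j + 1)) (ζ i j)
    have hwK : w ∈ nearSquareCells ρ := by
      refine mem_nearSquareCells ?_ (hw.trans (by linarith))
      rw [← unitSquare_eq_closedBall]
      exact cellCentre_mem_unitSquare h0 hi hj
    have hconc := (hK w hwK).2.2
      (by rw [hX₂, congrArg Prod.fst hζij]; field_simp; ring)
      (by rw [hX₁, congrArg Prod.snd hζij]; field_simp; ring)
    rw [v1, v2, v3, v4] at hconc
    dsimp only
    rwa [hgF hi.le hj.le, hgF hi hj.le, hgF hi hj, hgF hi.le hj]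
  · dsimp only
    rw [hgF hi hj, ← hFf (hball (hsq' hi hj).1)]
    refine (hlip _ (hsq' hi hj).1 _ (hsq' hi hj).2).trans ?_
    rw [add_sub_cancel_left, mul_assoc]
    exact mul_le_mul_of_nonneg_left (hest i j (hsum hi hj)).1 hC.le

end
end
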